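/- Let n ≥ 1, δ > (n-1)/2, p ∈ (0,∞) with 2n/(n+1+2δ) ≤ p, and let ω ∈ A_{p(n+1+2δ)/(2n)}(ℝ^n). Then there exists a constant C > 0 such that for every Schwartz function f on ℝ^n, ‖B^δ_*(f)‖_{WL^p_ω} ≤ C ‖M(f,Φ)‖_{L^p_ω}; that is, the maximal Bochner–Riesz means of order δ is bounded from the weighted Hardy space H^p_ω(ℝ^n) to the weighted weak Lebesgue space WL^p_ω(ℝ^n). -/

import Mathlib

noncomputable section

open MeasureTheory Real Set
open scoped ENNReal NNReal

abbrev En (n : ℕ) : Type := EuclideanSpace ℝ (Fin n)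

/-- The Bochner–Riesz kernel of order `δ`: the Fourier transform of `ξ ↦ ((1-|ξ|²)⁺)^δ`. -/
def brKernel (n : ℕ) (δ : ℝ) (x : En n) : ℂ :=
  ∫ ξ : En n, (((max (1 - ‖ξ‖ ^ 2) 0) ^ δ : ℝ) : ℂ) *
    Complex.exp (-(2 * Real.pi) * Complex.I * ((∑ i, x i * ξ i : ℝ) : ℂ))

/-- The dilated kernel `φ_ε(x) = ε^{-n} φ(x/ε)`. -/
def brKernelDil (n : ℕ) (δ ε : ℝ) (x : En n) : ℂ :=
  (ε ^ n)⁻¹ • brKernel n δ (ε⁻¹ • x)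

/-- The Bochner–Riesz means `B^δ_{1/ε} f = f * φ_ε`. -/
def brMeans (n : ℕ) (δ ε : ℝ) (f : En n → ℂ) (x : En n) : ℂ :=
  ∫ y, f y * brKernelDil n δ ε (x - y)

/-- The maximal Bochner–Riesz means `B^δ_* f`. -/
def brMax (n : ℕ) (δ : ℝ) (f : En n → ℂ) (x : En n) : ℝ≥0∞ :=
  ⨆ (ε : ℝ) (_ : 0 < ε), (‖brMeans n δ ε f x‖₊ : ℝ≥0∞)

/-- The radial maximal function `M(f,Φ)(x) = sup_{t>0} |(Φ_t * f)(x)|`. -/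
def radMax (n : ℕ) (Φ : En n → ℂ) (f : En n → ℂ) (x : En n) : ℝ≥0∞ :=
  ⨆ (t : ℝ) (_ : 0 < t), (‖∫ y, (t ^ n)⁻¹ • Φ (t⁻¹ • (x - y)) * f y‖₊ : ℝ≥0∞)

/-- Average of `ω` over the ball `B(x,r)`. -/
def ballAvg (n : ℕ) (ω : En n → ℝ≥0∞) (x : En n) (r : ℝ) : ℝ≥0∞ :=
  (volume (Metric.ball x r))⁻¹ * ∫⁻ y in Metric.ball x r, ω y

/-- The Muckenhoupt class `A_1(ℝ^n)`. -/
def IsA1 (n : ℕ) (ω : En n → ℝ≥0∞) : Prop :=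
  ∃ C : ℝ≥0∞, C < ⊤ ∧ ∀ (x : En n) (r : ℝ), 0 < r →
    ballAvg n ω x r * essSup (fun y => (ω y)⁻¹) (volume.restrict (Metric.ball x r)) ≤ C

/-- The Muckenhoupt class `A_p(ℝ^n)` for `p ∈ (1,∞)`. -/
def IsApGT1 (n : ℕ) (p : ℝ) (ω : En n → ℝ≥0∞) : Prop :=
  ∃ C : ℝ≥0∞, C < ⊤ ∧ ∀ (x : En n) (r : ℝ), 0 < r →
    ballAvg n ω x r * (ballAvg n (fun y => ω y ^ (1/(1-p))) x r) ^ (p - 1) ≤ C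

/-- The Muckenhoupt class `A_p(ℝ^n)` for `p ∈ [1,∞)`. -/
def IsAp (n : ℕ) (p : ℝ) (ω : En n → ℝ≥0∞) : Prop :=
  if p = 1 then IsA1 n ω else IsApGT1 n p ω

/-- The weighted Lebesgue quasinorm `‖g‖_{L^p_ω}` (of a nonnegative function). -/
def wLp (n : ℕ) (ω : En n → ℝ≥0∞) (p : ℝ) (g : En n → ℝ≥0∞) : ℝ≥0∞ :=
  (∫⁻ x, g x ^ p * ω x) ^ (1/p)

/-- The weighted weak Lebesgue quasinorm `‖g‖_{WL^p_ω}`. -/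
def wWLp (n : ℕ) (ω : En n → ℝ≥0∞) (p : ℝ) (g : En n → ℝ≥0∞) : ℝ≥0∞ :=
  ⨆ (α : ℝ≥0) (_ : 0 < α),
    (α : ℝ≥0∞) * (∫⁻ x in {x | (α : ℝ≥0∞) < g x}, ω x) ^ (1/p)

namespace BR

/-! ### Vitali covering and maximal functions -/

lemma vitali_core {n : ℕ} (S : Set (En n)) (c : En n → En n) (r : En n → ℝ) (R : ℝ)
    (hr : ∀ x ∈ S, 0 < r x ∧ r x ≤ R ∧ x ∈ Metric.ball (c x) (r x)) :
    ∃ u ⊆ S, u.Countable ∧ u.PairwiseDisjoint (fun x => Metric.ball (c x) (r x)) ∧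
      S ⊆ ⋃ x ∈ u, Metric.ball (c x) (5 * r x) := by
  obtain ⟨u, huS, hd, hc⟩ := Vitali.exists_disjoint_subfamily_covering_enlargement_ball S c r R
    (fun a ha => (hr a ha).2.1) 5 (by norm_num)
  refine ⟨u, huS, ?_, hd, ?_⟩
  · refine hd.countable_of_isOpen (fun a _ => Metric.isOpen_ball) ?_
    intro a ha
    exact ⟨c a, Metric.mem_ball_self (hr a (huS ha)).1⟩
  · intro x hx
    obtain ⟨b, hb, hsub⟩ := hc x hx
    simp only [mem_iUnion]
    exact ⟨b, hb, hsub (hr x hx).2.2⟩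

lemma vitali_measure_bdd {n : ℕ} (μ ν : Measure (En n)) (D : ℝ≥0∞)
    (hD : ∀ c r, 0 < r → μ (Metric.ball c (5 * r)) ≤ D * μ (Metric.ball c r))
    (S : Set (En n)) (R : ℝ)
    (h : ∀ x ∈ S, ∃ c r, 0 < r ∧ r ≤ R ∧ x ∈ Metric.ball c r ∧
      μ (Metric.ball c r) ≤ ν (Metric.ball c r)) :
    μ S ≤ D * ν univ := by
  choose! c r h1 h2 h3 h4 using h
  obtain ⟨u, huS, hcount, hd, hcov⟩ := vitali_core S c r R (fun x hx => ⟨h1 x hx, h2 x hx, h3 x hx⟩)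
  calc μ S ≤ μ (⋃ x ∈ u, Metric.ball (c x) (5 * r x)) := measure_mono hcov
    _ ≤ ∑' x : u, μ (Metric.ball (c x) (5 * r x)) := measure_biUnion_le _ hcount _
    _ ≤ ∑' x : u, D * ν (Metric.ball (c x) (r x)) := by
        refine ENNReal.tsum_le_tsum fun x => (hD _ _ (h1 x (huS x.2))).trans ?_
        exact mul_le_mul_right (h4 x (huS x.2)) D
    _ = D * ∑' x : u, ν (Metric.ball (c x) (r x)) := ENNReal.tsum_mul_left
    _ = D * ν (⋃ x ∈ u, Metric.ball (c x) (r x)) := by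
        rw [measure_biUnion hcount hd (fun _ _ => Metric.isOpen_ball.measurableSet)]
    _ ≤ D * ν univ := by gcongr; exact subset_univ _

lemma vitali_measure {n : ℕ} (μ ν : Measure (En n)) (D : ℝ≥0∞)
    (hD : ∀ c r, 0 < r → μ (Metric.ball c (5 * r)) ≤ D * μ (Metric.ball c r))
    (S : Set (En n))
    (h : ∀ x ∈ S, ∃ c r, 0 < r ∧ x ∈ Metric.ball c r ∧
      μ (Metric.ball c r) ≤ ν (Metric.ball c r)) :
    μ S ≤ D * ν univ := by
  let T : ℕ → Set (En n) := fun N => {x ∈ S | ∃ (c : En n) (r : ℝ), 0 < r ∧ r ≤ N ∧ x ∈ Metric.ball c r ∧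
      μ (Metric.ball c r) ≤ ν (Metric.ball c r)}
  have hT : S ⊆ ⋃ N, T N := by
    intro x hx
    obtain ⟨c, r, h1, h2, h3⟩ := h x hx
    obtain ⟨N, hN⟩ := exists_nat_ge r
    exact mem_iUnion.2 ⟨N, hx, c, r, h1, hN, h2, h3⟩
  have hmono : Monotone T := by
    intro N M hNM x hx
    obtain ⟨hx, c, r, h1, h2, h3⟩ := hx
    exact ⟨hx, c, r, h1, h2.trans (by exact_mod_cast hNM), h3⟩
  calc μ S ≤ μ (⋃ N, T N) := measure_mono hT
    _ = ⨆ N, μ (T N) := hmono.measure_iUnion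
    _ ≤ D * ν univ := iSup_le fun N => vitali_measure_bdd μ ν D hD (T N) N (fun x hx => hx.2)

/-- Uncentred maximal function with respect to `μ`. -/
def Mx {n : ℕ} (μ : Measure (En n)) (h : En n → ℝ≥0∞) (x : En n) : ℝ≥0∞ :=
  ⨆ (c : En n) (r : ℝ) (_ : 0 < r) (_ : x ∈ Metric.ball c r),
    (μ (Metric.ball c r))⁻¹ * ∫⁻ y in Metric.ball c r, h y ∂μ

lemma lt_Mx_iff {n : ℕ} (μ : Measure (En n)) (h : En n → ℝ≥0∞) (x : En n) (a : ℝ≥0∞) :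
    a < Mx μ h x ↔ ∃ c r, 0 < r ∧ x ∈ Metric.ball c r ∧
      a < (μ (Metric.ball c r))⁻¹ * ∫⁻ y in Metric.ball c r, h y ∂μ := by
  simp only [Mx, lt_iSup_iff, exists_prop]

lemma le_Mx {n : ℕ} (μ : Measure (En n)) (h : En n → ℝ≥0∞) (x c : En n) (r : ℝ) (hr : 0 < r)
    (hx : x ∈ Metric.ball c r) :
    (μ (Metric.ball c r))⁻¹ * ∫⁻ y in Metric.ball c r, h y ∂μ ≤ Mx μ h x := by
  unfold Mx
  exact le_iSup_of_le c (le_iSup_of_le r (le_iSup_of_le hr (le_iSup_of_le hx le_rfl)))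

lemma isOpen_lt_Mx {n : ℕ} (μ : Measure (En n)) (h : En n → ℝ≥0∞) (a : ℝ≥0∞) :
    IsOpen {x | a < Mx μ h x} := by
  rw [isOpen_iff_forall_mem_open]
  intro x hx
  obtain ⟨c, r, h1, h2, h3⟩ := (lt_Mx_iff μ h x a).1 hx
  exact ⟨Metric.ball c r, fun y hy => (lt_Mx_iff μ h y a).2 ⟨c, r, h1, hy, h3⟩,
    Metric.isOpen_ball, h2⟩

lemma measurable_Mx {n : ℕ} (μ : Measure (En n)) (h : En n → ℝ≥0∞) : Measurable (Mx μ h) :=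
  measurable_of_Ioi fun a => (isOpen_lt_Mx μ h a).measurableSet

/-- A measure which is doubling, positive and finite on balls. -/
structure Dbl {n : ℕ} (μ : Measure (En n)) (D : ℝ≥0∞) : Prop where
  dbl : ∀ c r, 0 < r → μ (Metric.ball c (5 * r)) ≤ D * μ (Metric.ball c r)
  pos : ∀ c r, 0 < r → 0 < μ (Metric.ball c r)
  fin : ∀ c r, 0 < r → μ (Metric.ball c r) < ⊤

lemma Mx_weak {n : ℕ} {μ : Measure (En n)} {D : ℝ≥0∞} (hμ : Dbl μ D) (h : En n → ℝ≥0∞)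
    (hh : Measurable h) (a : ℝ≥0∞) (ha : a ≠ 0) (ha' : a ≠ ⊤) :
    μ {x | a < Mx μ h x} ≤ D * (a⁻¹ * ∫⁻ y, h y ∂μ) := by
  have := vitali_measure μ (a⁻¹ • μ.withDensity h) D hμ.dbl {x | a < Mx μ h x} ?_
  · simpa [withDensity_apply _ MeasurableSet.univ] using this
  · intro x hx
    obtain ⟨c, r, h1, h2, h3⟩ := (lt_Mx_iff μ h x a).1 hx
    refine ⟨c, r, h1, h2, ?_⟩
    rw [Measure.smul_apply, withDensity_apply _ Metric.isOpen_ball.measurableSet, smul_eq_mul]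
    have hp := (hμ.pos c r h1).ne'
    have hf := (hμ.fin c r h1).ne
    rw [mul_comm, ← div_eq_mul_inv, ENNReal.lt_div_iff_mul_lt (Or.inl hp) (Or.inl hf)] at h3
    rw [← ENNReal.div_eq_inv_mul, ENNReal.le_div_iff_mul_le (Or.inl ha) (Or.inl ha'), mul_comm]
    exact h3.le

lemma exists_zpow_two {v : ℝ≥0∞} (h0 : v ≠ 0) (ht : v ≠ ⊤) :
    ∃ k : ℤ, (2 : ℝ≥0∞) ^ k < v ∧ v ≤ (2 : ℝ≥0∞) ^ (k + 1) :=
  ENNReal.exists_mem_Ioc_zpow h0 ht (by norm_num) (by norm_num)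

/-- the constant in `dyadic_sum_le`. -/
def dyC (p : ℝ) : ℝ≥0∞ := (1 - (2 : ℝ≥0∞) ^ (-p))⁻¹

lemma dyC_lt_top {p : ℝ} (hp : 0 < p) : dyC p < ⊤ := by
  unfold dyC
  rw [ENNReal.inv_lt_top, tsub_pos_iff_lt]
  exact ENNReal.rpow_lt_one_of_one_lt_of_neg (by norm_num) (by linarith)

lemma zpow_two_mono {a b : ℤ} (h : a ≤ b) : (2 : ℝ≥0∞) ^ a ≤ (2 : ℝ≥0∞) ^ b :=
  ENNReal.zpow_le_of_le (by norm_num) h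

lemma dyadic_sum_le {p : ℝ} (hp : 0 < p) (v : ℝ≥0∞) :
    ∑' k : ℤ, (if (2 : ℝ≥0∞) ^ k < v then ((2 : ℝ≥0∞) ^ k) ^ p else 0) ≤ dyC p * v ^ p := by
  rcases eq_or_ne v 0 with rfl | h0
  · simp
  rcases eq_or_ne v ⊤ with rfl | ht
  · rw [ENNReal.top_rpow_of_pos hp, ENNReal.mul_top]
    · exact le_top
    · unfold dyC
      rw [ENNReal.inv_ne_zero]
      exact ((tsub_le_self).trans_lt ENNReal.one_lt_top).ne
  obtain ⟨k0, hk1, hk2⟩ := exists_zpow_two h0 ht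
  have hinj : Function.Injective (fun m : ℕ => k0 - (m : ℤ)) := by
    intro a b hab; simp at hab; exact hab
  rw [← hinj.tsum_eq]
  · calc ∑' m : ℕ, (if (2 : ℝ≥0∞) ^ (k0 - (m : ℤ)) < v then ((2 : ℝ≥0∞) ^ (k0 - (m : ℤ))) ^ p else 0)
        ≤ ∑' m : ℕ, ((2 : ℝ≥0∞) ^ k0) ^ p * ((2 : ℝ≥0∞) ^ (-p)) ^ m := by
          refine ENNReal.tsum_le_tsum fun m => ?_
          split_ifs
          · apply le_of_eq
            rw [← ENNReal.rpow_natCast, ← ENNReal.rpow_intCast, ← ENNReal.rpow_intCast,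
              ← ENNReal.rpow_mul, ← ENNReal.rpow_mul, ← ENNReal.rpow_mul,
              ← ENNReal.rpow_add _ _ (by norm_num) (by norm_num)]
            congr 1
            push_cast; ring
          · exact zero_le
      _ = ((2 : ℝ≥0∞) ^ k0) ^ p * dyC p := by
          rw [ENNReal.tsum_mul_left, ENNReal.tsum_geometric]; rfl
      _ ≤ dyC p * v ^ p := by
          rw [mul_comm]; gcongr
  · intro k hk
    simp only [Function.mem_support, ne_eq, ite_eq_right_iff, not_forall] at hk
    obtain ⟨hk, -⟩ := hk
    have : k ≤ k0 := by
      by_contra hcon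
      have : k0 + 1 ≤ k := by omega
      exact absurd (hk.trans_le hk2) (not_lt.2 (zpow_two_mono this))
    exact ⟨(k0 - k).toNat, by simp; omega⟩

lemma sq_le_dyadic (v : ℝ≥0∞) :
    v ^ 2 ≤ ∑' k : ℤ, (if (2 : ℝ≥0∞) ^ k < v then 4 * ((2 : ℝ≥0∞) ^ k) ^ 2 else 0) := by
  rcases eq_or_ne v 0 with rfl | h0
  · simp
  rcases eq_or_ne v ⊤ with rfl | ht
  · have h2 : ∀ k : ℤ, (2 : ℝ≥0∞) ^ k < ⊤ := fun k =>
      ENNReal.zpow_lt_top (by norm_num) (by norm_num) k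
    simp only [h2, if_true]
    refine le_trans le_top (le_trans (b := ∑' k : ℕ, (1 : ℝ≥0∞)) (by simp) ?_)
    have hinj : Function.Injective (fun m : ℕ => (m : ℤ)) := Nat.cast_injective
    refine le_trans ?_ (ENNReal.tsum_comp_le_tsum_of_injective hinj _)
    refine ENNReal.tsum_le_tsum fun m => ?_
    have : (1 : ℝ≥0∞) ≤ (2 : ℝ≥0∞) ^ (m : ℤ) := by
      rw [zpow_natCast]; exact one_le_pow₀ (by norm_num)
    calc (1 : ℝ≥0∞) = 1 * 1 ^ 2 := by simp
      _ ≤ _ := by gcongr; norm_num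
  obtain ⟨k0, hk1, hk2⟩ := exists_zpow_two h0 ht
  refine le_trans ?_ (ENNReal.le_tsum k0)
  rw [if_pos hk1]
  calc v ^ 2 ≤ ((2 : ℝ≥0∞) ^ (k0 + 1)) ^ 2 := by gcongr
    _ = _ := by
      rw [ENNReal.zpow_add (by norm_num) (by norm_num), mul_pow, mul_comm]; norm_num

lemma Mx_strong {n : ℕ} {μ : Measure (En n)} {D : ℝ≥0∞} (hμ : Dbl μ D) (h : En n → ℝ≥0∞)
    (hh : Measurable h) :
    ∫⁻ x, (Mx μ h x) ^ 2 ∂μ ≤ (16 * D * dyC 1) * ∫⁻ x, (h x) ^ 2 ∂μ := by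
  -- truncation
  have key : ∀ k : ℤ, μ {x | (2 : ℝ≥0∞) ^ (k + 1) < Mx μ h x} ≤
      D * (((2 : ℝ≥0∞) ^ k)⁻¹ * ∫⁻ y, (if (2 : ℝ≥0∞) ^ k < h y then h y else 0) ∂μ) := by
    intro k
    have hm : Measurable (fun y => if (2 : ℝ≥0∞) ^ k < h y then h y else 0) :=
      Measurable.ite (measurableSet_lt measurable_const hh) hh measurable_const
    refine le_trans (measure_mono ?_) (Mx_weak hμ _ hm ((2 : ℝ≥0∞) ^ k)
      (ENNReal.zpow_pos (by norm_num) (by norm_num) k).ne'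
      (ENNReal.zpow_lt_top (by norm_num) (by norm_num) k).ne)
    intro x hx
    obtain ⟨c, r, h1, h2, h3⟩ := (lt_Mx_iff μ h x _).1 hx
    refine (lt_Mx_iff _ _ x _).2 ⟨c, r, h1, h2, ?_⟩
    have hle : (μ (Metric.ball c r))⁻¹ * ∫⁻ y in Metric.ball c r, h y ∂μ ≤
        (μ (Metric.ball c r))⁻¹ * (∫⁻ y in Metric.ball c r,
          (if (2 : ℝ≥0∞) ^ k < h y then h y else 0) ∂μ) + (2 : ℝ≥0∞) ^ k := by
      calc (μ (Metric.ball c r))⁻¹ * ∫⁻ y in Metric.ball c r, h y ∂μ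
          ≤ (μ (Metric.ball c r))⁻¹ * ∫⁻ y in Metric.ball c r,
            ((if (2 : ℝ≥0∞) ^ k < h y then h y else 0) + (2 : ℝ≥0∞) ^ k) ∂μ := by
            gcongr with y
            split_ifs with hy
            · exact le_self_add
            · simpa using hy
        _ = (μ (Metric.ball c r))⁻¹ * (∫⁻ y in Metric.ball c r,
            (if (2 : ℝ≥0∞) ^ k < h y then h y else 0) ∂μ) +
            (2 : ℝ≥0∞) ^ k * ((μ (Metric.ball c r))⁻¹ * μ (Metric.ball c r)) := by
            rw [lintegral_add_left hm, setLIntegral_const, mul_add]; ring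
        _ = _ := by
            rw [ENNReal.inv_mul_cancel (hμ.pos c r h1).ne' (hμ.fin c r h1).ne, mul_one]
    have h4 := h3.trans_le hle
    rw [ENNReal.zpow_add (by norm_num) (by norm_num), zpow_one, mul_two] at h4
    exact lt_of_add_lt_add_right h4
  calc ∫⁻ x, (Mx μ h x) ^ 2 ∂μ
      ≤ ∫⁻ x, ∑' k : ℤ, (if (2 : ℝ≥0∞) ^ k < Mx μ h x then 4 * ((2 : ℝ≥0∞) ^ k) ^ 2 else 0) ∂μ :=
        lintegral_mono fun x => sq_le_dyadic _
    _ = ∑' k : ℤ, ∫⁻ x, (if (2 : ℝ≥0∞) ^ k < Mx μ h x then 4 * ((2 : ℝ≥0∞) ^ k) ^ 2 else 0) ∂μ := by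
        refine lintegral_tsum fun k => ?_
        exact (Measurable.ite (isOpen_lt_Mx μ h _).measurableSet measurable_const
          measurable_const).aemeasurable
    _ = ∑' k : ℤ, 4 * ((2 : ℝ≥0∞) ^ k) ^ 2 * μ {x | (2 : ℝ≥0∞) ^ k < Mx μ h x} := by
        congr 1; ext k
        rw [← lintegral_indicator_const (isOpen_lt_Mx μ h _).measurableSet]
        congr 1; ext x; simp [indicator]
    _ = ∑' k : ℤ, 4 * ((2 : ℝ≥0∞) ^ (k + 1)) ^ 2 * μ {x | (2 : ℝ≥0∞) ^ (k + 1) < Mx μ h x} := by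
        rw [← (Equiv.addRight (1 : ℤ)).tsum_eq]; rfl
    _ ≤ ∑' k : ℤ, 4 * ((2 : ℝ≥0∞) ^ (k + 1)) ^ 2 *
        (D * (((2 : ℝ≥0∞) ^ k)⁻¹ * ∫⁻ y, (if (2 : ℝ≥0∞) ^ k < h y then h y else 0) ∂μ)) := by
        refine ENNReal.tsum_le_tsum fun k => ?_
        gcongr
        exact key k
    _ = ∑' k : ℤ, 16 * D * ∫⁻ y, (if (2 : ℝ≥0∞) ^ k < h y then ((2 : ℝ≥0∞) ^ k) ^ (1 : ℝ) else 0) * h y ∂μ := by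
        congr 1; ext k
        have e1 : ∫⁻ y, (if (2 : ℝ≥0∞) ^ k < h y then ((2 : ℝ≥0∞) ^ k) ^ (1 : ℝ) else 0) * h y ∂μ =
            (2 : ℝ≥0∞) ^ k * ∫⁻ y, (if (2 : ℝ≥0∞) ^ k < h y then h y else 0) ∂μ := by
          rw [← lintegral_const_mul' _ _ (ENNReal.zpow_lt_top (by norm_num) (by norm_num) k).ne]
          congr 1; ext y
          split_ifs <;> simp
        rw [e1, ENNReal.zpow_add (by norm_num) (by norm_num), zpow_one]
        have := ENNReal.mul_inv_cancel (ENNReal.zpow_pos (a := 2) (by norm_num) (by norm_num) k).ne'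
          (ENNReal.zpow_lt_top (a := 2) (by norm_num) (by norm_num) k).ne
        generalize (∫⁻ y, (if (2 : ℝ≥0∞) ^ k < h y then h y else 0) ∂μ) = I
        generalize (2 : ℝ≥0∞) ^ k = z at this ⊢
        calc 4 * (z * 2) ^ 2 * (D * (z⁻¹ * I)) = 16 * D * ((z * z⁻¹) * z * I) := by ring
          _ = _ := by rw [this]; ring
    _ = 16 * D * ∫⁻ y, (∑' k : ℤ, (if (2 : ℝ≥0∞) ^ k < h y then ((2 : ℝ≥0∞) ^ k) ^ (1 : ℝ) else 0)) * h y ∂μ := by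
        rw [ENNReal.tsum_mul_left, ← lintegral_tsum]
        · congr 2; ext y; rw [ENNReal.tsum_mul_right]
        · intro k
          exact ((Measurable.ite (measurableSet_lt measurable_const hh) measurable_const
            measurable_const).mul hh).aemeasurable
    _ ≤ 16 * D * ∫⁻ y, (dyC 1 * (h y) ^ (1 : ℝ)) * h y ∂μ := by
        gcongr with y
        exact dyadic_sum_le one_pos _
    _ = (16 * D * dyC 1) * ∫⁻ x, (h x) ^ 2 ∂μ := by
        rw [mul_assoc (16 * D), ← lintegral_const_mul _ (hh.pow_const 2)]
        congr 2; ext y; rw [ENNReal.rpow_one]; ring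

end BR

namespace BR

/-! ### Consequences of the Muckenhoupt condition -/

lemma vol_ball_pos {n : ℕ} (c : En n) {r : ℝ} (hr : 0 < r) : volume (Metric.ball c r) ≠ 0 :=
  (Metric.measure_ball_pos volume c hr).ne'

lemma vol_ball_fin {n : ℕ} (c : En n) (r : ℝ) : volume (Metric.ball c r) ≠ ⊤ :=
  measure_ball_lt_top.ne

lemma vol_ball_mul {n : ℕ} (c : En n) {a : ℝ} (ha : 0 < a) (r : ℝ) :
    volume (Metric.ball c (a * r)) = ENNReal.ofReal (a ^ n) * volume (Metric.ball c r) := by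
  rw [Measure.addHaar_ball_mul_of_pos _ _ ha, finrank_euclideanSpace_fin,
    Measure.addHaar_ball_center volume c r]

lemma holder_set {n : ℕ} {q : ℝ} (hq : 1 < q) (ω : En n → ℝ≥0∞) (hω : Measurable ω)
    (A : Set (En n)) (h0 : ∀ᵐ y ∂(volume.restrict A), ω y ≠ 0)
    (ht : ∀ᵐ y ∂(volume.restrict A), ω y ≠ ⊤) (h : En n → ℝ≥0∞) (hh : Measurable h) :
    (∫⁻ y in A, h y) ^ q ≤ (∫⁻ y in A, ω y * h y ^ q) * (∫⁻ y in A, ω y ^ (1 / (1 - q))) ^ (q - 1) := by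
  have hq0 : 0 < q := by linarith
  have hc : q.HolderConjugate (q / (q - 1)) := Real.HolderConjugate.conjExponent hq
  have := ENNReal.lintegral_mul_le_Lp_mul_Lq (volume.restrict A) hc
    (f := fun y => h y * ω y ^ (1 / q)) (g := fun y => ω y ^ (-(1 / q)))
    ((hh.mul (hω.pow_const _)).aemeasurable) ((hω.pow_const _).aemeasurable)
  have e1 : ∫⁻ y in A, h y = ∫⁻ y in A, ((fun y => h y * ω y ^ (1 / q)) * (fun y => ω y ^ (-(1 / q)))) y := by
    refine lintegral_congr_ae ?_
    filter_upwards [h0, ht] with y hy0 hyt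
    simp only [Pi.mul_apply]
    rw [mul_assoc, ← ENNReal.rpow_add _ _ hy0 hyt, add_neg_cancel, ENNReal.rpow_zero, mul_one]
  rw [e1]
  calc _ ≤ ((∫⁻ y in A, (h y * ω y ^ (1 / q)) ^ q) ^ (1 / q) *
        (∫⁻ y in A, (ω y ^ (-(1 / q))) ^ (q / (q - 1))) ^ (1 / (q / (q - 1)))) ^ q := by
        gcongr
    _ = _ := by
        rw [ENNReal.mul_rpow_of_nonneg _ _ hq0.le, ← ENNReal.rpow_mul, ← ENNReal.rpow_mul]
        have e2 : 1 / q * q = 1 := by field_simp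
        have e3 : 1 / (q / (q - 1)) * q = q - 1 := by
          have : q - 1 ≠ 0 := by linarith
          field_simp
        rw [e2, e3, ENNReal.rpow_one]
        congr 2
        · ext y
          rw [ENNReal.mul_rpow_of_nonneg _ _ hq0.le, ← ENNReal.rpow_mul, e2, ENNReal.rpow_one, mul_comm]
        · congr 1; ext y
          rw [← ENNReal.rpow_mul]
          congr 1
          have : q - 1 ≠ 0 := by linarith
          have : 1 - q ≠ 0 := by linarith
          have e : 1 - q = -(q - 1) := by ring
          rw [e]
          field_simp

lemma ae_ne_top_of_loc {n : ℕ} (ω : En n → ℝ≥0∞) (hωmeas : Measurable ω)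
    (hωloc : ∀ (x : En n) (r : ℝ), 0 < r → (∫⁻ y in Metric.ball x r, ω y) < ⊤) :
    ∀ᵐ y : En n, ω y ≠ ⊤ := by
  have h1 : ∀ N : ℕ, ∀ᵐ y ∂(volume.restrict (Metric.ball (0 : En n) (N + 1))), ω y ≠ ⊤ := by
    intro N
    filter_upwards [ae_lt_top hωmeas (hωloc 0 (N + 1) (by positivity)).ne] with y hy using hy.ne
  have h2 : (⋃ N : ℕ, Metric.ball (0 : En n) (N + 1)) = univ := by
    refine eq_univ_of_forall fun x => mem_iUnion.2 ?_
    obtain ⟨N, hN⟩ := exists_nat_ge ‖x‖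
    exact ⟨N, by simp; linarith⟩
  rw [← Measure.restrict_univ (μ := (volume : Measure (En n))), ← h2]
  exact (ae_restrict_iUnion_iff _ _).2 h1

/-- the weighted measure -/
def Wm {n : ℕ} (ω : En n → ℝ≥0∞) : Measure (En n) := volume.withDensity ω

lemma Wm_apply {n : ℕ} (ω : En n → ℝ≥0∞) {A : Set (En n)} (hA : MeasurableSet A) :
    Wm ω A = ∫⁻ y in A, ω y := withDensity_apply _ hA

lemma Wm_lint {n : ℕ} {ω : En n → ℝ≥0∞} (hω : Measurable ω) {h : En n → ℝ≥0∞} (hh : Measurable h)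
    (c : En n) (r : ℝ) :
    ∫⁻ y in Metric.ball c r, h y ∂(Wm ω) = ∫⁻ y in Metric.ball c r, ω y * h y := by
  unfold Wm
  rw [setLIntegral_withDensity_eq_setLIntegral_mul _ hω hh Metric.isOpen_ball.measurableSet]
  rfl

lemma Ap_Pq {n : ℕ} {q : ℝ} (hq : 1 ≤ q) (ω : En n → ℝ≥0∞) (hωmeas : Measurable ω)
    (hωloc : ∀ (x : En n) (r : ℝ), 0 < r → (∫⁻ y in Metric.ball x r, ω y) < ⊤)
    (hω : IsAp n q ω) :
    ∃ K : ℝ≥0∞, K < ⊤ ∧ ∀ (c : En n) (r : ℝ), 0 < r → ∀ h : En n → ℝ≥0∞, Measurable h →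
      (∫⁻ y in Metric.ball c r, h y) ^ q * Wm ω (Metric.ball c r) ≤
        K * volume (Metric.ball c r) ^ q * ∫⁻ y in Metric.ball c r, h y ^ q ∂(Wm ω) := by
  have hnt := ae_ne_top_of_loc ω hωmeas hωloc
  unfold IsAp at hω
  split_ifs at hω with h1
  · subst h1
    obtain ⟨K, hK, H⟩ := hω
    refine ⟨K, hK, fun c r hr h hh => ?_⟩
    have hv0 := vol_ball_pos c hr
    have hvt := vol_ball_fin c r
    specialize H c r hr
    rw [Wm_lint hωmeas (hh.pow_const _), Wm_apply _ Metric.isOpen_ball.measurableSet]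
    simp only [ENNReal.rpow_one]
    set S := essSup (fun y => (ω y)⁻¹) (volume.restrict (Metric.ball c r)) with hS
    unfold ballAvg at H
    set w := ∫⁻ y in Metric.ball c r, ω y with hw
    by_cases hSt : S = ⊤
    · have : w = 0 := by
        by_contra hw0
        rw [hSt, ENNReal.mul_top (mul_ne_zero (ENNReal.inv_ne_zero.2 hvt) hw0)] at H
        exact absurd (H.trans_lt hK) (lt_irrefl _)
      rw [this]; simp
    have hle : ∫⁻ y in Metric.ball c r, h y ≤ S * ∫⁻ y in Metric.ball c r, ω y * h y := by
      rw [← lintegral_const_mul' _ _ hSt]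
      refine lintegral_mono_ae ?_
      filter_upwards [ENNReal.ae_le_essSup (μ := volume.restrict (Metric.ball c r)) (fun y => (ω y)⁻¹), ae_restrict_of_ae hnt] with y hy hyt
      have hy0 : ω y ≠ 0 := by
        intro h0; simp only [h0, ENNReal.inv_zero] at hy
        exact hSt (top_le_iff.1 hy)
      calc h y = (ω y)⁻¹ * ω y * h y := by rw [ENNReal.inv_mul_cancel hy0 hyt, one_mul]
        _ ≤ S * ω y * h y := by gcongr
        _ = _ := by ring
    calc (∫⁻ y in Metric.ball c r, h y) * w
        ≤ (S * ∫⁻ y in Metric.ball c r, ω y * h y) * w := by gcongr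
      _ = (volume (Metric.ball c r) * (volume (Metric.ball c r))⁻¹) * ((S * ∫⁻ y in Metric.ball c r, ω y * h y) * w) := by
          rw [ENNReal.mul_inv_cancel hv0 hvt, one_mul]
      _ = ((volume (Metric.ball c r))⁻¹ * w * S) * volume (Metric.ball c r) * ∫⁻ y in Metric.ball c r, ω y * h y := by ring
      _ ≤ _ := by gcongr
  · have hq1 : 1 < q := lt_of_le_of_ne hq (Ne.symm h1)
    obtain ⟨K, hK, H⟩ := hω
    refine ⟨K, hK, fun c r hr h hh => ?_⟩
    have hv0 := vol_ball_pos c hr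
    have hvt := vol_ball_fin c r
    specialize H c r hr
    rw [Wm_lint hωmeas (hh.pow_const _), Wm_apply _ Metric.isOpen_ball.measurableSet]
    unfold ballAvg at H
    set w := ∫⁻ y in Metric.ball c r, ω y with hw
    set s := ∫⁻ y in Metric.ball c r, ω y ^ (1 / (1 - q)) with hs
    set v := volume (Metric.ball c r) with hv
    by_cases hw0 : w = 0
    · rw [hw0]; simp
    have hst : s ≠ ⊤ := by
      intro hst
      rw [hst, ENNReal.mul_top (ENNReal.inv_ne_zero.2 hvt), ENNReal.top_rpow_of_pos (by linarith),
        ENNReal.mul_top (mul_ne_zero (ENNReal.inv_ne_zero.2 hvt) hw0)] at H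
      exact absurd (H.trans_lt hK) (lt_irrefl _)
    have h0 : ∀ᵐ y ∂(volume.restrict (Metric.ball c r)), ω y ≠ 0 := by
      filter_upwards [ae_lt_top (hωmeas.pow_const _) hst] with y hy hy0
      rw [hy0, ENNReal.zero_rpow_of_neg] at hy
      · exact lt_irrefl _ hy
      · rw [one_div, inv_lt_zero]; linarith
    have hH := holder_set hq1 ω hωmeas (Metric.ball c r) h0 (ae_restrict_of_ae hnt) h hh
    rw [← hs] at hH
    calc (∫⁻ y in Metric.ball c r, h y) ^ q * w
        ≤ ((∫⁻ y in Metric.ball c r, ω y * h y ^ q) * s ^ (q - 1)) * w := by gcongr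
      _ = (v * v⁻¹) ^ q * (((∫⁻ y in Metric.ball c r, ω y * h y ^ q) * s ^ (q - 1)) * w) := by
          rw [ENNReal.mul_inv_cancel hv0 hvt, ENNReal.one_rpow, one_mul]
      _ = (v⁻¹ * w * (v⁻¹ * s) ^ (q - 1)) * v ^ q * ∫⁻ y in Metric.ball c r, ω y * h y ^ q := by
          rw [ENNReal.mul_rpow_of_nonneg _ _ (by linarith), ENNReal.mul_rpow_of_nonneg _ _ (by linarith)]
          have : v⁻¹ ^ q = v⁻¹ * v⁻¹ ^ (q - 1) := by
            nth_rw 2 [← ENNReal.rpow_one v⁻¹]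
            rw [← ENNReal.rpow_add _ _ (ENNReal.inv_ne_zero.2 hvt) (ENNReal.inv_ne_top.2 hv0)]
            congr 1; ring
          rw [this]; ring
      _ ≤ _ := by gcongr

/-- Set version of the `A_q` property. -/
structure SetP {n : ℕ} (μ : Measure (En n)) (q : ℝ) (K : ℝ≥0∞) : Prop where
  setp : ∀ (c : En n) (r : ℝ) (A : Set (En n)), 0 < r → MeasurableSet A → A ⊆ Metric.ball c r →
    volume A ^ q * μ (Metric.ball c r) ≤ K * volume (Metric.ball c r) ^ q * μ A
  pos : ∀ c r, 0 < r → 0 < μ (Metric.ball c r)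
  fin : ∀ c r, 0 < r → μ (Metric.ball c r) < ⊤

lemma SetP.ball_le {n : ℕ} {μ : Measure (En n)} {q : ℝ} {K : ℝ≥0∞} (h : SetP μ q K) (hq : 0 ≤ q)
    (c : En n) (a r : ℝ) (ha : 1 ≤ a) (hr : 0 < r) :
    μ (Metric.ball c (a * r)) ≤ (K * ENNReal.ofReal (a ^ n) ^ q) * μ (Metric.ball c r) := by
  have h1 := h.setp c (a * r) (Metric.ball c r) (by positivity) Metric.isOpen_ball.measurableSet
    (Metric.ball_subset_ball (by nlinarith))
  rw [vol_ball_mul c (by linarith), ENNReal.mul_rpow_of_nonneg _ _ hq] at h1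
  have hv0 : volume (Metric.ball c r) ^ q ≠ 0 := by
    simp [ENNReal.rpow_eq_zero_iff, vol_ball_pos c hr, vol_ball_fin c r]
  have hvt : volume (Metric.ball c r) ^ q ≠ ⊤ := ENNReal.rpow_ne_top_of_nonneg hq (vol_ball_fin c r)
  rw [← ENNReal.mul_le_mul_iff_right hv0 hvt]
  calc _ ≤ _ := h1
    _ = _ := by ring

lemma SetP.Dbl {n : ℕ} {μ : Measure (En n)} {q : ℝ} {K : ℝ≥0∞} (h : SetP μ q K) (hq : 0 ≤ q) :
    Dbl μ (K * ENNReal.ofReal (5 ^ n) ^ q) :=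
  ⟨fun c r hr => h.ball_le hq c 5 r (by norm_num) hr, h.pos, h.fin⟩

lemma Wm_zero_or_setP {n : ℕ} {q : ℝ} (hq : 1 ≤ q) (ω : En n → ℝ≥0∞)
    (hωloc : ∀ (x : En n) (r : ℝ), 0 < r → (∫⁻ y in Metric.ball x r, ω y) < ⊤)
    (K : ℝ≥0∞)
    (H : ∀ (c : En n) (r : ℝ), 0 < r → ∀ h : En n → ℝ≥0∞, Measurable h →
      (∫⁻ y in Metric.ball c r, h y) ^ q * Wm ω (Metric.ball c r) ≤
        K * volume (Metric.ball c r) ^ q * ∫⁻ y in Metric.ball c r, h y ^ q ∂(Wm ω)) :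
    Wm ω = 0 ∨ SetP (Wm ω) q K := by
  have hq0 : 0 < q := by linarith
  have hset : ∀ (c : En n) (r : ℝ) (A : Set (En n)), 0 < r → MeasurableSet A → A ⊆ Metric.ball c r →
    volume A ^ q * Wm ω (Metric.ball c r) ≤ K * volume (Metric.ball c r) ^ q * Wm ω A := by
    intro c r A hr hA hsub
    have := H c r hr (A.indicator 1) (measurable_one.indicator hA)
    have e1 : ∫⁻ y in Metric.ball c r, A.indicator 1 y = volume A := by
      rw [lintegral_indicator_one hA, Measure.restrict_apply hA, inter_eq_left.2 hsub]
    have e2 : ∫⁻ y in Metric.ball c r, (A.indicator (1 : En n → ℝ≥0∞) y) ^ q ∂(Wm ω) = Wm ω A := by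
      have : (fun y => (A.indicator (1 : En n → ℝ≥0∞) y) ^ q) = A.indicator 1 := by
        ext y
        by_cases hy : y ∈ A <;> simp [hy, hq0]
      rw [this, lintegral_indicator_one hA, Measure.restrict_apply hA, inter_eq_left.2 hsub]
    rwa [e1, e2] at this
  by_cases hz : ∃ c r, 0 < r ∧ Wm ω (Metric.ball c r) = 0
  · left
    obtain ⟨c, r, hr, h0⟩ := hz
    have h2 : (⋃ N : ℕ, Metric.ball c (r + N)) = univ := by
      refine eq_univ_of_forall fun x => mem_iUnion.2 ?_
      obtain ⟨N, hN⟩ := exists_nat_ge (dist x c)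
      exact ⟨N, by simp; linarith⟩
    rw [← Measure.measure_univ_eq_zero, ← h2, measure_iUnion_null_iff]
    intro N
    have := hset c (r + N) (Metric.ball c r) (by positivity) Metric.isOpen_ball.measurableSet
      (Metric.ball_subset_ball (by simp))
    rw [h0, mul_zero, nonpos_iff_eq_zero, mul_eq_zero] at this
    rcases this with h | h
    · simp [ENNReal.rpow_eq_zero_iff, vol_ball_pos c hr, vol_ball_fin c r] at h
    · exact h
  · right
    push Not at hz
    refine ⟨hset, fun c r hr => pos_iff_ne_zero.2 (hz c r hr), fun c r hr => ?_⟩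
    rw [Wm_apply _ Metric.isOpen_ball.measurableSet]
    exact hωloc c r hr

/-- dual weight -/
def dual {n : ℕ} (q : ℝ) (ω : En n → ℝ≥0∞) : En n → ℝ≥0∞ := fun y => ω y ^ (1 / (1 - q))

lemma dual_facts {n : ℕ} {q : ℝ} (hq : 1 < q) (ω : En n → ℝ≥0∞) (hωmeas : Measurable ω)
    (hωloc : ∀ (x : En n) (r : ℝ), 0 < r → (∫⁻ y in Metric.ball x r, ω y) < ⊤)
    (hpos : ∀ c r, 0 < r → 0 < Wm ω (Metric.ball c r)) (hω : IsAp n q ω) :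
    ∃ K : ℝ≥0∞, K < ⊤ ∧ SetP (Wm (dual q ω)) (q / (q - 1)) K ∧
      (∀ A : Set (En n), MeasurableSet A → volume A ^ q ≤ Wm ω A * (Wm (dual q ω) A) ^ (q - 1)) ∧
      (∀ c r, 0 < r → Wm ω (Metric.ball c r) * (Wm (dual q ω) (Metric.ball c r)) ^ (q - 1) ≤
        K * volume (Metric.ball c r) ^ q) := by
  have hnt := ae_ne_top_of_loc ω hωmeas hωloc
  have hq1 : 0 < q - 1 := by linarith
  unfold IsAp at hω
  rw [if_neg hq.ne'] at hω
  obtain ⟨C, hC, H⟩ := hω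
  have hballs : ∀ c r, 0 < r → Wm ω (Metric.ball c r) * (Wm (dual q ω) (Metric.ball c r)) ^ (q - 1) ≤
        C * volume (Metric.ball c r) ^ q := by
    intro c r hr
    have h1 := H c r hr
    have hv0 := vol_ball_pos c hr
    have hvt := vol_ball_fin c r
    rw [Wm_apply _ Metric.isOpen_ball.measurableSet, Wm_apply _ Metric.isOpen_ball.measurableSet]
    unfold ballAvg at h1
    unfold dual
    set w := ∫⁻ y in Metric.ball c r, ω y with hw
    set s := ∫⁻ y in Metric.ball c r, ω y ^ (1 / (1 - q)) with hs
    set v := volume (Metric.ball c r) with hv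
    calc w * s ^ (q - 1) = (v * v⁻¹) ^ q * (w * s ^ (q - 1)) := by
          rw [ENNReal.mul_inv_cancel hv0 hvt, ENNReal.one_rpow, one_mul]
      _ = (v⁻¹ * w * (v⁻¹ * s) ^ (q - 1)) * v ^ q := by
          rw [ENNReal.mul_rpow_of_nonneg _ _ (by linarith), ENNReal.mul_rpow_of_nonneg _ _ (by linarith)]
          have : v⁻¹ ^ q = v⁻¹ * v⁻¹ ^ (q - 1) := by
            nth_rw 2 [← ENNReal.rpow_one v⁻¹]
            rw [← ENNReal.rpow_add _ _ (ENNReal.inv_ne_zero.2 hvt) (ENNReal.inv_ne_top.2 hv0)]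
            congr 1; ring
          rw [this]; ring
      _ ≤ C * v ^ q := by gcongr
  have hdm : Measurable (dual q ω) := hωmeas.pow_const _
  have hSfin : ∀ c r, 0 < r → Wm (dual q ω) (Metric.ball c r) < ⊤ := by
    intro c r hr
    rw [lt_top_iff_ne_top]
    intro hst
    have h1 := hballs c r hr
    rw [hst, ENNReal.top_rpow_of_pos hq1, ENNReal.mul_top (hpos c r hr).ne', top_le_iff] at h1
    exact ENNReal.mul_ne_top hC.ne (ENNReal.rpow_ne_top_of_nonneg (by linarith) (vol_ball_fin c r)) h1
  have hn0 : ∀ᵐ y : En n, ω y ≠ 0 := by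
    have := ae_ne_top_of_loc (dual q ω) hdm (fun c r hr => by
      have := hSfin c r hr
      rwa [Wm_apply _ Metric.isOpen_ball.measurableSet] at this)
    filter_upwards [this] with y hy hy0
    unfold dual at hy
    rw [hy0, ENNReal.zero_rpow_of_neg] at hy
    · exact hy rfl
    · rw [one_div, inv_lt_zero]; linarith
  have hsets : ∀ A : Set (En n), MeasurableSet A →
      volume A ^ q ≤ Wm ω A * (Wm (dual q ω) A) ^ (q - 1) := by
    intro A hA
    have := holder_set hq ω hωmeas A (ae_restrict_of_ae hn0) (ae_restrict_of_ae hnt) 1 measurable_one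
    rw [Wm_apply _ hA, Wm_apply _ hA]
    simpa [dual] using this
  refine ⟨max C (C ^ (1 / (q - 1))), ?_, ⟨?_, ?_, hSfin⟩, hsets, ?_⟩
  · exact max_lt hC (ENNReal.rpow_lt_top_of_nonneg (by positivity) hC.ne)
  · intro c r A hr hA hsub
    have h1 := hsets A hA
    have h2 := hballs c r hr
    have h3 : Wm ω A ≤ Wm ω (Metric.ball c r) := measure_mono hsub
    set B := Metric.ball c r
    set S := Wm (dual q ω)
    have h4 : volume A ^ (q / (q - 1)) ≤ Wm ω B ^ (1 / (q - 1)) * S A := by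
      have := ENNReal.rpow_le_rpow (h1.trans (mul_le_mul_left h3 _)) (z := 1 / (q - 1)) (by positivity)
      rw [← ENNReal.rpow_mul, ENNReal.mul_rpow_of_nonneg _ _ (by positivity), ← ENNReal.rpow_mul] at this
      rwa [mul_one_div_cancel hq1.ne', ENNReal.rpow_one, mul_one_div] at this
    have h5 : Wm ω B ^ (1 / (q - 1)) * S B ≤ C ^ (1 / (q - 1)) * volume B ^ (q / (q - 1)) := by
      have := ENNReal.rpow_le_rpow h2 (z := 1 / (q - 1)) (by positivity)
      rw [ENNReal.mul_rpow_of_nonneg _ _ (by positivity), ENNReal.mul_rpow_of_nonneg _ _ (by positivity),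
        ← ENNReal.rpow_mul, ← ENNReal.rpow_mul] at this
      rwa [mul_one_div_cancel hq1.ne', ENNReal.rpow_one, mul_one_div] at this
    calc volume A ^ (q / (q - 1)) * S B ≤ (Wm ω B ^ (1 / (q - 1)) * S A) * S B := by gcongr
      _ = (Wm ω B ^ (1 / (q - 1)) * S B) * S A := by ring
      _ ≤ (C ^ (1 / (q - 1)) * volume B ^ (q / (q - 1))) * S A := by gcongr
      _ ≤ _ := by gcongr; exact le_max_right _ _
  · intro c r hr
    rw [pos_iff_ne_zero]
    intro h0
    have h1 := hsets (Metric.ball c r) Metric.isOpen_ball.measurableSet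
    rw [h0, ENNReal.zero_rpow_of_pos hq1, mul_zero, nonpos_iff_eq_zero] at h1
    simp [ENNReal.rpow_eq_zero_iff, vol_ball_pos c hr, vol_ball_fin c r] at h1
  · intro c r hr
    exact (hballs c r hr).trans (by gcongr; exact le_max_left _ _)

end BR

namespace BR

/-! ### Quantitative absolute continuity -/

lemma dbl_vol {n : ℕ} : Dbl (volume : Measure (En n)) (ENNReal.ofReal (5 ^ n)) :=
  ⟨fun c r _ => (vol_ball_mul c (by norm_num) r).le, fun c r hr => pos_iff_ne_zero.2 (vol_ball_pos c hr),
    fun c r _ => (vol_ball_fin c r).lt_top⟩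

/-- maximal function of a set -/
def Mset {n : ℕ} (E : Set (En n)) : En n → ℝ≥0∞ := Mx volume (E.indicator 1)

lemma lt_Mset_iff {n : ℕ} {E : Set (En n)} (hE : MeasurableSet E) (x : En n) (a : ℝ≥0∞) :
    a < Mset E x ↔ ∃ c r, 0 < r ∧ x ∈ Metric.ball c r ∧
      a * volume (Metric.ball c r) < volume (E ∩ Metric.ball c r) := by
  unfold Mset
  rw [lt_Mx_iff]
  refine exists_congr fun c => exists_congr fun r => and_congr_right fun hr => and_congr_right fun hx => ?_
  rw [lintegral_indicator_one hE, Measure.restrict_apply hE, mul_comm, ← div_eq_mul_inv,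
    ENNReal.lt_div_iff_mul_lt (Or.inl (vol_ball_pos c hr)) (Or.inl (vol_ball_fin c r))]

lemma Mset_vol {n : ℕ} {E : Set (En n)} (hE : MeasurableSet E) (a : ℝ≥0∞) (ha : a ≠ 0) (ha' : a ≠ ⊤) :
    volume {x | a < Mset E x} ≤ ENNReal.ofReal (5 ^ n) * (a⁻¹ * volume E) := by
  have := Mx_weak dbl_vol (E.indicator 1) (measurable_one.indicator hE) a ha ha'
  rwa [lintegral_indicator_one hE] at this

/-- the threshold -/
def thr (n : ℕ) : ℝ≥0∞ := (ENNReal.ofReal (2 ^ (n + 1)))⁻¹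

lemma thr_ne_zero (n : ℕ) : thr n ≠ 0 := by simp [thr]
lemma thr_ne_top (n : ℕ) : thr n ≠ ⊤ := by
  simp only [thr, ne_eq, ENNReal.inv_eq_top, ENNReal.ofReal_eq_zero, not_le]; positivity

lemma good_ball {n : ℕ} (hn : 1 ≤ n) {E : Set (En n)} (hE : IsOpen E) (hfin : volume E ≠ ⊤)
    (y : En n) (hy : y ∈ E) :
    ∃ r, 0 < r ∧ thr n * volume (Metric.ball y r) < volume (E ∩ Metric.ball y r) ∧
      2 * volume (E ∩ Metric.ball y r) ≤ volume (Metric.ball y r) := by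
  obtain ⟨r0, hr0, hsub⟩ := Metric.isOpen_iff.1 hE y hy
  have hvol : ∀ k : ℕ, volume (Metric.ball y (2 ^ k * r0)) =
      ENNReal.ofReal ((2 ^ k) ^ n) * volume (Metric.ball y r0) := fun k =>
    vol_ball_mul y (by positivity) r0
  have hv0 := vol_ball_pos y hr0
  have hvt := vol_ball_fin y r0
  have hex : ∃ k : ℕ, 2 * volume (E ∩ Metric.ball y (2 ^ k * r0)) ≤ volume (Metric.ball y (2 ^ k * r0)) := by
    have hne : (2 * volume E / volume (Metric.ball y r0)) ≠ ⊤ :=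
      ENNReal.div_ne_top (ENNReal.mul_ne_top (by norm_num) hfin) hv0
    obtain ⟨k, hk⟩ := ENNReal.exists_nat_gt hne
    refine ⟨k, ?_⟩
    rw [hvol k]
    calc 2 * volume (E ∩ Metric.ball y (2 ^ k * r0)) ≤ 2 * volume E := by gcongr; exact inter_subset_left
      _ ≤ k * volume (Metric.ball y r0) := by
          rw [← ENNReal.div_le_iff hv0 hvt]; exact hk.le
      _ ≤ _ := by
          gcongr
          rw [← ENNReal.ofReal_natCast]
          apply ENNReal.ofReal_le_ofReal
          calc (k : ℝ) ≤ 2 ^ k := by exact_mod_cast Nat.lt_two_pow_self.le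
            _ ≤ (2 ^ k) ^ n := le_self_pow₀ (one_le_pow₀ (by norm_num)) (by omega)
  classical
  have hk := Nat.find_spec hex
  set k := Nat.find hex with hkdef
  have hk0 : k ≠ 0 := by
    intro h0
    rw [h0] at hk
    simp only [pow_zero, one_mul] at hk
    rw [inter_eq_right.2 hsub, two_mul] at hk
    have : volume (Metric.ball y r0) < volume (Metric.ball y r0) + volume (Metric.ball y r0) :=
      ENNReal.lt_add_right hvt hv0
    exact absurd hk (not_le.2 this)
  obtain ⟨m, hm⟩ := Nat.exists_eq_succ_of_ne_zero hk0
  have hlt : ¬ (2 * volume (E ∩ Metric.ball y (2 ^ m * r0)) ≤ volume (Metric.ball y (2 ^ m * r0))) :=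
    Nat.find_min hex (by omega)
  refine ⟨2 ^ k * r0, by positivity, ?_, hk⟩
  rw [not_le] at hlt
  have e : (2 : ℝ) ^ k * r0 = 2 * (2 ^ m * r0) := by rw [hm, pow_succ]; ring
  have h1 : volume (E ∩ Metric.ball y (2 ^ m * r0)) ≤ volume (E ∩ Metric.ball y (2 ^ k * r0)) := by
    refine measure_mono (inter_subset_inter_right _ (Metric.ball_subset_ball ?_))
    rw [e]; nlinarith [show 0 < 2 ^ m * r0 by positivity]
  refine lt_of_lt_of_le ?_ h1
  rw [e, vol_ball_mul y (by norm_num), ← mul_assoc]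
  have e2 : thr n * ENNReal.ofReal (2 ^ n) = 2⁻¹ := by
    unfold thr
    rw [← ENNReal.ofReal_inv_of_pos (by positivity), ← ENNReal.ofReal_mul (by positivity)]
    rw [show ((2 : ℝ) ^ (n + 1))⁻¹ * 2 ^ n = 2⁻¹ by rw [pow_succ]; field_simp]
    rw [ENNReal.ofReal_inv_of_pos (by norm_num)]; norm_num
  rw [e2]
  calc 2⁻¹ * volume (Metric.ball y (2 ^ m * r0)) < 2⁻¹ * (2 * volume (E ∩ Metric.ball y (2 ^ m * r0))) := by
        rw [ENNReal.mul_lt_mul_iff_right (by simp) (by simp)]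
        exact hlt
    _ = volume (E ∩ Metric.ball y (2 ^ m * r0)) := by
        rw [← mul_assoc, ENNReal.inv_mul_cancel (by simp) (by simp), one_mul]

lemma grow_step {n : ℕ} (hn : 1 ≤ n) {μ : Measure (En n)} {q : ℝ} {K : ℝ≥0∞} (h : SetP μ q K)
    (hq : 0 ≤ q) {E : Set (En n)} (hE : IsOpen E) (hfin : volume E ≠ ⊤) :
    E ⊆ {x | thr n < Mset E x} ∧
    μ E ≤ ((K * ENNReal.ofReal (5 ^ n) ^ q) * (K * 2 ^ q)) * μ ({x | thr n < Mset E x} \ E) := by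
  have hsub : ∀ y ∈ E, ∃ r, 0 < r ∧ Metric.ball y r ⊆ {x | thr n < Mset E x} ∧
      2 * volume (E ∩ Metric.ball y r) ≤ volume (Metric.ball y r) := by
    intro y hy
    obtain ⟨r, h1, h2, h3⟩ := good_ball hn hE hfin y hy
    exact ⟨r, h1, fun z hz => (lt_Mset_iff hE.measurableSet z _).2 ⟨y, r, h1, hz, h2⟩, h3⟩
  refine ⟨fun y hy => ?_, ?_⟩
  · obtain ⟨r, h1, h2, h3⟩ := hsub y hy
    exact h2 (Metric.mem_ball_self h1)
  · have := vitali_measure μ ((K * 2 ^ q) • μ.restrict ({x | thr n < Mset E x} \ E)) _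
      (h.Dbl hq).dbl E ?_
    · simpa [mul_assoc] using this
    · intro y hy
      obtain ⟨r, h1, h2, h3⟩ := hsub y hy
      refine ⟨y, r, h1, Metric.mem_ball_self h1, ?_⟩
      have hm : MeasurableSet (Metric.ball y r \ E) := Metric.isOpen_ball.measurableSet.diff hE.measurableSet
      have h4 := h.setp y r (Metric.ball y r \ E) h1 hm sdiff_subset
      have hv0 := vol_ball_pos y h1
      have hvt := vol_ball_fin y r
      have h5 : volume (Metric.ball y r) ≤ 2 * volume (Metric.ball y r \ E) := by
        have e : volume (E ∩ Metric.ball y r) + volume (Metric.ball y r \ E) = volume (Metric.ball y r) := by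
          rw [inter_comm]; exact measure_inter_add_sdiff _ hE.measurableSet
        have hf : volume (E ∩ Metric.ball y r) ≠ ⊤ := measure_ne_top_of_subset inter_subset_right hvt
        rw [← e, two_mul] at h3
        have h6 := (ENNReal.add_le_add_iff_left hf).1 h3
        rw [← e, two_mul]; gcongr
      have hvq0 : volume (Metric.ball y r) ^ q ≠ 0 := by
        simp [ENNReal.rpow_eq_zero_iff, hv0, hvt]
      have hvqt : volume (Metric.ball y r) ^ q ≠ ⊤ := ENNReal.rpow_ne_top_of_nonneg hq hvt
      rw [Measure.smul_apply, Measure.restrict_apply Metric.isOpen_ball.measurableSet, smul_eq_mul]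
      have e1 : Metric.ball y r ∩ ({x | thr n < Mset E x} \ E) = Metric.ball y r \ E := by
        ext z; simp only [mem_inter_iff, mem_sdiff]
        exact ⟨fun hz => ⟨hz.1, hz.2.2⟩, fun hz => ⟨hz.1, h2 hz.1, hz.2⟩⟩
      rw [e1, ← ENNReal.mul_le_mul_iff_right hvq0 hvqt]
      calc volume (Metric.ball y r) ^ q * μ (Metric.ball y r)
          ≤ (2 * volume (Metric.ball y r \ E)) ^ q * μ (Metric.ball y r) := by gcongr
        _ = 2 ^ q * (volume (Metric.ball y r \ E) ^ q * μ (Metric.ball y r)) := by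
            rw [ENNReal.mul_rpow_of_nonneg _ _ hq]; ring
        _ ≤ 2 ^ q * (K * volume (Metric.ball y r) ^ q * μ (Metric.ball y r \ E)) := by gcongr
        _ = _ := by ring

/-- base for the geometric decay -/
def bb : ℝ := 20

lemma grow_vol {n : ℕ} (hn : 1 ≤ n) {E : Set (En n)} (hE : MeasurableSet E) :
    volume {x | thr n < Mset E x} ≤ ENNReal.ofReal (bb ^ n) * volume E := by
  refine (Mset_vol hE _ (thr_ne_zero n) (thr_ne_top n)).trans ?_
  rw [← mul_assoc]
  gcongr
  unfold thr
  rw [inv_inv, ← ENNReal.ofReal_mul (by positivity)]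
  apply ENNReal.ofReal_le_ofReal
  have : (bb : ℝ) ^ n = 5 ^ n * (2 ^ n * 2 ^ n) := by unfold bb; rw [← mul_pow, ← mul_pow]; norm_num
  rw [this, pow_succ]
  have : (2 : ℝ) ≤ 2 ^ n := by simpa using pow_le_pow_right₀ (by norm_num : (1 : ℝ) ≤ 2) hn
  gcongr

lemma radius_lt {n : ℕ} (c x : En n) {r s : ℝ} (h : volume (Metric.ball c r) < volume (Metric.ball x s)) :
    r < s := by
  by_contra hc
  rw [Measure.addHaar_ball_center, Measure.addHaar_ball_center volume x] at h
  exact absurd h (not_lt.2 (measure_mono (Metric.ball_subset_ball (not_lt.1 hc))))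

lemma decay_claim {n : ℕ} (hn : 1 ≤ n) {μ : Measure (En n)} {q : ℝ} {K : ℝ≥0∞} (h : SetP μ q K)
    (hq : 0 ≤ q) (κ : ℝ≥0∞)
    (hκ : ∀ E : Set (En n), IsOpen E → volume E ≠ ⊤ → μ E ≤ κ * μ {x | thr n < Mset E x})
    (x : En n) (R : ℝ) (hR : 0 < R) (J : ℕ) : ∀ (E : Set (En n)) (R' : ℝ), IsOpen E →
      E ⊆ Metric.ball x R' →
      ENNReal.ofReal ((bb ^ J) ^ n) * volume E ≤ volume (Metric.ball x R) →
      μ E ≤ κ ^ J * μ (Metric.ball x (R' + 8 * R * (1 - (2 ^ J)⁻¹))) := by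
  induction J with
  | zero => intro E R' hE hsub hv; simpa using measure_mono hsub
  | succ J ih =>
    intro E R' hE hsub hv
    have hb0 : (0 : ℝ) < bb := by norm_num [bb]
    have hfin : volume E ≠ ⊤ := measure_ne_top_of_subset hsub (vol_ball_fin x R')
    have h1 := hκ E hE hfin
    have h2 := ih {z | thr n < Mset E z} (R' + 8 * R * (bb ^ (J + 1))⁻¹) (isOpen_lt_Mx _ _ _) ?_ ?_
    · calc μ E ≤ κ * μ {x | thr n < Mset E x} := h1
        _ ≤ κ * (κ ^ J * μ (Metric.ball x (R' + 8 * R * (bb ^ (J + 1))⁻¹ + 8 * R * (1 - (2 ^ J)⁻¹)))) := by gcongr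
        _ ≤ κ * (κ ^ J * μ (Metric.ball x (R' + 8 * R * (1 - (2 ^ (J + 1))⁻¹)))) := by
            refine mul_le_mul_right (mul_le_mul_right (measure_mono (Metric.ball_subset_ball ?_)) _) _
            have : ((bb : ℝ) ^ (J + 1))⁻¹ ≤ (2 ^ (J + 1))⁻¹ := by
              gcongr; norm_num [bb]
            have e : ((2 : ℝ) ^ J)⁻¹ = 2 * (2 ^ (J + 1))⁻¹ := by rw [pow_succ]; field_simp
            rw [e]; nlinarith
        _ = _ := by rw [pow_succ]; ring
    · intro z hz
      obtain ⟨c, r, hr, hzc, hlt⟩ := (lt_Mset_iff hE.measurableSet z _).1 hz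
      have hne : (E ∩ Metric.ball c r).Nonempty := by
        rw [nonempty_iff_ne_empty]; intro h0; rw [h0] at hlt; simp at hlt
      obtain ⟨w, hwE, hwc⟩ := hne
      have hr4 : r < 4 * (bb ^ (J + 1))⁻¹ * R := by
        apply radius_lt c x
        rw [vol_ball_mul x (by positivity)]
        have h3 : thr n * volume (Metric.ball c r) < volume E := hlt.trans_le (measure_mono inter_subset_left)
        have h4 : thr n * volume (Metric.ball c r) * ENNReal.ofReal ((bb ^ (J + 1)) ^ n) < volume (Metric.ball x R) := by
          refine lt_of_lt_of_le ?_ hv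
          rw [mul_comm]
          have hp : ENNReal.ofReal ((bb ^ (J + 1)) ^ n) ≠ 0 := by
            simp only [ne_eq, ENNReal.ofReal_eq_zero, not_le]; positivity
          rw [ENNReal.mul_lt_mul_iff_right hp ENNReal.ofReal_ne_top]; exact h3
        have e : ENNReal.ofReal ((4 * (bb ^ (J + 1))⁻¹) ^ n) * (thr n * ENNReal.ofReal ((bb ^ (J + 1)) ^ n)) ≥ 1 := by
          unfold thr
          rw [← ENNReal.ofReal_inv_of_pos (by positivity), ← ENNReal.ofReal_mul (by positivity),
            ← ENNReal.ofReal_mul (by positivity), ge_iff_le, ENNReal.one_le_ofReal, mul_pow, inv_pow]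
          have e4 : (4 : ℝ) ^ n = 2 ^ n * 2 ^ n := by rw [← mul_pow]; norm_num
          have : (2 : ℝ) ≤ 2 ^ n := by simpa using pow_le_pow_right₀ (by norm_num : (1 : ℝ) ≤ 2) hn
          rw [e4, pow_succ]
          field_simp
          rw [pow_succ 2 n]
          nlinarith
        have hp4 : ENNReal.ofReal ((4 * (bb ^ (J + 1))⁻¹) ^ n) ≠ 0 := by
          simp only [ne_eq, ENNReal.ofReal_eq_zero, not_le]; positivity
        calc volume (Metric.ball c r) ≤ (ENNReal.ofReal ((4 * (bb ^ (J + 1))⁻¹) ^ n) * (thr n * ENNReal.ofReal ((bb ^ (J + 1)) ^ n))) * volume (Metric.ball c r) := by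
              nth_rw 1 [← one_mul (volume (Metric.ball c r))]
              gcongr
          _ = ENNReal.ofReal ((4 * (bb ^ (J + 1))⁻¹) ^ n) * (thr n * volume (Metric.ball c r) * ENNReal.ofReal ((bb ^ (J + 1)) ^ n)) := by ring
          _ < _ := by
            rw [ENNReal.mul_lt_mul_iff_right hp4 ENNReal.ofReal_ne_top]; exact h4
      have hw := hsub hwE
      rw [Metric.mem_ball] at *
      have := dist_triangle4 z c w x
      rw [dist_comm c w] at this
      linarith
    · refine le_trans ?_ hv
      calc ENNReal.ofReal ((bb ^ J) ^ n) * volume {z | thr n < Mset E z}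
          ≤ ENNReal.ofReal ((bb ^ J) ^ n) * (ENNReal.ofReal (bb ^ n) * volume E) := by
            gcongr; exact grow_vol hn hE.measurableSet
        _ = _ := by
            rw [← mul_assoc, ← ENNReal.ofReal_mul (by positivity), ← mul_pow, pow_succ]

lemma decay {n : ℕ} (hn : 1 ≤ n) {μ : Measure (En n)} {q : ℝ} {K : ℝ≥0∞} (h : SetP μ q K)
    (hq : 0 ≤ q) (hK : K < ⊤) :
    ∃ (η : ℝ) (C : ℝ≥0∞), 0 < η ∧ η ≤ 1 ∧ C < ⊤ ∧ ∀ (x : En n) (R : ℝ) (E : Set (En n)), 0 < R → IsOpen E →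
      E ⊆ Metric.ball x R →
      μ E ≤ C * (volume E / volume (Metric.ball x R)) ^ η * μ (Metric.ball x R) := by
  set M : ℝ≥0∞ := (K * ENNReal.ofReal (5 ^ n) ^ q) * (K * 2 ^ q) with hM
  have hMt : M ≠ ⊤ := by
    refine ENNReal.mul_ne_top (ENNReal.mul_ne_top hK.ne (ENNReal.rpow_ne_top_of_nonneg hq ENNReal.ofReal_ne_top))
      (ENNReal.mul_ne_top hK.ne (ENNReal.rpow_ne_top_of_nonneg hq (by norm_num)))
  have hκ : ∀ E : Set (En n), IsOpen E → volume E ≠ ⊤ →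
      μ E ≤ (M / (1 + M)) * μ {x | thr n < Mset E x} := by
    intro E hE hfin
    obtain ⟨h1, h2⟩ := grow_step hn h hq hE hfin
    rw [← hM] at h2
    rw [ENNReal.div_eq_inv_mul, mul_assoc, ← ENNReal.div_eq_inv_mul,
      ENNReal.le_div_iff_mul_le (Or.inl (by simp)) (Or.inl (by simp [hMt])), mul_add, mul_one]
    have e : μ {x | thr n < Mset E x} = μ E + μ ({x | thr n < Mset E x} \ E) := by
      rw [← measure_inter_add_sdiff {x | thr n < Mset E x} hE.measurableSet, inter_eq_right.2 h1]
    rw [e, mul_add, add_comm, mul_comm M (μ E)]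
    gcongr
  set A : ℝ := bb ^ n with hA
  have hA1 : 1 < A := one_lt_pow₀ (by norm_num [bb]) (by omega)
  have hκ1 : (M / (1 + M)) < 1 := by
    rw [ENNReal.div_lt_iff (Or.inl (by simp)) (Or.inl (by simp [hMt])), one_mul, add_comm]
    exact ENNReal.lt_add_right hMt (by simp)
  set κ : ℝ := max (M / (1 + M)).toReal A⁻¹ with hκd
  have hκlt : κ < 1 := by
    refine max_lt ?_ (inv_lt_one_of_one_lt₀ hA1)
    have := (ENNReal.toReal_lt_toReal (hκ1.trans ENNReal.one_lt_top).ne ENNReal.one_ne_top).2 hκ1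
    simpa using this
  have hκpos : 0 < κ := lt_max_of_lt_right (by positivity)
  have hκle : M / (1 + M) ≤ ENNReal.ofReal κ := by
    rw [← ENNReal.ofReal_toReal (hκ1.trans ENNReal.one_lt_top).ne]
    exact ENNReal.ofReal_le_ofReal (le_max_left _ _)
  set η : ℝ := - Real.logb A κ with hη
  have hAη : A ^ (-η) = κ := by rw [hη, neg_neg, Real.rpow_logb (by linarith) hA1.ne' hκpos]
  have hη0 : 0 < η := by rw [hη]; have := Real.logb_neg hA1 hκpos hκlt; linarith
  have hη1 : η ≤ 1 := by
    have : Real.logb A A⁻¹ ≤ Real.logb A κ := Real.logb_le_logb_of_le hA1 (by positivity) (le_max_right _ _)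
    rw [Real.logb_inv, Real.logb_self_eq_one hA1] at this
    linarith
  refine ⟨η, ENNReal.ofReal (A ^ η) * (K * ENNReal.ofReal (9 ^ n) ^ q), hη0, hη1, ?_, ?_⟩
  · exact (ENNReal.mul_ne_top ENNReal.ofReal_ne_top (ENNReal.mul_ne_top hK.ne
      (ENNReal.rpow_ne_top_of_nonneg hq ENNReal.ofReal_ne_top))).lt_top
  intro x R E hR hE hsub
  have hv0 := vol_ball_pos x hR
  have hvt := vol_ball_fin x R
  by_cases hE0 : volume E = 0
  · -- open null sets are empty
    have : E = ∅ := by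
      by_contra hne
      exact (hE.measure_pos volume (nonempty_iff_ne_empty.2 hne)).ne' hE0
    simp [this]
  have hfin : volume E ≠ ⊤ := measure_ne_top_of_subset hsub hvt
  set ρ := volume E / volume (Metric.ball x R) with hρ
  have hρ0 : ρ ≠ 0 := by rw [hρ]; simp [hE0, hvt]
  have hρt : ρ ≠ ⊤ := ENNReal.div_ne_top hfin hv0
  have hρ1 : ρ ≤ 1 := ENNReal.div_le_of_le_mul (by rw [one_mul]; exact measure_mono hsub)
  obtain ⟨k, hk1, hk2⟩ := ENNReal.exists_mem_Ioc_zpow hρ0 hρt (y := ENNReal.ofReal A)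
    (by rw [← ENNReal.ofReal_one]; exact (ENNReal.ofReal_lt_ofReal_iff (by linarith)).2 hA1) ENNReal.ofReal_ne_top
  have hA0' : ENNReal.ofReal A ≠ 0 := by simp; linarith
  have hA1' : 1 ≤ ENNReal.ofReal A := by rw [ENNReal.one_le_ofReal]; exact hA1.le
  have hkneg : k < 0 := by
    by_contra hc
    have := ENNReal.zpow_le_of_le hA1' (not_lt.1 hc)
    rw [zpow_zero] at this
    exact absurd (hk1.trans_le hρ1) (not_lt.2 this)
  obtain ⟨J, hJ⟩ : ∃ J : ℕ, k = -((J : ℤ) + 1) := ⟨(-k - 1).toNat, by omega⟩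
  have hk2' : ENNReal.ofReal ((bb ^ J) ^ n) * volume E ≤ volume (Metric.ball x R) := by
    have e1 : k + 1 = -(J : ℤ) := by omega
    rw [e1, hρ, ENNReal.div_le_iff hv0 hvt, ENNReal.zpow_neg, zpow_natCast] at hk2
    have e2 : ENNReal.ofReal ((bb ^ J) ^ n) = ENNReal.ofReal A ^ J := by
      rw [← ENNReal.ofReal_pow (by linarith), hA, ← pow_mul, ← pow_mul, mul_comm]
    rw [e2]
    calc _ ≤ ENNReal.ofReal A ^ J * ((ENNReal.ofReal A ^ J)⁻¹ * volume (Metric.ball x R)) := by gcongr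
      _ = _ := by
        rw [← mul_assoc, ENNReal.mul_inv_cancel (pow_ne_zero _ hA0') (ENNReal.pow_ne_top ENNReal.ofReal_ne_top), one_mul]
  have h1 := decay_claim hn h hq _ hκ x R hR J E R hE hsub hk2'
  have h2 : μ (Metric.ball x (R + 8 * R * (1 - (2 ^ J)⁻¹))) ≤ K * ENNReal.ofReal (9 ^ n) ^ q * μ (Metric.ball x R) := by
    refine le_trans (measure_mono (Metric.ball_subset_ball ?_)) (h.ball_le hq x 9 R (by norm_num) hR)
    have : (0 : ℝ) < (2 ^ J)⁻¹ := by positivity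
    nlinarith
  have h3 : (M / (1 + M)) ^ J ≤ ENNReal.ofReal (A ^ η) * ρ ^ η := by
    calc (M / (1 + M)) ^ J ≤ ENNReal.ofReal κ ^ J := by gcongr
      _ = ENNReal.ofReal (A ^ η) * ((ENNReal.ofReal A) ^ k) ^ η := by
          rw [← hAη, ← ENNReal.ofReal_rpow_of_pos (by linarith), ← ENNReal.ofReal_rpow_of_pos (by linarith),
            ← ENNReal.rpow_intCast, ← ENNReal.rpow_natCast, ← ENNReal.rpow_mul, ← ENNReal.rpow_mul,
            ← ENNReal.rpow_add _ _ hA0' ENNReal.ofReal_ne_top]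
          congr 1; rw [hJ]; push_cast; ring
      _ ≤ _ := by gcongr
  calc μ E ≤ _ := h1
    _ ≤ (ENNReal.ofReal (A ^ η) * ρ ^ η) * (K * ENNReal.ofReal (9 ^ n) ^ q * μ (Metric.ball x R)) := by gcongr
    _ = _ := by ring

lemma improve {n : ℕ} (hn : 1 ≤ n) {q : ℝ} (hq : 1 < q) (ω : En n → ℝ≥0∞) (hωmeas : Measurable ω)
    (hωloc : ∀ (x : En n) (r : ℝ), 0 < r → (∫⁻ y in Metric.ball x r, ω y) < ⊤)
    (hpos : ∀ c r, 0 < r → 0 < Wm ω (Metric.ball c r)) (hω : IsAp n q ω) :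
    ∃ (q' : ℝ) (C : ℝ≥0∞), 1 ≤ q' ∧ q' < q ∧ C < ⊤ ∧ ∀ (x : En n) (R : ℝ) (E : Set (En n)), 0 < R → IsOpen E →
      E ⊆ Metric.ball x R →
      volume E ^ q' * Wm ω (Metric.ball x R) ≤ C * volume (Metric.ball x R) ^ q' * Wm ω E := by
  obtain ⟨K, hK, hS, hA, hB⟩ := dual_facts hq ω hωmeas hωloc hpos hω
  have hq1 : 0 < q - 1 := by linarith
  obtain ⟨η, C, h1, h2, h3, h4⟩ := decay hn hS (by positivity) hK
  refine ⟨q - η * (q - 1), C ^ (q - 1) * K, by nlinarith, by nlinarith,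
    ENNReal.mul_lt_top (ENNReal.rpow_lt_top_of_nonneg hq1.le h3.ne) hK, ?_⟩
  intro x R E hR hE hsub
  have hv0 := vol_ball_pos x hR
  have hvt := vol_ball_fin x R
  by_cases hE0 : volume E = 0
  · rw [hE0, ENNReal.zero_rpow_of_pos (by nlinarith)]; simp
  have hfin : volume E ≠ ⊤ := measure_ne_top_of_subset hsub hvt
  set B := Metric.ball x R
  set a := η * (q - 1)
  have hEa0 : volume E ^ a ≠ 0 := by simp [ENNReal.rpow_eq_zero_iff, hE0, hfin]
  have hEat : volume E ^ a ≠ ⊤ := ENNReal.rpow_ne_top_of_nonneg (by positivity) hfin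
  rw [← ENNReal.mul_le_mul_iff_right hEa0 hEat]
  calc volume E ^ a * (volume E ^ (q - a) * Wm ω B) = volume E ^ q * Wm ω B := by
        rw [← mul_assoc, ← ENNReal.rpow_add _ _ hE0 hfin]; congr 2; ring
    _ ≤ (Wm ω E * (Wm (dual q ω) E) ^ (q - 1)) * Wm ω B := by gcongr; exact hA E hE.measurableSet
    _ ≤ (Wm ω E * (C * (volume E / volume B) ^ η * Wm (dual q ω) B) ^ (q - 1)) * Wm ω B := by
        gcongr; exact h4 x R E hR hE hsub
    _ = Wm ω E * C ^ (q - 1) * (volume E / volume B) ^ a * (Wm ω B * (Wm (dual q ω) B) ^ (q - 1)) := by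
        rw [ENNReal.mul_rpow_of_nonneg _ _ hq1.le, ENNReal.mul_rpow_of_nonneg _ _ hq1.le, ← ENNReal.rpow_mul]
        ring
    _ ≤ Wm ω E * C ^ (q - 1) * (volume E / volume B) ^ a * (K * volume B ^ q) :=
        mul_le_mul_right (hB x R hR) _
    _ = volume E ^ a * (C ^ (q - 1) * K * volume B ^ (q - a) * Wm ω E) := by
        rw [div_eq_mul_inv, ENNReal.mul_rpow_of_nonneg _ _ (by positivity)]
        have : (volume B)⁻¹ ^ a * volume B ^ q = volume B ^ (q - a) := by
          rw [ENNReal.inv_rpow, ← ENNReal.rpow_neg, ← ENNReal.rpow_add _ _ hv0 hvt]; congr 1; ring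
        calc _ = volume E ^ a * (C ^ (q - 1) * K * ((volume B)⁻¹ ^ a * volume B ^ q) * Wm ω E) := by ring
          _ = _ := by rw [this]

end BR

namespace BR

/-! ### Restricted weak type and the summation lemma -/

/-- Open-set version of the `A_q` property. -/
def OpenP {n : ℕ} (μ : Measure (En n)) (q : ℝ) (K : ℝ≥0∞) : Prop :=
  ∀ (c : En n) (r : ℝ) (E : Set (En n)), 0 < r → IsOpen E → E ⊆ Metric.ball c r →
    volume E ^ q * μ (Metric.ball c r) ≤ K * volume (Metric.ball c r) ^ q * μ E

lemma rwt {n : ℕ} {μ : Measure (En n)} {q : ℝ} {D K : ℝ≥0∞} (hD : Dbl μ D) (h : OpenP μ q K)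
    (hq : 0 ≤ q) {E : Set (En n)} (hE : IsOpen E) (a : ℝ≥0∞) (ha : a ≠ 0) (ha' : a ≠ ⊤) :
    μ {x | a < Mset E x} ≤ D * K * a ^ (-q) * μ E := by
  have := vitali_measure μ ((K * a ^ (-q)) • μ.restrict E) _ hD.dbl {x | a < Mset E x} ?_
  · simpa [mul_assoc] using this
  · intro x hx
    obtain ⟨c, r, h1, h2, h3⟩ := (lt_Mset_iff hE.measurableSet x a).1 hx
    refine ⟨c, r, h1, h2, ?_⟩
    have h4 := h c r (E ∩ Metric.ball c r) h1 (hE.inter Metric.isOpen_ball) inter_subset_right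
    have hv0 := vol_ball_pos c h1
    have hvt := vol_ball_fin c r
    have haq0 : a ^ q ≠ 0 := by simp [ENNReal.rpow_eq_zero_iff, ha, ha']
    have haqt : a ^ q ≠ ⊤ := ENNReal.rpow_ne_top_of_nonneg hq ha'
    have hvq0 : volume (Metric.ball c r) ^ q ≠ 0 := by
      simp [ENNReal.rpow_eq_zero_iff, hv0, hvt]
    have hvqt : volume (Metric.ball c r) ^ q ≠ ⊤ := ENNReal.rpow_ne_top_of_nonneg hq hvt
    rw [Measure.smul_apply, Measure.restrict_apply Metric.isOpen_ball.measurableSet, smul_eq_mul,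
      inter_comm, ← ENNReal.mul_le_mul_iff_right hvq0 hvqt, ← ENNReal.mul_le_mul_iff_right haq0 haqt]
    calc a ^ q * (volume (Metric.ball c r) ^ q * μ (Metric.ball c r))
        = (a * volume (Metric.ball c r)) ^ q * μ (Metric.ball c r) := by
          rw [ENNReal.mul_rpow_of_nonneg _ _ hq]; ring
      _ ≤ volume (E ∩ Metric.ball c r) ^ q * μ (Metric.ball c r) := by gcongr
      _ ≤ _ := h4
      _ = (a ^ q * a ^ (-q)) * (K * volume (Metric.ball c r) ^ q * μ (E ∩ Metric.ball c r)) := by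
          rw [ENNReal.rpow_neg, ENNReal.mul_inv_cancel haq0 haqt, one_mul]
      _ = _ := by ring

lemma G_level {n : ℕ} {μ : Measure (En n)} {s : ℝ} {D K : ℝ≥0∞} (hD : Dbl μ D) (h : OpenP μ s K)
    (hs : 0 ≤ s) {r : ℝ} (hr : 0 < r) {E : Set (En n)} (hE : IsOpen E) (k : ℕ)
    (a : ℝ≥0∞) (ha : a ≠ 0) (ha' : a ≠ ⊤) :
    μ {x | a < 2 ^ k * (Mset E x) ^ r} ≤ D * K * (a * (2 ^ k)⁻¹) ^ (-(s / r)) * μ E := by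
  have h20 : (2 : ℝ≥0∞) ^ k ≠ 0 := pow_ne_zero _ (by norm_num)
  have h2t : (2 : ℝ≥0∞) ^ k ≠ ⊤ := ENNReal.pow_ne_top (by norm_num)
  have hb0 : a * (2 ^ k)⁻¹ ≠ 0 := mul_ne_zero ha (ENNReal.inv_ne_zero.2 h2t)
  have hbt : a * (2 ^ k)⁻¹ ≠ ⊤ := ENNReal.mul_ne_top ha' (ENNReal.inv_ne_top.2 h20)
  have := rwt hD h hs hE ((a * (2 ^ k)⁻¹) ^ (1 / r)) (by simp [ENNReal.rpow_eq_zero_iff, hb0, hbt, -mul_eq_zero])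
    (ENNReal.rpow_ne_top_of_nonneg (by positivity) hbt)
  rw [← ENNReal.rpow_mul, show 1 / r * -s = -(s / r) by ring] at this
  refine le_trans (measure_mono ?_) this
  intro x hx
  simp only [mem_ofPred_eq] at hx ⊢
  rw [one_div, ENNReal.rpow_inv_lt_iff hr, ← div_eq_mul_inv,
    ENNReal.div_lt_iff (Or.inl h20) (Or.inl h2t), mul_comm]
  exact hx

lemma meas_G {n : ℕ} (E : Set (En n)) (k : ℕ) (r : ℝ) :
    Measurable (fun x => (2 : ℝ≥0∞) ^ k * (Mset E x) ^ r) :=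
  ((measurable_Mx _ _).pow_const r).const_mul _

lemma sum_lemma_B {n : ℕ} {μ : Measure (En n)} {s p r : ℝ} {D K : ℝ≥0∞} (hD : Dbl μ D) (hDt : D < ⊤)
    (hKt : K < ⊤) (h : OpenP μ s K)
    (hs : 0 < s) (hr : 0 < r) (hsp : s < p * r) :
    ∃ C : ℝ≥0∞, C < ⊤ ∧ ∀ E : ℕ → Set (En n), (∀ k, IsOpen (E k)) →
      μ {x | 1 / 2 < ∑' k : ℕ, 2 ^ k * (Mset (E k) x) ^ r} ≤
        C * ∑' k : ℕ, ((2 : ℝ≥0∞) ^ k) ^ p * μ (E k) := by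
  have hp' : 0 < s / r := by positivity
  have hlt : s / r < p := by rwa [div_lt_iff₀ hr]
  set p' := s / r
  set γ := p / p' - 1 with hγ
  have hγ0 : 0 < γ := by rw [hγ, sub_pos, one_lt_div hp']; exact hlt
  set c : ℝ≥0∞ := (1 - (2 : ℝ≥0∞) ^ (-γ)) / 2 with hc
  have hlt1 : (2 : ℝ≥0∞) ^ (-γ) < 1 := ENNReal.rpow_lt_one_of_one_lt_of_neg (by norm_num) (by linarith)
  have hsub0 : 1 - (2 : ℝ≥0∞) ^ (-γ) ≠ 0 := (tsub_pos_iff_lt.2 hlt1).ne'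
  have hsubt : 1 - (2 : ℝ≥0∞) ^ (-γ) ≠ ⊤ := (tsub_le_self.trans_lt ENNReal.one_lt_top).ne
  have hc0 : c ≠ 0 := by rw [hc]; simp [hsub0]
  have hct : c ≠ ⊤ := ENNReal.div_ne_top hsubt (by norm_num)
  refine ⟨D * K * c ^ (-p'), ?_, ?_⟩
  · refine ENNReal.mul_lt_top (ENNReal.mul_lt_top hDt hKt) ?_
    rw [ENNReal.rpow_neg, ENNReal.inv_lt_top, pos_iff_ne_zero]
    simp [ENNReal.rpow_eq_zero_iff, hc0, hct]
  intro E hE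
  have hz0 : ∀ k : ℕ, ((2 : ℝ≥0∞) ^ (-γ)) ^ k ≠ 0 := fun k => pow_ne_zero _ (by simp [ENNReal.rpow_eq_zero_iff])
  have hzt : ∀ k : ℕ, ((2 : ℝ≥0∞) ^ (-γ)) ^ k ≠ ⊤ := fun k => ENNReal.pow_ne_top (hlt1.trans ENNReal.one_lt_top).ne
  have hsub : {x | 1 / 2 < ∑' k : ℕ, 2 ^ k * (Mset (E k) x) ^ r} ⊆
      ⋃ k : ℕ, {x | c * ((2 : ℝ≥0∞) ^ (-γ)) ^ k < 2 ^ k * (Mset (E k) x) ^ r} := by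
    intro x hx
    by_contra hcon
    simp only [mem_iUnion, mem_ofPred_eq, not_exists, not_lt] at hcon hx
    refine absurd hx (not_lt.2 ?_)
    calc _ ≤ ∑' k : ℕ, c * ((2 : ℝ≥0∞) ^ (-γ)) ^ k := ENNReal.tsum_le_tsum hcon
      _ = 1 / 2 := by
        rw [ENNReal.tsum_mul_left, ENNReal.tsum_geometric, hc, div_eq_mul_inv, mul_right_comm,
          ENNReal.mul_inv_cancel hsub0 hsubt, one_mul, one_div]
  calc _ ≤ _ := measure_mono hsub
    _ ≤ ∑' k : ℕ, μ {x | c * ((2 : ℝ≥0∞) ^ (-γ)) ^ k < 2 ^ k * (Mset (E k) x) ^ r} := measure_iUnion_le _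
    _ ≤ ∑' k : ℕ, D * K * (c * ((2 : ℝ≥0∞) ^ (-γ)) ^ k * (2 ^ k)⁻¹) ^ (-p') * μ (E k) :=
        ENNReal.tsum_le_tsum fun k => G_level hD h hs.le hr (hE k) k _ (mul_ne_zero hc0 (hz0 k))
          (ENNReal.mul_ne_top hct (hzt k))
    _ = ∑' k : ℕ, (D * K * c ^ (-p')) * (((2 : ℝ≥0∞) ^ k) ^ p * μ (E k)) := by
        congr 1; ext k
        have e1 : ((2 : ℝ≥0∞) ^ (-γ)) ^ k * (2 ^ k)⁻¹ = (2 : ℝ≥0∞) ^ (-((1 + γ) * k)) := by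
          rw [← ENNReal.rpow_natCast, ← ENNReal.rpow_natCast, ← ENNReal.rpow_neg, ← ENNReal.rpow_mul,
            ← ENNReal.rpow_add _ _ (by norm_num) (by norm_num)]
          congr 1; ring
        have e2 : ((2 : ℝ≥0∞) ^ (-((1 + γ) * k))) ^ (-p') = ((2 : ℝ≥0∞) ^ k) ^ p := by
          rw [← ENNReal.rpow_natCast, ← ENNReal.rpow_mul, ← ENNReal.rpow_mul]
          congr 1
          rw [hγ]; field_simp; ring
        rw [mul_assoc c, e1, ENNReal.mul_rpow_of_ne_zero hc0 (by simp [ENNReal.rpow_eq_zero_iff]), e2]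
        ring
    _ = _ := ENNReal.tsum_mul_left

lemma min_one_le (v : ℝ≥0∞) :
    min v 1 ≤ ∑' j : ℕ, (if ((2 : ℝ≥0∞) ^ (j + 1))⁻¹ < v then ((2 : ℝ≥0∞) ^ j)⁻¹ else 0) := by
  rcases eq_or_ne v 0 with rfl | h0
  · simp
  have hm0 : min v 1 ≠ 0 := (lt_min (pos_iff_ne_zero.2 h0) one_pos).ne'
  obtain ⟨k, hk1, hk2⟩ := exists_zpow_two hm0 ((min_le_right v 1).trans_lt ENNReal.one_lt_top).ne
  have hk : k < 0 := by
    by_contra hc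
    have := zpow_two_mono (not_lt.1 hc)
    rw [zpow_zero] at this
    exact absurd (hk1.trans_le (min_le_right v 1)) (not_lt.2 this)
  obtain ⟨J, hJ⟩ : ∃ J : ℕ, k = -((J : ℤ) + 1) := ⟨(-k - 1).toNat, by omega⟩
  refine le_trans ?_ (ENNReal.le_tsum J)
  have e1 : ((2 : ℝ≥0∞) ^ (J + 1))⁻¹ = 2 ^ k := by
    rw [hJ, ENNReal.zpow_neg]; congr 1; exact_mod_cast (zpow_natCast (2 : ℝ≥0∞) (J + 1)).symm
  have e2 : ((2 : ℝ≥0∞) ^ J)⁻¹ = 2 ^ (k + 1) := by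
    have : k + 1 = -(J : ℤ) := by omega
    rw [this, ENNReal.zpow_neg, zpow_natCast]
  rw [e1, e2, if_pos (hk1.trans_le (min_le_left _ _))]
  exact hk2

lemma sum_lemma_A {n : ℕ} {μ : Measure (En n)} {q p r : ℝ} {D K : ℝ≥0∞} (hD : Dbl μ D) (hDt : D < ⊤)
    (hKt : K < ⊤) (h : OpenP μ q K)
    (hq : 0 < q) (hr : 0 < r) (hqp : q = p * r) (hp1 : p < 1) :
    ∃ C : ℝ≥0∞, C < ⊤ ∧ ∀ E : ℕ → Set (En n), (∀ k, IsOpen (E k)) →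
      μ {x | 1 / 2 < ∑' k : ℕ, 2 ^ k * (Mset (E k) x) ^ r} ≤
        C * ∑' k : ℕ, ((2 : ℝ≥0∞) ^ k) ^ p * μ (E k) := by
  have hpe : q / r = p := by rw [hqp]; field_simp
  have hlev : ∀ (E : Set (En n)), IsOpen E → ∀ (k : ℕ) (a : ℝ≥0∞), a ≠ 0 → a ≠ ⊤ →
      μ {x | a < 2 ^ k * (Mset E x) ^ r} ≤ D * K * a ^ (-p) * (((2 : ℝ≥0∞) ^ k) ^ p * μ E) := by
    intro E hE k a ha ha'
    have := G_level hD h hq.le hr hE k a ha ha'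
    rw [hpe, ENNReal.mul_rpow_of_ne_zero ha (by simp), ENNReal.inv_rpow, ENNReal.rpow_neg (2 ^ k), inv_inv] at this
    calc _ ≤ _ := this
      _ = _ := by ring
  set Z : ℝ≥0∞ := ∑' j : ℕ, ((2 : ℝ≥0∞) ^ j)⁻¹ * (((2 : ℝ≥0∞) ^ (j + 1))⁻¹) ^ (-p) with hZ
  have hZt : Z < ⊤ := by
    have : Z = ∑' j : ℕ, (2 : ℝ≥0∞) ^ p * ((2 : ℝ≥0∞) ^ (p - 1)) ^ j := by
      rw [hZ]; congr 1; ext j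
      rw [← ENNReal.rpow_natCast, ← ENNReal.rpow_natCast, ← ENNReal.rpow_natCast, ← ENNReal.rpow_neg,
        ← ENNReal.rpow_neg, ← ENNReal.rpow_mul, ← ENNReal.rpow_mul,
        ← ENNReal.rpow_add _ _ (by norm_num) (by norm_num), ← ENNReal.rpow_add _ _ (by norm_num) (by norm_num)]
      congr 1; push_cast; ring
    rw [this, ENNReal.tsum_mul_left, ENNReal.tsum_geometric]
    refine ENNReal.mul_lt_top (lt_top_iff_ne_top.2 (by simp [ENNReal.rpow_eq_top_iff])) ?_
    rw [ENNReal.inv_lt_top, tsub_pos_iff_lt]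
    exact ENNReal.rpow_lt_one_of_one_lt_of_neg (by norm_num) (by linarith)
  refine ⟨D * K + 2 * (D * K * Z), ?_, ?_⟩
  · have := ENNReal.mul_lt_top hDt hKt
    exact ENNReal.add_lt_top.2 ⟨this, ENNReal.mul_lt_top (by norm_num) (ENNReal.mul_lt_top this hZt)⟩
  intro E hE
  set T := ∑' k : ℕ, ((2 : ℝ≥0∞) ^ k) ^ p * μ (E k) with hT
  have hsub : {x | 1 / 2 < ∑' k : ℕ, 2 ^ k * (Mset (E k) x) ^ r} ⊆
      (⋃ k : ℕ, {x | 1 < 2 ^ k * (Mset (E k) x) ^ r}) ∪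
      {x | 1 / 2 ≤ ∑' k : ℕ, min (2 ^ k * (Mset (E k) x) ^ r) 1} := by
    intro x hx
    by_cases hc : ∃ k : ℕ, 1 < 2 ^ k * (Mset (E k) x) ^ r
    · exact Or.inl (mem_iUnion.2 hc)
    · right
      push Not at hc
      simp only [mem_ofPred_eq] at hx ⊢
      refine hx.le.trans (le_of_eq ?_)
      congr 1; ext k; rw [min_eq_left (hc k)]
  have h1 : μ (⋃ k : ℕ, {x | 1 < 2 ^ k * (Mset (E k) x) ^ r}) ≤ D * K * T := by
    refine (measure_iUnion_le _).trans ?_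
    rw [hT, ← ENNReal.tsum_mul_left]
    refine ENNReal.tsum_le_tsum fun k => ?_
    simpa using hlev (E k) (hE k) k 1 one_ne_zero ENNReal.one_ne_top
  have hInt : ∀ k : ℕ, ∫⁻ x, min (2 ^ k * (Mset (E k) x) ^ r) 1 ∂μ ≤ D * K * Z * (((2 : ℝ≥0∞) ^ k) ^ p * μ (E k)) := by
    intro k
    calc ∫⁻ x, min (2 ^ k * (Mset (E k) x) ^ r) 1 ∂μ
        ≤ ∫⁻ x, ∑' j : ℕ, (if ((2 : ℝ≥0∞) ^ (j + 1))⁻¹ < 2 ^ k * (Mset (E k) x) ^ r then ((2 : ℝ≥0∞) ^ j)⁻¹ else 0) ∂μ :=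
          lintegral_mono fun x => min_one_le _
      _ = ∑' j : ℕ, ∫⁻ x, (if ((2 : ℝ≥0∞) ^ (j + 1))⁻¹ < 2 ^ k * (Mset (E k) x) ^ r then ((2 : ℝ≥0∞) ^ j)⁻¹ else 0) ∂μ := by
          refine lintegral_tsum fun j => ?_
          exact (Measurable.ite (measurableSet_lt measurable_const (meas_G _ _ _)) measurable_const
            measurable_const).aemeasurable
      _ = ∑' j : ℕ, ((2 : ℝ≥0∞) ^ j)⁻¹ * μ {x | ((2 : ℝ≥0∞) ^ (j + 1))⁻¹ < 2 ^ k * (Mset (E k) x) ^ r} := by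
          congr 1; ext j
          rw [← lintegral_indicator_const (measurableSet_lt measurable_const (meas_G _ _ _))]
          congr 1; ext x; simp [indicator]
      _ ≤ ∑' j : ℕ, ((2 : ℝ≥0∞) ^ j)⁻¹ * (D * K * (((2 : ℝ≥0∞) ^ (j + 1))⁻¹) ^ (-p) * (((2 : ℝ≥0∞) ^ k) ^ p * μ (E k))) := by
          refine ENNReal.tsum_le_tsum fun j => mul_le_mul_right (hlev (E k) (hE k) k _ (by simp) (by simp)) _
      _ = _ := by
          rw [hZ, ← ENNReal.tsum_mul_left, ← ENNReal.tsum_mul_right]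
          congr 1; ext j; ring
  have h2 : μ {x | 1 / 2 ≤ ∑' k : ℕ, min (2 ^ k * (Mset (E k) x) ^ r) 1} ≤ 2 * (D * K * Z * T) := by
    have hm : ∀ k : ℕ, AEMeasurable (fun x => min (2 ^ k * (Mset (E k) x) ^ r) 1) μ := fun k =>
      ((meas_G (E k) k r).min measurable_const).aemeasurable
    have := mul_meas_ge_le_lintegral₀ (μ := μ) (AEMeasurable.ennreal_tsum hm) (1 / 2)
    rw [lintegral_tsum hm] at this
    have h3 : ∑' k : ℕ, ∫⁻ x, min (2 ^ k * (Mset (E k) x) ^ r) 1 ∂μ ≤ D * K * Z * T := by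
      rw [hT, ← ENNReal.tsum_mul_left]; exact ENNReal.tsum_le_tsum hInt
    calc _ = 2 * (1 / 2 * μ {x | 1 / 2 ≤ ∑' k : ℕ, min (2 ^ k * (Mset (E k) x) ^ r) 1}) := by
          rw [← mul_assoc, one_div, ENNReal.mul_inv_cancel (by norm_num) (by norm_num), one_mul]
      _ ≤ _ := mul_le_mul_right (this.trans h3) _
  calc _ ≤ _ := measure_mono hsub
    _ ≤ _ := measure_union_le _ _
    _ ≤ D * K * T + 2 * (D * K * Z * T) := add_le_add h1 h2
    _ = _ := by ring

end BR

namespace BR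

/-! ### Kernel estimate on level sets -/

/-- The model kernel. -/
def kap (n : ℕ) (N ε : ℝ) (z : En n) : ℝ≥0∞ := ENNReal.ofReal ((ε ^ n)⁻¹ * (1 + ‖z‖ / ε) ^ (-N))

lemma vol_ball_std {n : ℕ} (c : En n) {r : ℝ} (hr : 0 < r) :
    volume (Metric.ball c r) = ENNReal.ofReal (r ^ n) * volume (Metric.ball (0 : En n) 1) := by
  rw [← Measure.addHaar_ball_center volume c 1, ← vol_ball_mul c hr, mul_one]

lemma Mset_le_one {n : ℕ} {E : Set (En n)} (hE : MeasurableSet E) (x : En n) : Mset E x ≤ 1 := by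
  by_contra hc
  obtain ⟨c, r, -, -, h3⟩ := (lt_Mset_iff hE x 1).1 (not_le.1 hc)
  rw [one_mul] at h3
  exact absurd h3 (not_lt.2 (measure_mono inter_subset_right))

lemma inter_ball_le {n : ℕ} {E : Set (En n)} (hE : MeasurableSet E) (x c : En n) (r : ℝ) (hr : 0 < r)
    (hx : x ∈ Metric.ball c r) :
    volume (E ∩ Metric.ball c r) ≤ Mset E x * volume (Metric.ball c r) := by
  by_contra hc
  exact lt_irrefl _ ((lt_Mset_iff hE x (Mset E x)).2 ⟨c, r, hr, hx, not_le.1 hc⟩)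

lemma kap_meas {n : ℕ} (N ε : ℝ) (x : En n) : Measurable (fun y => kap n N ε (x - y)) := by
  unfold kap; fun_prop

lemma real_id {n : ℕ} {N ρ ε : ℝ} {i : ℕ} (hρ0 : 0 < ρ) (hε : 0 < ε) :
    (ε ^ n)⁻¹ * (2 ^ i * ρ) ^ (-N) * ρ ^ (-(n : ℝ)) * (2 ^ (i + 1) * ρ * ε) ^ n =
      2 ^ n * ρ ^ (-N) * ((2 : ℝ) ^ ((n : ℝ) - N)) ^ i := by
  have e0 : ((2 : ℝ) ^ ((n : ℝ) - N)) ^ i = (2 ^ i) ^ (-N) * (2 ^ i) ^ n := by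
    rw [← Real.rpow_natCast (2 ^ ((n : ℝ) - N)) i, ← Real.rpow_mul (by norm_num),
      ← Real.rpow_natCast (2 ^ i) n, ← Real.rpow_natCast 2 i, ← Real.rpow_mul (by norm_num),
      ← Real.rpow_mul (by norm_num), ← Real.rpow_add (by norm_num)]
    congr 1; ring
  have e2 : ρ ^ (-(n : ℝ)) * ρ ^ n = 1 := by
    rw [← Real.rpow_natCast ρ n, ← Real.rpow_add hρ0]; simp
  have e3 : (ε ^ n)⁻¹ * ε ^ n = 1 := by field_simp
  rw [Real.mul_rpow (by positivity) hρ0.le, e0, pow_succ, mul_pow, mul_pow, mul_pow]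
  calc _ = ((ε ^ n)⁻¹ * ε ^ n) * (ρ ^ (-(n : ℝ)) * ρ ^ n) *
        (2 ^ n * ρ ^ (-N) * ((2 ^ i) ^ (-N) * (2 ^ i) ^ n)) := by ring
    _ = _ := by rw [e2, e3]; ring

lemma kap_level {n : ℕ} (hn : 1 ≤ n) {N : ℝ} (hN : (n : ℝ) < N) :
    ∃ C : ℝ≥0∞, C < ⊤ ∧ ∀ (E S : Set (En n)) (ε : ℝ) (x : En n), 0 < ε → MeasurableSet E → MeasurableSet S →
      (∀ y ∈ S, Metric.ball y ε ⊆ E) →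
      ∫⁻ y in S, kap n N ε (x - y) ≤ C * (Mset E x) ^ (N / n) := by
  have hn0 : (0 : ℝ) < n := by exact_mod_cast hn
  have hN0 : 0 < N := hn0.trans hN
  set v1 := volume (Metric.ball (0 : En n) 1) with hv1
  set g : ℝ := 2 ^ ((n : ℝ) - N) with hg
  have hg0 : 0 < g := by positivity
  have hg1 : g < 1 := Real.rpow_lt_one_of_one_lt_of_neg (by norm_num) (by linarith)
  refine ⟨ENNReal.ofReal (2 ^ n) * v1 * (1 - ENNReal.ofReal g)⁻¹, ?_, ?_⟩
  · refine ENNReal.mul_lt_top (ENNReal.mul_lt_top ENNReal.ofReal_lt_top (vol_ball_fin _ _).lt_top) ?_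
    rw [ENNReal.inv_lt_top, tsub_pos_iff_lt, ENNReal.ofReal_lt_one]; exact hg1
  intro E S ε x hε hE hS hSE
  rcases S.eq_empty_or_nonempty with rfl | ⟨y0, hy0⟩
  · simp
  set θ := Mset E x with hθ
  have hθ1 : θ ≤ 1 := Mset_le_one hE x
  have hθt : θ ≠ ⊤ := (hθ1.trans_lt ENNReal.one_lt_top).ne
  have hlow : ∀ y ∈ S, ENNReal.ofReal ((1 + ‖x - y‖ / ε) ^ n)⁻¹ ≤ θ := by
    intro y hy
    have hd : 0 < 1 + ‖x - y‖ / ε := by positivity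
    have hx : x ∈ Metric.ball y ((1 + ‖x - y‖ / ε) * ε) := by
      rw [Metric.mem_ball, dist_eq_norm, add_mul, one_mul, div_mul_cancel₀ _ hε.ne']; linarith
    have h1 := inter_ball_le hE x y _ (by positivity) hx
    rw [vol_ball_mul y hd] at h1
    have h2 : volume (Metric.ball y ε) ≤ volume (E ∩ Metric.ball y ((1 + ‖x - y‖ / ε) * ε)) := by
      refine measure_mono (subset_inter (hSE y hy) (Metric.ball_subset_ball ?_))
      have : 0 ≤ ‖x - y‖ / ε := by positivity
      nlinarith
    have h3 := h2.trans h1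
    have hv0 := vol_ball_pos y hε
    have hvt := vol_ball_fin y ε
    have hz0 : ENNReal.ofReal ((1 + ‖x - y‖ / ε) ^ n) ≠ 0 := by
      simp only [ne_eq, ENNReal.ofReal_eq_zero, not_le]; positivity
    rw [ENNReal.ofReal_inv_of_pos (by positivity), ENNReal.inv_le_iff_le_mul (fun _ => hz0)
      (fun h => absurd h ENNReal.ofReal_ne_top)]
    rw [← mul_assoc, mul_comm] at h3
    nth_rw 1 [← mul_one (volume (Metric.ball y ε))] at h3
    rw [mul_comm]
    exact (ENNReal.mul_le_mul_iff_right hv0 hvt).1 h3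
  set t := θ.toReal with ht
  have hθe : θ = ENNReal.ofReal t := (ENNReal.ofReal_toReal hθt).symm
  have ht0 : 0 < t := by
    have h1 := hlow y0 hy0
    have : (0 : ℝ≥0∞) < ENNReal.ofReal ((1 + ‖x - y0‖ / ε) ^ n)⁻¹ := by
      rw [ENNReal.ofReal_pos]; positivity
    exact ENNReal.toReal_pos (this.trans_le h1).ne' hθt
  have ht1 : t ≤ 1 := by rw [ht]; exact ENNReal.toReal_le_of_le_ofReal (by norm_num) (by simpa using hθ1)
  set ρ : ℝ := t ^ (-(1 / (n : ℝ))) with hρ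
  have hρ0 : 0 < ρ := by positivity
  have hρn : ρ ^ (-(n : ℝ)) = t := by
    rw [hρ, ← Real.rpow_mul ht0.le]
    rw [show -(1 / (n : ℝ)) * -(n : ℝ) = 1 by field_simp, Real.rpow_one]
  have hθN : θ ^ (N / n) = ENNReal.ofReal (ρ ^ (-N)) := by
    rw [hθe, ENNReal.ofReal_rpow_of_pos ht0, ← hρn, ← Real.rpow_mul hρ0.le]
    congr 2; field_simp
  have hρle : ∀ y ∈ S, ρ ≤ 1 + ‖x - y‖ / ε := by
    intro y hy
    have hd : 0 < 1 + ‖x - y‖ / ε := by positivity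
    have h1 := hlow y hy
    rw [hθe, ENNReal.ofReal_le_ofReal_iff ht0.le, ← Real.rpow_natCast, ← Real.rpow_neg hd.le, ← hρn] at h1
    exact (Real.rpow_le_rpow_iff_of_neg hd hρ0 (by linarith)).1 h1
  have hpt : ∀ y, S.indicator (fun y => kap n N ε (x - y)) y ≤
      ∑' i : ℕ, (E ∩ Metric.ball x (2 ^ (i + 1) * ρ * ε)).indicator
        (fun _ => ENNReal.ofReal ((ε ^ n)⁻¹ * (2 ^ i * ρ) ^ (-N))) y := by
    intro y
    by_cases hy : y ∈ S
    · rw [indicator_of_mem hy]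
      have h1 : 1 ≤ (1 + ‖x - y‖ / ε) / ρ := by rw [one_le_div hρ0]; exact hρle y hy
      obtain ⟨i, hi1, hi2⟩ := exists_nat_pow_near h1 (by norm_num : (1 : ℝ) < 2)
      rw [le_div_iff₀ hρ0] at hi1
      rw [div_lt_iff₀ hρ0] at hi2
      refine le_trans ?_ (ENNReal.le_tsum i)
      have hmem : y ∈ E ∩ Metric.ball x (2 ^ (i + 1) * ρ * ε) := by
        refine ⟨hSE y hy (Metric.mem_ball_self hε), ?_⟩
        rw [Metric.mem_ball, dist_comm, dist_eq_norm]
        have : ‖x - y‖ / ε < 2 ^ (i + 1) * ρ := by linarith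
        rwa [div_lt_iff₀ hε] at this
      rw [indicator_of_mem hmem]
      unfold kap
      apply ENNReal.ofReal_le_ofReal
      refine mul_le_mul_of_nonneg_left ?_ (by positivity)
      refine Real.rpow_le_rpow_of_nonpos ?_ hi1 ?_
      · positivity
      · linarith
    · rw [indicator_of_notMem hy]; exact zero_le
  rw [← lintegral_indicator hS]
  calc ∫⁻ y, S.indicator (fun y => kap n N ε (x - y)) y
      ≤ ∫⁻ y, ∑' i : ℕ, (E ∩ Metric.ball x (2 ^ (i + 1) * ρ * ε)).indicator
        (fun _ => ENNReal.ofReal ((ε ^ n)⁻¹ * (2 ^ i * ρ) ^ (-N))) y := lintegral_mono hpt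
    _ = ∑' i : ℕ, ENNReal.ofReal ((ε ^ n)⁻¹ * (2 ^ i * ρ) ^ (-N)) *
          volume (E ∩ Metric.ball x (2 ^ (i + 1) * ρ * ε)) := by
        have hm : ∀ i : ℕ, MeasurableSet (E ∩ Metric.ball x (2 ^ (i + 1) * ρ * ε)) := fun i =>
          hE.inter Metric.isOpen_ball.measurableSet
        rw [lintegral_tsum fun i => (measurable_const.indicator (hm i)).aemeasurable]
        congr 1; ext i; rw [lintegral_indicator_const (hm i)]
    _ ≤ ∑' i : ℕ, (ENNReal.ofReal (2 ^ n) * v1 * ENNReal.ofReal (ρ ^ (-N))) * ENNReal.ofReal g ^ i := by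
        refine ENNReal.tsum_le_tsum fun i => ?_
        calc _ ≤ ENNReal.ofReal ((ε ^ n)⁻¹ * (2 ^ i * ρ) ^ (-N)) * (θ * volume (Metric.ball x (2 ^ (i + 1) * ρ * ε))) := by
              gcongr
              exact inter_ball_le hE x x _ (by positivity) (Metric.mem_ball_self (by positivity))
          _ = ENNReal.ofReal (2 ^ n * ρ ^ (-N) * g ^ i) * v1 := by
              rw [vol_ball_std x (by positivity), hθe, ← mul_assoc, ← mul_assoc, ← ENNReal.ofReal_mul (by positivity),
                ← ENNReal.ofReal_mul (mul_nonneg (by positivity) ht0.le)]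
              congr 2
              rw [← hρn]; exact real_id hρ0 hε
          _ = _ := by
              rw [ENNReal.ofReal_mul (by positivity), ENNReal.ofReal_mul (by positivity), ENNReal.ofReal_pow hg0.le]; ring
    _ = _ := by
        rw [ENNReal.tsum_mul_left, ENNReal.tsum_geometric, hθN]; ring

lemma kap_int {n : ℕ} (hn : 1 ≤ n) {N : ℝ} (hN : (n : ℝ) < N) :
    ∃ C : ℝ≥0∞, C < ⊤ ∧ ∀ (ε : ℝ) (x : En n), 0 < ε → ∫⁻ y, kap n N ε (x - y) ≤ C := by
  obtain ⟨C, hC, h⟩ := kap_level hn hN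
  refine ⟨C, hC, fun ε x hε => ?_⟩
  have := h univ univ ε x hε MeasurableSet.univ MeasurableSet.univ (fun y _ => subset_univ _)
  rw [Measure.restrict_univ] at this
  refine this.trans ?_
  have hn0 : (0 : ℝ) < n := by exact_mod_cast hn
  calc _ ≤ C * 1 := by
        gcongr
        exact ENNReal.rpow_le_one (Mset_le_one MeasurableSet.univ x) (by have := hn0.trans hN; positivity)
    _ = C := mul_one _

end BR

namespace BR

/-! ### Decay of the Bochner–Riesz kernel -/

/-- The holomorphic integrand. -/
def oscF (μ τ : ℝ) (z : ℂ) : ℂ := (1 - z ^ 2) ^ (μ : ℂ) * Complex.exp (-Complex.I * τ * z)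

lemma oscF_norm (μ τ : ℝ) (hμ : 0 < μ) (a b : ℝ) :
    ‖oscF μ τ ((a : ℂ) + (b : ℂ) * Complex.I)‖ =
      ‖(1 - ((a : ℂ) + (b : ℂ) * Complex.I) ^ 2)‖ ^ μ * Real.exp (τ * b) := by
  unfold oscF
  rw [norm_mul, Complex.norm_exp, Complex.norm_cpow_real]
  congr 2
  simp

lemma osc_re (z : ℂ) : (1 - z ^ 2).re = 1 - z.re ^ 2 + z.im ^ 2 := by
  simp [sq]; ring

lemma osc_side (μ τ : ℝ) (hμ : 0 < μ) (hτ : 0 < τ) (a : ℝ) (ha : a ^ 2 = 1) :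
    ‖∫ y in (-1 : ℝ)..0, oscF μ τ ((a : ℂ) + (y : ℂ) * Complex.I)‖
      ≤ 3 ^ μ * Real.Gamma (μ + 1) * τ ^ (-(μ + 1)) := by
  have habs : |a| = 1 := by
    rw [← Real.sqrt_sq_eq_abs, ha, Real.sqrt_one]
  have hg : IntegrableOn (fun x : ℝ => (3 : ℝ) ^ μ * (x ^ μ * Real.exp (-(τ * x)))) (Ioi 0) := by
    refine Integrable.const_mul ?_ _
    have := integrableOn_rpow_mul_exp_neg_mul_rpow (p := 1) (s := μ) (b := τ) (by linarith) one_pos hτ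
    refine this.congr_fun (fun x _ => ?_) measurableSet_Ioi
    simp
  have h1 : ∫ y in (-1 : ℝ)..0, oscF μ τ ((a : ℂ) + (y : ℂ) * Complex.I)
      = ∫ s in (0 : ℝ)..1, oscF μ τ ((a : ℂ) + ((-s : ℝ) : ℂ) * Complex.I) := by
    have := intervalIntegral.integral_comp_neg (a := 0) (b := 1)
      (fun y : ℝ => oscF μ τ ((a : ℂ) + (y : ℂ) * Complex.I))
    rw [this]; simp
  rw [h1]
  have hgi : IntervalIntegrable (fun x : ℝ => (3 : ℝ) ^ μ * (x ^ μ * Real.exp (-(τ * x)))) volume 0 1 := by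
    rw [intervalIntegrable_iff_integrableOn_Ioc_of_le zero_le_one]
    exact hg.mono_set (fun x hx => hx.1)
  calc _ ≤ ∫ s in (0 : ℝ)..1, (3 : ℝ) ^ μ * (s ^ μ * Real.exp (-(τ * s))) := by
        refine intervalIntegral.norm_integral_le_of_norm_le zero_le_one ?_ hgi
        refine Filter.Eventually.of_forall (fun s hs => ?_)
        rw [oscF_norm μ τ hμ, ← mul_assoc, ← Real.mul_rpow (by norm_num) hs.1.le]
        have h2 : ‖1 - ((a : ℂ) + ((-s : ℝ) : ℂ) * Complex.I) ^ 2‖ ≤ 3 * s := by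
          have e : 1 - ((a : ℂ) + ((-s : ℝ) : ℂ) * Complex.I) ^ 2
              = ((s ^ 2 : ℝ) : ℂ) + ((2 * a * s : ℝ) : ℂ) * Complex.I := by
            have hI := Complex.I_sq
            have ha' : (a : ℂ) ^ 2 = 1 := by exact_mod_cast ha
            push_cast
            linear_combination (-1 : ℂ) * ha' - (s : ℂ) ^ 2 * hI
          rw [e]
          refine (norm_add_le _ _).trans ?_
          rw [norm_mul, Complex.norm_I, Complex.norm_real, Complex.norm_real, mul_one,
            Real.norm_eq_abs, Real.norm_eq_abs, abs_mul, abs_mul, habs, abs_of_pos hs.1,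
            abs_of_nonneg (sq_nonneg s)]
          have := hs.1; have := hs.2
          norm_num
          nlinarith
        have h3 : τ * -s = -(τ * s) := by ring
        rw [h3]
        gcongr
    _ ≤ ∫ s in Ioi (0 : ℝ), (3 : ℝ) ^ μ * (s ^ μ * Real.exp (-(τ * s))) := by
        rw [intervalIntegral.integral_of_le zero_le_one]
        refine setIntegral_mono_set hg ?_ (Filter.Eventually.of_forall (fun x hx => hx.1))
        refine (ae_restrict_mem measurableSet_Ioi).mono (fun x hx => ?_)
        have : (0 : ℝ) < x := hx
        positivity
    _ = _ := by
        rw [integral_const_mul]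
        have := Real.integral_rpow_mul_exp_neg_mul_Ioi (a := μ + 1) (r := τ) (by linarith) hτ
        simp only [add_sub_cancel_right] at this
        rw [this, one_div, Real.inv_rpow hτ.le, Real.rpow_neg hτ.le]
        ring

lemma osc_bound (μ : ℝ) (hμ : 0 < μ) : ∃ C : ℝ, 0 ≤ C ∧ ∀ τ : ℝ, 1 ≤ τ →
    ‖∫ t in (-1 : ℝ)..1, (((1 - t ^ 2) ^ μ : ℝ) : ℂ) * Complex.exp (-Complex.I * τ * t)‖
      ≤ C * τ ^ (-(μ + 1)) := by
  obtain ⟨k, hk⟩ := exists_nat_ge (μ + 1)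
  refine ⟨2 * 5 ^ μ * (k.factorial : ℝ) + 2 * (3 ^ μ * Real.Gamma (μ + 1)), ?_, ?_⟩
  · have := Real.Gamma_pos_of_pos (s := μ + 1) (by linarith)
    positivity
  intro τ hτ
  have hτ0 : 0 < τ := by linarith
  have hre : ∀ z : ℂ, z.re ∈ Icc (-1 : ℝ) 1 → 0 ≤ (1 - z ^ 2).re := by
    intro z hz
    rw [osc_re]
    have := hz.1; have := hz.2
    nlinarith [sq_nonneg z.im]
  have hcont : ContinuousOn (oscF μ τ) (uIcc (-1 : ℝ) 1 ×ℂ uIcc (-1 : ℝ) 0) := by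
    intro z hz
    rw [Complex.mem_reProdIm, uIcc_of_le (by norm_num), uIcc_of_le (by norm_num)] at hz
    refine ContinuousAt.continuousWithinAt ?_
    unfold oscF
    refine ContinuousAt.mul ?_ (by fun_prop)
    have h1 := Complex.continuousAt_cpow_const_of_re_pos (z := 1 - z ^ 2) (w := (μ : ℂ))
      (Or.inl (hre z hz.1)) (by simpa using hμ)
    exact ContinuousAt.comp (f := fun z : ℂ => 1 - z ^ 2) h1 (by fun_prop)
  have hdiff : DifferentiableOn ℂ (oscF μ τ) (Ioo (-1 : ℝ) 1 ×ℂ Ioo (-1 : ℝ) 0) := by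
    intro z hz
    rw [Complex.mem_reProdIm] at hz
    refine DifferentiableAt.differentiableWithinAt ?_
    unfold oscF
    refine DifferentiableAt.mul ?_ (by fun_prop)
    refine DifferentiableAt.cpow (by fun_prop) (by fun_prop) ?_
    left
    rw [osc_re]
    have := hz.1.1; have := hz.1.2
    nlinarith [sq_nonneg z.im]
  have key := Complex.integral_boundary_rect_eq_zero_of_continuousOn_of_differentiableOn
    (oscF μ τ) (-1 - Complex.I) 1 (by simpa using hcont) (by simpa using hdiff)
  simp only [Complex.sub_re, Complex.neg_re, Complex.one_re, Complex.I_re, Complex.sub_im,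
    Complex.neg_im, Complex.one_im, Complex.I_im, sub_zero, neg_zero, zero_sub, Complex.ofReal_zero,
    zero_mul, add_zero] at key
  have htop : ∫ t in (-1 : ℝ)..1, (((1 - t ^ 2) ^ μ : ℝ) : ℂ) * Complex.exp (-Complex.I * τ * t)
      = ∫ t in (-1 : ℝ)..1, oscF μ τ (t : ℂ) := by
    refine intervalIntegral.integral_congr (fun t ht => ?_)
    rw [uIcc_of_le (by norm_num)] at ht
    have h0 : 0 ≤ 1 - t ^ 2 := by nlinarith [ht.1, ht.2]
    simp only [oscF]
    rw [Complex.ofReal_cpow h0]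
    push_cast
    rfl
  have s1 := osc_side μ τ hμ hτ0 1 (by norm_num)
  have s2 := osc_side μ τ hμ hτ0 (-1) (by norm_num)
  have hbot : ‖∫ x in (-1 : ℝ)..1, oscF μ τ ((x : ℂ) + ((-1 : ℝ) : ℂ) * Complex.I)‖
      ≤ 2 * 5 ^ μ * (k.factorial : ℝ) * τ ^ (-(μ + 1)) := by
    have hb : ∀ x ∈ Set.uIoc (-1 : ℝ) 1, ‖oscF μ τ ((x : ℂ) + ((-1 : ℝ) : ℂ) * Complex.I)‖
        ≤ 5 ^ μ * ((k.factorial : ℝ) * τ ^ (-(μ + 1))) := by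
      intro x hx
      rw [uIoc_of_le (by norm_num)] at hx
      rw [oscF_norm μ τ hμ]
      have h2 : ‖1 - ((x : ℂ) + ((-1 : ℝ) : ℂ) * Complex.I) ^ 2‖ ^ μ ≤ 5 ^ μ := by
        refine Real.rpow_le_rpow (norm_nonneg _) ?_ hμ.le
        have hz : ‖(x : ℂ) + ((-1 : ℝ) : ℂ) * Complex.I‖ ≤ 2 := by
          refine (norm_add_le _ _).trans ?_
          rw [norm_mul, Complex.norm_I, Complex.norm_real, Complex.norm_real]
          have : ‖x‖ ≤ 1 := abs_le.2 ⟨hx.1.le, hx.2⟩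
          norm_num at this ⊢
          linarith
        refine (norm_sub_le _ _).trans ?_
        rw [norm_pow, norm_one]
        nlinarith [norm_nonneg ((x : ℂ) + ((-1 : ℝ) : ℂ) * Complex.I)]
      have h3 : Real.exp (τ * -1) ≤ (k.factorial : ℝ) * τ ^ (-(μ + 1)) := by
        have h4 := Real.pow_div_factorial_le_exp τ hτ0.le k
        have h5 : τ ^ (μ + 1) ≤ τ ^ k := by
          rw [← Real.rpow_natCast]
          exact Real.rpow_le_rpow_of_exponent_le hτ hk
        have hf : (0 : ℝ) < k.factorial := by exact_mod_cast k.factorial_pos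
        rw [div_le_iff₀ hf] at h4
        rw [mul_neg_one, Real.exp_neg, Real.rpow_neg hτ0.le, ← div_eq_mul_inv,
          inv_le_comm₀ (Real.exp_pos _) (by positivity), inv_div, div_le_iff₀ hf]
        linarith
      exact mul_le_mul h2 h3 (Real.exp_nonneg _) (by positivity)
    refine (intervalIntegral.norm_integral_le_of_norm_le_const hb).trans (le_of_eq ?_)
    norm_num; ring
  rw [htop]
  have e : ∫ t in (-1 : ℝ)..1, oscF μ τ (t : ℂ) =
    (∫ x in (-1 : ℝ)..1, oscF μ τ ((x : ℂ) + ((-1 : ℝ) : ℂ) * Complex.I))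
    + Complex.I • (∫ y in (-1 : ℝ)..0, oscF μ τ (((1 : ℝ) : ℂ) + (y : ℂ) * Complex.I))
    - Complex.I • (∫ y in (-1 : ℝ)..0, oscF μ τ (((-1 : ℝ) : ℂ) + (y : ℂ) * Complex.I)) := by
    linear_combination -key
  rw [e]
  refine (norm_sub_le _ _).trans ?_
  refine (add_le_add_left (norm_add_le _ _) _).trans ?_
  rw [norm_smul, norm_smul, Complex.norm_I, one_mul, one_mul]
  linarith

end BR

namespace BR

/-- The Bochner–Riesz multiplier. -/
def brm (n : ℕ) (δ : ℝ) (ξ : En n) : ℝ := (max (1 - ‖ξ‖ ^ 2) 0) ^ δ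

lemma sum_eq_inner {n : ℕ} (x ξ : En n) : ∑ i, x i * ξ i = inner ℝ x ξ := by
  rw [PiLp.inner_apply]
  refine Finset.sum_congr rfl (fun i _ => ?_)
  simp [mul_comm]

lemma brKernel_eq (n : ℕ) (δ : ℝ) (x : En n) : brKernel n δ x =
    ∫ ξ : En n, ((brm n δ ξ : ℝ) : ℂ) *
      Complex.exp (-(2 * Real.pi) * Complex.I * ((inner ℝ x ξ : ℝ) : ℂ)) := by
  unfold brKernel brm
  simp_rw [sum_eq_inner]

lemma brKernel_rot {n : ℕ} (δ : ℝ) {x y : En n} (h : ‖x‖ = ‖y‖) :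
    brKernel n δ x = brKernel n δ y := by
  set R := (Submodule.span ℝ {x - y})ᗮ.reflection with hR
  have hRx : R x = y := Submodule.reflection_sub h
  rw [brKernel_eq, brKernel_eq]
  have := (R.measurePreserving).integral_comp R.toHomeomorph.measurableEmbedding
    (fun ξ : En n => ((brm n δ ξ : ℝ) : ℂ) *
      Complex.exp (-(2 * Real.pi) * Complex.I * ((inner ℝ y ξ : ℝ) : ℂ)))
  rw [← this]
  refine integral_congr_ae (Filter.Eventually.of_forall (fun ξ => ?_))
  simp only [brm, LinearIsometryEquiv.norm_map]
  rw [← hRx, LinearIsometryEquiv.inner_map_map]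

/-- Integral over the remaining variables. -/
def Hd (d : ℕ) (δ a : ℝ) : ℝ := ∫ w : Fin d → ℝ, (max (a - ∑ i, w i ^ 2) 0) ^ δ

lemma Hd_eq (d : ℕ) {δ : ℝ} (hδ : 0 < δ) (hμ : 0 < δ + d / 2) (a : ℝ) :
    Hd d δ a = (max a 0) ^ (δ + d / 2) * Hd d δ 1 := by
  rcases le_or_gt a 0 with ha | ha
  · rw [max_eq_right ha, Real.zero_rpow hμ.ne', zero_mul]
    unfold Hd
    have : ∀ w : Fin d → ℝ, (max (a - ∑ i, w i ^ 2) 0) ^ δ = 0 := by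
      intro w
      rw [max_eq_right, Real.zero_rpow hδ.ne']
      have : 0 ≤ ∑ i, w i ^ 2 := Finset.sum_nonneg (fun i _ => sq_nonneg _)
      linarith
    simp [this]
  · rw [max_eq_left ha.le]
    have hs : 0 < √a := Real.sqrt_pos.2 ha
    have key := Measure.integral_comp_smul (volume : Measure (Fin d → ℝ))
      (fun w : Fin d → ℝ => (max (a - ∑ i, w i ^ 2) 0) ^ δ) (√a)
    have e : ∀ w : Fin d → ℝ, (max (a - ∑ i, (√a • w) i ^ 2) 0) ^ δ
        = a ^ δ * (max (1 - ∑ i, w i ^ 2) 0) ^ δ := by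
      intro w
      rw [← Real.mul_rpow ha.le (le_max_right _ _), mul_max_of_nonneg _ _ ha.le, mul_zero]
      congr 2
      simp only [Pi.smul_apply, smul_eq_mul, mul_pow, Real.sq_sqrt ha.le]
      rw [← Finset.mul_sum]; ring
    simp_rw [e] at key
    rw [integral_const_mul] at key
    change _ * Hd d δ 1 = _ • Hd d δ a at key
    rw [Module.finrank_fin_fun, abs_of_pos (by positivity), smul_eq_mul] at key
    have h2 : a ^ (δ + d / 2) = a ^ δ * √a ^ d := by
      rw [Real.rpow_add ha, Real.sqrt_eq_rpow, ← Real.rpow_natCast, ← Real.rpow_mul ha.le]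
      congr 2; ring
    rw [h2]
    have h3 : (√a ^ d) ≠ 0 := by positivity
    field_simp at key
    linarith

lemma brKernel_slice (d : ℕ) {δ : ℝ} (hδ : 0 < δ) (hμ : 0 < δ + d / 2) (x : En (d + 1)) :
    brKernel (d + 1) δ x = (Hd d δ 1 : ℂ) *
      ∫ t in (-1 : ℝ)..1, (((1 - t ^ 2) ^ (δ + d / 2) : ℝ) : ℂ) *
        Complex.exp (-Complex.I * ((2 * Real.pi * ‖x‖ : ℝ) : ℂ) * t) := by
  set y : En (d + 1) := EuclideanSpace.single 0 ‖x‖ with hy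
  have hxy : ‖x‖ = ‖y‖ := by rw [hy]; simp
  rw [brKernel_rot δ hxy]
  unfold brKernel
  set G : ℝ × (Fin d → ℝ) → ℂ := fun z => (((max (1 - z.1 ^ 2 - ∑ i, z.2 i ^ 2) 0) ^ δ : ℝ) : ℂ) *
    Complex.exp (-Complex.I * ((2 * Real.pi * ‖x‖ : ℝ) : ℂ) * (z.1 : ℂ)) with hG
  set e := MeasurableEquiv.piFinSuccAbove (fun _ : Fin (d + 1) => ℝ) 0 with he
  have h1 : ∫ ξ : En (d + 1), (((max (1 - ‖ξ‖ ^ 2) 0) ^ δ : ℝ) : ℂ) *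
      Complex.exp (-(2 * Real.pi) * Complex.I * ((∑ i, y i * ξ i : ℝ) : ℂ))
      = ∫ z, G z := by
    rw [← (volume_preserving_piFinSuccAbove (fun _ : Fin (d + 1) => ℝ) 0).integral_comp
      e.measurableEmbedding,
      ← (PiLp.volume_preserving_ofLp (Fin (d + 1))).integral_comp
        (MeasurableEquiv.toLp 2 (Fin (d + 1) → ℝ)).symm.measurableEmbedding]
    refine integral_congr_ae (Filter.Eventually.of_forall (fun ξ => ?_))
    have a1 : 1 - ‖ξ‖ ^ 2 = 1 - (ξ 0) ^ 2 - ∑ i : Fin d, (ξ i.succ) ^ 2 := by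
      rw [EuclideanSpace.norm_sq_eq, Fin.sum_univ_succ]
      simp only [Real.norm_eq_abs, sq_abs]
      ring
    have a2 : ∑ i, y i * ξ i = ‖x‖ * ξ 0 := by
      rw [Fin.sum_univ_succ]
      simp [hy]
    simp only [hG, a1, a2, MeasurableEquiv.piFinSuccAbove]
    simp only [Fin.insertNthEquiv_zero]
    simp [Fin.tail]
    left
    congr 1
    ring
  rw [h1]
  have hcont : Continuous G := by
    rw [hG]
    refine Continuous.mul ?_ (by fun_prop)
    refine Complex.continuous_ofReal.comp ?_
    refine Continuous.rpow_const (by fun_prop) (fun _ => Or.inr hδ.le)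
  have hsupp : HasCompactSupport G := by
    refine HasCompactSupport.intro (isCompact_closedBall (0 : ℝ × (Fin d → ℝ)) 1) (fun z hz => ?_)
    rw [mem_closedBall_zero_iff, Prod.norm_def, max_le_iff, not_and_or] at hz
    have : 1 - z.1 ^ 2 - ∑ i, z.2 i ^ 2 ≤ 0 := by
      have hs : 0 ≤ ∑ i, z.2 i ^ 2 := Finset.sum_nonneg (fun i _ => sq_nonneg _)
      rcases hz with hz | hz
      · rw [Real.norm_eq_abs, not_le] at hz
        have : 1 ≤ z.1 ^ 2 := by
          rw [← sq_abs]; nlinarith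
        linarith
      · rw [pi_norm_le_iff_of_nonneg zero_le_one] at hz
        push Not at hz
        obtain ⟨i, hi⟩ := hz
        have h2 : 1 ≤ z.2 i ^ 2 := by
          rw [Real.norm_eq_abs] at hi
          rw [← sq_abs]; nlinarith
        have h3 := Finset.single_le_sum (f := fun i => z.2 i ^ 2) (fun i _ => sq_nonneg (z.2 i))
          (Finset.mem_univ i)
        nlinarith [sq_nonneg z.1]
    simp only [hG, max_eq_right this, Real.zero_rpow hδ.ne', Complex.ofReal_zero, zero_mul]
  have hInt : Integrable G (volume.prod volume) := hcont.integrable_of_hasCompactSupport hsupp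
  change ∫ z, G z ∂(volume.prod volume) = _
  rw [integral_prod _ hInt]
  have h2 : ∀ t : ℝ, ∫ w, G (t, w) = (Hd d δ 1 : ℂ) * ((((max (1 - t ^ 2) 0) ^ (δ + d / 2) : ℝ) : ℂ) *
        Complex.exp (-Complex.I * ((2 * Real.pi * ‖x‖ : ℝ) : ℂ) * t)) := by
    intro t
    simp only [hG]
    rw [integral_mul_const, integral_complex_ofReal]
    change ((Hd d δ (1 - t ^ 2) : ℝ) : ℂ) * _ = _
    rw [Hd_eq d hδ hμ]
    push_cast
    ring
  simp_rw [h2]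
  rw [integral_const_mul]
  congr 1
  rw [intervalIntegral.integral_of_le (by norm_num), ← integral_indicator measurableSet_Ioc]
  refine integral_congr_ae (Filter.Eventually.of_forall (fun t => ?_))
  by_cases ht : t ∈ Ioc (-1 : ℝ) 1
  · rw [indicator_of_mem ht]
    have : 0 ≤ 1 - t ^ 2 := by nlinarith [ht.1, ht.2]
    simp only [max_eq_left this]
  · rw [indicator_of_notMem ht]
    have : 1 - t ^ 2 ≤ 0 := by
      rw [mem_Ioc, not_and_or] at ht
      rcases ht with h | h <;> nlinarith
    simp only [max_eq_right this, Real.zero_rpow hμ.ne', Complex.ofReal_zero, zero_mul]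

lemma brm_cont {n : ℕ} {δ : ℝ} (hδ : 0 < δ) : Continuous (brm n δ) := by
  unfold brm
  exact Continuous.rpow_const (by fun_prop) (fun _ => Or.inr hδ.le)

lemma brm_zero {n : ℕ} {δ : ℝ} (hδ : 0 < δ) {ξ : En n} (h : 1 ≤ ‖ξ‖) : brm n δ ξ = 0 := by
  unfold brm
  rw [max_eq_right (by nlinarith), Real.zero_rpow hδ.ne']

lemma brm_supp {n : ℕ} {δ : ℝ} (hδ : 0 < δ) : HasCompactSupport (brm n δ) := by
  refine HasCompactSupport.intro (isCompact_closedBall (0 : En n) 1) (fun z hz => ?_)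
  rw [mem_closedBall_zero_iff, not_le] at hz
  exact brm_zero hδ hz.le

lemma brKernel_decay {n : ℕ} (hn : 1 ≤ n) {δ : ℝ} (hδ : ((n : ℝ) - 1) / 2 < δ) :
    ∃ C : ℝ, 0 < C ∧ ∀ x : En n,
      ‖brKernel n δ x‖ ≤ C * (1 + ‖x‖) ^ (-(((n : ℝ) + 1) / 2 + δ)) := by
  obtain ⟨d, rfl⟩ : ∃ d, n = d + 1 := ⟨n - 1, by omega⟩
  have hd0 : (0 : ℝ) ≤ d := Nat.cast_nonneg d
  have hδ0 : 0 < δ := by push_cast at hδ; linarith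
  have hμ : 0 < δ + (d : ℝ) / 2 := by positivity
  obtain ⟨C, hC, H⟩ := osc_bound _ hμ
  set N : ℝ := (((d + 1 : ℕ) : ℝ) + 1) / 2 + δ with hN
  have hNe : N = δ + (d : ℝ) / 2 + 1 := by rw [hN]; push_cast; ring
  have hN0 : 0 < N := by rw [hNe]; linarith
  set A : ℝ := ∫ ξ : En (d + 1), brm (d + 1) δ ξ with hA
  have hA0 : 0 ≤ A := integral_nonneg (fun ξ => Real.rpow_nonneg (le_max_right _ _) _)
  have hbd : ∀ x : En (d + 1), ‖brKernel (d + 1) δ x‖ ≤ A := by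
    intro x
    rw [brKernel_eq]
    refine (norm_integral_le_integral_norm _).trans (le_of_eq ?_)
    refine integral_congr_ae (Filter.Eventually.of_forall (fun ξ => ?_))
    simp only [norm_mul, Complex.norm_real]
    rw [Complex.norm_exp]
    simp [brm, abs_of_nonneg (Real.rpow_nonneg (le_max_right _ _) _)]
  refine ⟨|Hd d δ 1| * C * 2 ^ N + A * 2 ^ N + 1, by positivity, fun x => ?_⟩
  have hx1 : 0 < 1 + ‖x‖ := by positivity
  have hpi := Real.pi_gt_three
  have hpos : 0 < (1 + ‖x‖) ^ (-N) := Real.rpow_pos_of_pos hx1 _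
  have hsplit : ∀ a : ℝ, 0 < a → 1 + ‖x‖ ≤ 2 * a → a ^ (-N) ≤ 2 ^ N * (1 + ‖x‖) ^ (-N) := by
    intro a ha h
    have h1 := Real.rpow_le_rpow_of_nonpos (z := -N) hx1 h (by linarith)
    rw [Real.mul_rpow (by norm_num) ha.le] at h1
    have h2 : (2 : ℝ) ^ N * 2 ^ (-N) = 1 := by
      rw [← Real.rpow_add (by norm_num)]; simp
    have h3 : (0 : ℝ) < 2 ^ N := by positivity
    calc a ^ (-N) = 2 ^ N * (2 ^ (-N) * a ^ (-N)) := by rw [← mul_assoc, h2, one_mul]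
      _ ≤ _ := mul_le_mul_of_nonneg_left h1 h3.le
  rcases le_or_gt 1 (2 * Real.pi * ‖x‖) with h | h
  · rw [brKernel_slice d hδ0 hμ, norm_mul, Complex.norm_real, Real.norm_eq_abs]
    have h1 := H _ h
    rw [← hNe] at h1
    have h2 := hsplit (2 * Real.pi * ‖x‖) (by linarith) (by nlinarith [norm_nonneg x])
    calc _ ≤ |Hd d δ 1| * (C * (2 ^ N * (1 + ‖x‖) ^ (-N))) := by
          refine mul_le_mul_of_nonneg_left (h1.trans ?_) (abs_nonneg _)
          exact mul_le_mul_of_nonneg_left h2 hC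
      _ = (|Hd d δ 1| * C * 2 ^ N) * (1 + ‖x‖) ^ (-N) := by ring
      _ ≤ _ := by
          refine mul_le_mul_of_nonneg_right ?_ hpos.le
          have : 0 ≤ A * 2 ^ N := by positivity
          linarith
  · have hx : ‖x‖ ≤ 1 := by nlinarith [norm_nonneg x]
    have h2 := hsplit 1 one_pos (by linarith)
    rw [Real.one_rpow] at h2
    calc _ ≤ A * 1 := by rw [mul_one]; exact hbd x
      _ ≤ A * (2 ^ N * (1 + ‖x‖) ^ (-N)) := mul_le_mul_of_nonneg_left h2 hA0
      _ = (A * 2 ^ N) * (1 + ‖x‖) ^ (-N) := by ring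
      _ ≤ _ := by
          refine mul_le_mul_of_nonneg_right ?_ hpos.le
          have : 0 ≤ |Hd d δ 1| * C * 2 ^ N := by positivity
          linarith

end BR

namespace BR

/-! ### Fourier multipliers -/

/-- The character. -/
def ech {n : ℕ} (y ξ : En n) : ℂ := Complex.exp (((2 * Real.pi * inner ℝ y ξ : ℝ) : ℂ) * Complex.I)

lemma ech_norm {n : ℕ} (y ξ : En n) : ‖ech y ξ‖ = 1 := by
  unfold ech; exact Complex.norm_exp_ofReal_mul_I _

lemma ech_cont {n : ℕ} : Continuous (fun z : En n × En n => ech z.1 z.2) := by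
  unfold ech; fun_prop

lemma ech_cont2 {n : ℕ} {X : Type*} [TopologicalSpace X] {a b : X → En n} (ha : Continuous a)
    (hb : Continuous b) : Continuous (fun x => ech (a x) (b x)) :=
  ech_cont.comp (ha.prodMk hb)

lemma ech_add {n : ℕ} (y z ξ : En n) : ech (y + z) ξ = ech y ξ * ech z ξ := by
  unfold ech
  rw [← Complex.exp_add, inner_add_left]
  congr 1; push_cast; ring

lemma ech_smul {n : ℕ} (t : ℝ) (z ξ : En n) : ech (t • z) ξ = ech z (t • ξ) := by
  unfold ech
  rw [inner_smul_left, inner_smul_right]; simp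

/-- Inverse Fourier transform. -/
def Tm {n : ℕ} (g : En n → ℂ) (y : En n) : ℂ := ∫ ξ, g ξ * ech y ξ

/-- Fourier transform. -/
def FT {n : ℕ} (k : En n → ℂ) (ξ : En n) : ℂ := ∫ w, k w * ech (-w) ξ

lemma Tm_eq {n : ℕ} (g : En n → ℂ) : Tm g = FourierTransformInv.fourierInv g := by
  funext y
  rw [Real.fourierInv_eq']
  unfold Tm ech
  refine integral_congr_ae (Filter.Eventually.of_forall (fun ξ => ?_))
  simp only [smul_eq_mul, real_inner_comm]
  ring

lemma FT_eq {n : ℕ} (g : En n → ℂ) : FT g = FourierTransform.fourier g := by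
  funext y
  rw [Real.fourier_eq']
  unfold FT ech
  refine integral_congr_ae (Filter.Eventually.of_forall (fun ξ => ?_))
  simp only [smul_eq_mul, inner_neg_left]
  rw [mul_comm]
  congr 3
  push_cast; ring

lemma int_ech {n : ℕ} {g : En n → ℂ} (hg : Integrable g) (y : En n) :
    Integrable (fun ξ => g ξ * ech y ξ) := by
  refine hg.mul_bdd (c := 1) ?_ ?_
  · exact (ech_cont.comp (by fun_prop : Continuous fun ξ : En n => (y, ξ))).aestronglyMeasurable
  · exact Filter.Eventually.of_forall (fun ξ => (ech_norm _ _).le)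

lemma Tm_norm_le {n : ℕ} (g : En n → ℂ) (y : En n) : ‖Tm g y‖ ≤ ∫ ξ, ‖g ξ‖ := by
  unfold Tm
  refine (norm_integral_le_integral_norm _).trans (le_of_eq ?_)
  simp [ech_norm]

lemma Tm_cont {n : ℕ} {g : En n → ℂ} (hg : Integrable g) : Continuous (Tm g) := by
  unfold Tm
  refine continuous_of_dominated (bound := fun ξ => ‖g ξ‖) (fun y => (int_ech hg y).1) (fun y => ?_)
    hg.norm ?_
  · exact Filter.Eventually.of_forall (fun ξ => by simp [ech_norm])
  · refine Filter.Eventually.of_forall (fun ξ => ?_)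
    exact continuous_const.mul (ech_cont.comp (by fun_prop : Continuous fun y : En n => (y, ξ)))

lemma Tm_conv {n : ℕ} {k g : En n → ℂ} (hk : Integrable k) (hg : Integrable g) (t : ℝ) (y : En n) :
    ∫ w, k w * Tm g (y - t • w) = Tm (fun ξ => FT k (t • ξ) * g ξ) y := by
  have e : ∀ w ξ : En n, ech (y - t • w) ξ = ech (-w) (t • ξ) * ech y ξ := by
    intro w ξ
    rw [sub_eq_add_neg, ech_add, ← smul_neg, ech_smul, mul_comm]
  unfold Tm FT
  simp_rw [e, ← integral_const_mul]
  rw [integral_integral_swap]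
  · refine integral_congr_ae (Filter.Eventually.of_forall (fun ξ => ?_))
    simp only
    rw [mul_assoc, ← integral_mul_const]
    refine integral_congr_ae (Filter.Eventually.of_forall (fun w => ?_))
    simp only
    ring
  · have h1 : Integrable (fun z : En n × En n => k z.1 * g z.2) (volume.prod volume) :=
      hk.mul_prod hg
    have hc : Continuous (fun z : En n × En n => ech (-z.1) (t • z.2) * ech y z.2) :=
      (ech_cont2 continuous_fst.neg (continuous_snd.const_smul t)).mul
        (ech_cont2 continuous_const continuous_snd)
    have hb : ∀ z : En n × En n, ‖ech (-z.1) (t • z.2) * ech y z.2‖ ≤ 1 := by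
      intro z
      rw [norm_mul, ech_norm, ech_norm, one_mul]
    have h2 := h1.mul_bdd (c := 1) hc.aestronglyMeasurable (Filter.Eventually.of_forall hb)
    refine h2.congr (Filter.Eventually.of_forall (fun z => ?_))
    simp only [Function.uncurry]
    ring

lemma Tm_schwartz {n : ℕ} (f : SchwartzMap (En n) ℂ) :
    Tm (FourierTransform.fourier f : SchwartzMap (En n) ℂ) = f := by
  rw [Tm_eq, ← SchwartzMap.fourierInv_coe, FourierTransform.fourierInv_fourier_eq]

lemma FT_schwartz {n : ℕ} (a : SchwartzMap (En n) ℂ) :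
    FT (FourierTransformInv.fourierInv a : SchwartzMap (En n) ℂ) = a := by
  rw [FT_eq, ← SchwartzMap.fourier_coe, FourierTransform.fourier_fourierInv_eq]

lemma brKernel_FT {n : ℕ} (δ : ℝ) : brKernel n δ = FT (fun ξ => ((brm n δ ξ : ℝ) : ℂ)) := by
  funext x
  rw [brKernel_eq]
  unfold FT ech
  refine integral_congr_ae (Filter.Eventually.of_forall (fun ξ => ?_))
  simp only [inner_neg_left, real_inner_comm]
  congr 2
  push_cast; ring

lemma brKernel_cont {n : ℕ} {δ : ℝ} (hδ : 0 < δ) : Continuous (brKernel n δ) := by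
  have hi : Integrable (fun ξ : En n => ((brm n δ ξ : ℝ) : ℂ)) :=
    ((brm_cont hδ).integrable_of_hasCompactSupport (brm_supp hδ)).ofReal
  have : brKernel n δ = fun x => Tm (fun ξ => ((brm n δ ξ : ℝ) : ℂ)) (-x) := by
    funext x
    rw [brKernel_FT]
    unfold FT Tm ech
    simp [inner_neg_left, real_inner_comm]
  rw [this]
  exact (Tm_cont hi).comp continuous_neg

lemma brKernel_int {n : ℕ} (hn : 1 ≤ n) {δ : ℝ} (hδ : ((n : ℝ) - 1) / 2 < δ) :
    Integrable (brKernel n δ) := by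
  have hn' : (1 : ℝ) ≤ n := by exact_mod_cast hn
  have hδ0 : 0 < δ := by linarith
  obtain ⟨C, hC, H⟩ := brKernel_decay hn hδ
  have h1 : Integrable (fun x : En n => C * (1 + ‖x‖) ^ (-(((n : ℝ) + 1) / 2 + δ))) := by
    refine (integrable_one_add_norm ?_).const_mul C
    rw [finrank_euclideanSpace_fin]; linarith
  exact h1.mono' (brKernel_cont hδ0).aestronglyMeasurable (Filter.Eventually.of_forall H)

lemma FT_brKernel {n : ℕ} (hn : 1 ≤ n) {δ : ℝ} (hδ : ((n : ℝ) - 1) / 2 < δ) (ξ : En n) :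
    FT (brKernel n δ) ξ = ((brm n δ ξ : ℝ) : ℂ) := by
  have hn' : (1 : ℝ) ≤ n := by exact_mod_cast hn
  have hδ0 : 0 < δ := by linarith
  have hi : Integrable (fun ξ : En n => ((brm n δ ξ : ℝ) : ℂ)) :=
    ((brm_cont hδ0).integrable_of_hasCompactSupport (brm_supp hδ0)).ofReal
  have hc : Continuous (fun ξ : En n => ((brm n δ ξ : ℝ) : ℂ)) :=
    Complex.continuous_ofReal.comp (brm_cont hδ0)
  have h1 := brKernel_int hn hδ
  have h2 : brKernel n δ = FourierTransform.fourier (fun ξ => ((brm n δ ξ : ℝ) : ℂ)) := by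
    rw [brKernel_FT, FT_eq]
  have h3 := hc.fourierInv_fourier_eq hi (h2 ▸ h1)
  rw [← h2, ← Tm_eq] at h3
  have h4 : FT (brKernel n δ) ξ = Tm (brKernel n δ) (-ξ) := by
    unfold FT Tm ech
    simp [inner_neg_left, real_inner_comm]
  rw [h4, h3]
  simp [brm]

/-- Substitution. -/
lemma conv_subst {n : ℕ} (k F : En n → ℂ) {t : ℝ} (ht : 0 < t) (x : En n) :
    ∫ y, F y * ((t ^ n)⁻¹ • k (t⁻¹ • (x - y))) = ∫ w, k w * F (x - t • w) := by
  have h1 := integral_sub_left_eq_self (fun y => F y * ((t ^ n)⁻¹ • k (t⁻¹ • (x - y)))) volume x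
  rw [← h1]
  have h2 := Measure.integral_comp_smul (volume : Measure (En n))
    (fun z => F (x - z) * ((t ^ n)⁻¹ • k (t⁻¹ • (x - (x - z))))) t
  rw [finrank_euclideanSpace_fin, abs_of_pos (by positivity)] at h2
  have h3 : ∀ w : En n, F (x - t • w) * ((t ^ n)⁻¹ • k (t⁻¹ • (x - (x - t • w))))
      = (t ^ n)⁻¹ • (k w * F (x - t • w)) := by
    intro w
    rw [sub_sub_cancel, smul_smul, inv_mul_cancel₀ ht.ne', one_smul, mul_smul_comm, mul_comm]
  simp_rw [h3] at h2
  rw [integral_smul] at h2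
  have h4 : (t ^ n)⁻¹ ≠ 0 := by positivity
  exact (smul_right_injective ℂ h4 h2).symm

/-- The averages `a(tD) f`, where `h` is the Fourier transform of `f`. -/
def um {n : ℕ} (a h : En n → ℂ) (t : ℝ) (y : En n) : ℂ := Tm (fun ξ => a (t • ξ) * h ξ) y

lemma um_int {n : ℕ} (a : SchwartzMap (En n) ℂ) {h : En n → ℂ} (hh : Integrable h) (t : ℝ) :
    Integrable (fun ξ => a (t • ξ) * h ξ) := by
  obtain ⟨C, hC, H⟩ := a.decay 0 0
  refine hh.bdd_mul (c := C) ?_ ?_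
  · exact (a.continuous.comp (by fun_prop)).aestronglyMeasurable
  · exact Filter.Eventually.of_forall (fun ξ => by simpa using H (t • ξ))

lemma um_bdd {n : ℕ} (a : SchwartzMap (En n) ℂ) {h : En n → ℂ} (hh : Integrable h) :
    ∃ B : ℝ, 0 ≤ B ∧ ∀ t y, ‖um a h t y‖ ≤ B := by
  obtain ⟨C, hC, H⟩ := a.decay 0 0
  refine ⟨∫ ξ, C * ‖h ξ‖, integral_nonneg (fun ξ => by positivity), fun t y => ?_⟩
  unfold um
  refine (Tm_norm_le _ _).trans ?_
  refine integral_mono (um_int a hh t).norm (hh.norm.const_mul C) (fun ξ => ?_)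
  simp only [norm_mul]
  have := H (t • ξ)
  simp only [pow_zero, one_mul, norm_iteratedFDeriv_zero] at this
  exact mul_le_mul_of_nonneg_right this (norm_nonneg _)

lemma radMax_integrand {n : ℕ} (Φ f : SchwartzMap (En n) ℂ) {t : ℝ} (ht : 0 < t) (x : En n) :
    ∫ y, (t ^ n)⁻¹ • Φ (t⁻¹ • (x - y)) * f y =
      um (FourierTransform.fourier Φ : SchwartzMap (En n) ℂ)
        (FourierTransform.fourier f : SchwartzMap (En n) ℂ) t x := by
  have h1 := conv_subst Φ f ht x
  simp_rw [mul_comm (f _)] at h1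
  rw [h1]
  nth_rw 1 [← Tm_schwartz f]
  rw [Tm_conv Φ.integrable (SchwartzMap.integrable _)]
  unfold um
  rw [FT_eq, ← SchwartzMap.fourier_coe]

lemma brMeans_eq {n : ℕ} (hn : 1 ≤ n) {δ : ℝ} (hδ : ((n : ℝ) - 1) / 2 < δ)
    (f η : SchwartzMap (En n) ℂ) (hη : ∀ ξ, ‖ξ‖ ≤ 1 → η ξ = 1) {ε : ℝ} (hε : 0 < ε) (x : En n) :
    brMeans n δ ε f x = ∫ y, um η (FourierTransform.fourier f : SchwartzMap (En n) ℂ) ε y *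
      brKernelDil n δ ε (x - y) := by
  have hn' : (1 : ℝ) ≤ n := by exact_mod_cast hn
  have hδ0 : 0 < δ := by linarith
  unfold brMeans brKernelDil
  rw [conv_subst _ _ hε, conv_subst _ _ hε]
  nth_rw 1 [← Tm_schwartz f]
  unfold um
  rw [Tm_conv (brKernel_int hn hδ) (SchwartzMap.integrable _),
    Tm_conv (brKernel_int hn hδ) (um_int η (SchwartzMap.integrable _) ε)]
  congr 1
  funext ξ
  rw [FT_brKernel hn hδ]
  rcases le_or_gt ‖ε • ξ‖ 1 with h | h
  · rw [hη _ h, one_mul]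
  · rw [brm_zero hδ0 h.le]; simp

end BR

namespace BR

/-! ### Peetre maximal estimates -/

lemma sch_decay {n : ℕ} (k : SchwartzMap (En n) ℂ) (m : ℕ) :
    ∃ C : ℝ, 0 < C ∧ ∀ w, ‖k w‖ ≤ C * ((1 + ‖w‖) ^ m)⁻¹ := by
  refine ⟨2 ^ m * ((Finset.Iic (m, 0)).sup fun m => SchwartzMap.seminorm ℝ m.1 m.2) k + 1, ?_, ?_⟩
  · have : 0 ≤ ((Finset.Iic (m, 0)).sup fun m => SchwartzMap.seminorm ℝ m.1 m.2) k :=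
      apply_nonneg _ _
    positivity
  · intro w
    have h := SchwartzMap.one_add_le_sup_seminorm_apply (𝕜 := ℝ) (m := (m, 0)) (k := m) (n := 0)
      le_rfl le_rfl k w
    rw [norm_iteratedFDeriv_zero] at h
    have hp : 0 < (1 + ‖w‖) ^ m := by positivity
    rw [← div_eq_mul_inv, le_div_iff₀ hp]
    simp only at h
    linarith

lemma sch_wint {n : ℕ} (k : SchwartzMap (En n) ℂ) (l : ℕ) :
    Integrable (fun w => ‖k w‖ * (1 + ‖w‖) ^ l) := by
  obtain ⟨C, hC, H⟩ := sch_decay k (l + (n + 1))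
  have h1 : Integrable (fun x : En n => C * (1 + ‖x‖) ^ (-((n : ℝ) + 1))) := by
    refine (integrable_one_add_norm ?_).const_mul C
    rw [finrank_euclideanSpace_fin]; linarith
  refine h1.mono' ?_ (Filter.Eventually.of_forall (fun w => ?_))
  · exact (k.continuous.norm.mul (by fun_prop)).aestronglyMeasurable
  · have hp : 0 < 1 + ‖w‖ := by positivity
    rw [Real.norm_eq_abs, abs_of_nonneg (by positivity)]
    calc _ ≤ C * ((1 + ‖w‖) ^ (l + (n + 1)))⁻¹ * (1 + ‖w‖) ^ l :=
          mul_le_mul_of_nonneg_right (H w) (by positivity)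
      _ = C * ((1 + ‖w‖) ^ (n + 1))⁻¹ := by
          rw [pow_add]; field_simp
      _ = _ := by
          rw [Real.rpow_neg hp.le, ← Real.rpow_natCast]; push_cast; rfl

/-- Weighted kernel mass. -/
def wI {n : ℕ} (k : SchwartzMap (En n) ℂ) (l : ℕ) : ℝ := ∫ w, ‖k w‖ * (1 + ‖w‖) ^ l

lemma wI_nonneg {n : ℕ} (k : SchwartzMap (En n) ℂ) (l : ℕ) : 0 ≤ wI k l :=
  integral_nonneg (fun w => by positivity)

lemma peetre_tri {n : ℕ} (x y w : En n) {t t' : ℝ} (ht : 0 < t) (ht' : 0 ≤ t') (htt : t' ≤ t) :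
    1 + ‖x - (y - t' • w)‖ / t ≤ (1 + ‖x - y‖ / t) * (1 + ‖w‖) := by
  have h1 : ‖x - (y - t' • w)‖ ≤ ‖x - y‖ + t * ‖w‖ := by
    have : x - (y - t' • w) = (x - y) + t' • w := by abel
    rw [this]
    refine (norm_add_le _ _).trans ?_
    rw [norm_smul, Real.norm_eq_abs, abs_of_nonneg ht']
    have := mul_le_mul_of_nonneg_right htt (norm_nonneg w)
    linarith
  have h2 : ‖x - (y - t' • w)‖ / t ≤ ‖x - y‖ / t + ‖w‖ := by
    rw [div_le_iff₀ ht, add_mul, div_mul_cancel₀ _ ht.ne']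
    linarith
  have h3 : 0 ≤ ‖x - y‖ / t := by positivity
  nlinarith [norm_nonneg w, mul_nonneg h3 (norm_nonneg w)]

lemma peetre_transfer {n : ℕ} (k : SchwartzMap (En n) ℂ) (l : ℕ) {F : En n → ℂ} {x : En n}
    {B t t' : ℝ} (hB : 0 ≤ B) (ht : 0 < t) (ht' : 0 ≤ t') (htt : t' ≤ t)
    (hF : ∀ y, ‖F y‖ ≤ B * (1 + ‖x - y‖ / t) ^ l) (y : En n) :
    ‖∫ w, k w * F (y - t' • w)‖ ≤ B * wI k l * (1 + ‖x - y‖ / t) ^ l := by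
  have h1 : ∀ w, ‖k w * F (y - t' • w)‖ ≤
      (B * (1 + ‖x - y‖ / t) ^ l) * (‖k w‖ * (1 + ‖w‖) ^ l) := by
    intro w
    rw [norm_mul]
    have h2 := pow_le_pow_left₀ (by positivity) (peetre_tri x y w ht ht' htt) l
    calc _ ≤ ‖k w‖ * (B * ((1 + ‖x - y‖ / t) * (1 + ‖w‖)) ^ l) := by
          refine mul_le_mul_of_nonneg_left ((hF _).trans ?_) (norm_nonneg _)
          exact mul_le_mul_of_nonneg_left h2 hB
      _ = _ := by rw [mul_pow]; ring
  refine (norm_integral_le_of_norm_le ((sch_wint k l).const_mul _)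
    (Filter.Eventually.of_forall h1)).trans (le_of_eq ?_)
  rw [integral_const_mul]
  unfold wI
  ring

/-- The kernel of a Schwartz multiplier. -/
def kr {n : ℕ} (a : SchwartzMap (En n) ℂ) : SchwartzMap (En n) ℂ := FourierTransformInv.fourierInv a

lemma Tm_mul {n : ℕ} (a : SchwartzMap (En n) ℂ) {g : En n → ℂ} (hg : Integrable g) (s : ℝ)
    (y : En n) : Tm (fun ξ => a (s • ξ) * g ξ) y = ∫ w, kr a w * Tm g (y - s • w) := by
  rw [Tm_conv (SchwartzMap.integrable _) hg]
  unfold kr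
  rw [FT_schwartz]

lemma exists_G {n : ℕ} (η : SchwartzMap (En n) ℂ) (hη1 : ∀ ξ, ‖ξ‖ ≤ 1 → η ξ = 1)
    (hη2 : ∀ ξ, 2 ≤ ‖ξ‖ → η ξ = 0) (l : ℕ) (hl : 1 ≤ l) :
    ∃ G : SchwartzMap (En n) ℂ, ∀ ζ, η ((2 : ℝ)⁻¹ • ζ) - η ζ
      = ((((‖ζ‖ ^ 2) ^ l : ℝ)) : ℂ) * (G ζ * η ((4 : ℝ)⁻¹ • ζ)) := by
  have hnrm : ∀ (c : ℝ) (ζ : En n), 0 ≤ c → ‖c • ζ‖ = c * ‖ζ‖ := by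
    intro c ζ hc; rw [norm_smul, Real.norm_eq_abs, abs_of_nonneg hc]
  have hD0 : ∀ ζ : En n, ‖ζ‖ ≤ 1 → η ((2 : ℝ)⁻¹ • ζ) - η ζ = 0 := by
    intro ζ h
    rw [hη1 _ h, hη1, sub_self]
    rw [hnrm _ _ (by norm_num)]; linarith
  have hD4 : ∀ ζ : En n, 4 ≤ ‖ζ‖ → η ((2 : ℝ)⁻¹ • ζ) - η ζ = 0 := by
    intro ζ h
    rw [hη2 ζ (by linarith), hη2, sub_self]
    rw [hnrm _ _ (by norm_num)]; linarith
  set g : En n → ℂ := fun ζ => (((‖ζ‖ ^ 2) ^ l)⁻¹ : ℝ) • (η ((2 : ℝ)⁻¹ • ζ) - η ζ) with hg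
  have hsupp : HasCompactSupport g := by
    refine HasCompactSupport.intro (isCompact_closedBall (0 : En n) 4) (fun z hz => ?_)
    rw [mem_closedBall_zero_iff, not_le] at hz
    simp only [hg]
    rw [hD4 z hz.le, smul_zero]
  have hsm : ContDiff ℝ (⊤ : ℕ∞) g := by
    rw [contDiff_iff_contDiffAt]
    intro ζ
    rcases lt_or_ge ‖ζ‖ 1 with h | h
    · have : g =ᶠ[nhds ζ] fun _ => 0 := by
        have ho : IsOpen {z : En n | ‖z‖ < 1} := isOpen_lt continuous_norm continuous_const
        filter_upwards [ho.mem_nhds h] with z hz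
        simp only [hg]
        rw [hD0 z (le_of_lt hz), smul_zero]
      exact contDiffAt_const.congr_of_eventuallyEq this
    · have hz : ((‖ζ‖ ^ 2) ^ l) ≠ 0 := by positivity
      have a1 : ContDiffAt ℝ (⊤ : ℕ∞) (fun ζ : En n => ((‖ζ‖ ^ 2) ^ l)⁻¹) ζ := by
        refine ContDiffAt.inv ?_ hz
        exact ((contDiff_norm_sq ℝ).pow l).contDiffAt
      have a2 : ContDiffAt ℝ (⊤ : ℕ∞) (fun ζ : En n => η ((2 : ℝ)⁻¹ • ζ) - η ζ) ζ := by
        refine ContDiffAt.sub ?_ (η.smooth _).contDiffAt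
        exact ((η.smooth _).comp (contDiff_const_smul _)).contDiffAt
      exact a1.smul a2
  refine ⟨hsupp.toSchwartzMap hsm, fun ζ => ?_⟩
  have hv : hsupp.toSchwartzMap hsm ζ = g ζ := rfl
  rw [hv]
  rcases le_or_gt ‖ζ‖ 1 with h | h
  · simp only [hg]
    rw [hD0 ζ h]; simp
  · rcases le_or_gt 4 ‖ζ‖ with h4 | h4
    · simp only [hg]
      rw [hD4 ζ h4]; simp
    · have e : η ((4 : ℝ)⁻¹ • ζ) = 1 := by
        refine hη1 _ ?_
        rw [hnrm _ _ (by norm_num)]; linarith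
      have hz : (((‖ζ‖ ^ 2) ^ l : ℝ) : ℂ) ≠ 0 := by
        have : ((‖ζ‖ ^ 2) ^ l : ℝ) ≠ 0 := by positivity
        exact_mod_cast this
      rw [e, mul_one]
      simp only [hg, Complex.real_smul]
      rw [Complex.ofReal_inv, mul_inv_cancel_left₀ hz]

lemma peetre_B2 {n : ℕ} (Ψ η : SchwartzMap (En n) ℂ) (hη1 : ∀ ξ, ‖ξ‖ ≤ 1 → η ξ = 1)
    (hη2 : ∀ ξ, 2 ≤ ‖ξ‖ → η ξ = 0) (l : ℕ) (hl : 1 ≤ l) :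
    ∃ C : ℝ, 0 < C ∧ ∀ (h : En n → ℂ) (x : En n) (A : ℝ), Integrable h → 0 ≤ A →
      (∀ t y, 0 < t → ‖um η h t y‖ ≤ A * (1 + ‖x - y‖ / t) ^ l) →
      ∀ t y, 0 < t → ‖um Ψ h t y‖ ≤ C * A * (1 + ‖x - y‖ / t) ^ l := by
  obtain ⟨G, hG⟩ := exists_G η hη1 hη2 l hl
  have htg : Function.HasTemperateGrowth (fun ξ : En n => ((‖ξ‖ ^ 2) ^ l : ℝ)) := by fun_prop
  set P : SchwartzMap (En n) ℂ := SchwartzMap.smulLeftCLM ℂ (fun ξ : En n => ((‖ξ‖ ^ 2) ^ l : ℝ)) Ψ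
    with hP
  have hPv : ∀ ξ, P ξ = ((((‖ξ‖ ^ 2) ^ l : ℝ)) : ℂ) * Ψ ξ := by
    intro ξ
    rw [hP, SchwartzMap.smulLeftCLM_apply_apply htg, Complex.real_smul]
  set c0 := wI (kr Ψ) l with hc0
  set c1 := 4 ^ l * wI (kr G) l * wI (kr P) l with hc1
  have hc0n : 0 ≤ c0 := wI_nonneg _ _
  have hc1n : 0 ≤ c1 := by
    have := wI_nonneg (kr G) l
    have := wI_nonneg (kr P) l
    positivity
  refine ⟨c0 + 2 * c1 + 1, by positivity, ?_⟩
  intro h x A hh hA hU t y ht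
  set X := (1 + ‖x - y‖ / t) ^ l with hX
  have hX0 : 0 ≤ X := by positivity
  set a : ℕ → ℂ := fun K => Tm (fun ξ => Ψ (t • ξ) * (η ((((2 : ℝ) ^ K)⁻¹ * t) • ξ) * h ξ)) y with ha
  have hstep : ∀ K, ‖a (K + 1) - a K‖ ≤ c1 * A * X * (2⁻¹ : ℝ) ^ K := by
    intro K
    set r : ℝ := ((2 : ℝ) ^ K)⁻¹ with hr
    have hr0 : 0 < r := by positivity
    have hr1 : r ≤ 1 := inv_le_one_of_one_le₀ (one_le_pow₀ (by norm_num))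
    have e1 : a (K + 1) - a K = Tm (fun ξ => P (t • ξ) * (G ((r * t) • ξ) *
        (η ((4⁻¹ * (r * t)) • ξ) * (((((r ^ 2) ^ l : ℝ)) : ℂ) * h ξ)))) y := by
      simp only [ha]
      unfold Tm
      rw [← integral_sub]
      · refine integral_congr_ae (Filter.Eventually.of_forall (fun ξ => ?_))
        simp only
        have e2 : ((2 : ℝ) ^ (K + 1))⁻¹ * t = 2⁻¹ * (r * t) := by
          rw [hr, pow_succ, mul_inv]; ring
        have e3 := hG ((r * t) • ξ)
        rw [smul_smul, smul_smul] at e3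
        have e4 : ‖(r * t) • ξ‖ = r * ‖t • ξ‖ := by
          rw [mul_smul, norm_smul, Real.norm_eq_abs, abs_of_pos hr0]
        rw [e4, mul_pow, mul_pow] at e3
        rw [e2, hPv]
        push_cast at e3 ⊢
        linear_combination (Ψ (t • ξ) * h ξ * ech y ξ) * e3
      · exact int_ech (um_int Ψ (um_int η hh _) _) _
      · exact int_ech (um_int Ψ (um_int η hh _) _) _
    have hhc : Integrable (fun ξ => ((((r ^ 2) ^ l : ℝ)) : ℂ) * h ξ) := hh.const_mul _
    have hF1 : ∀ z, ‖Tm (fun ξ => η ((4⁻¹ * (r * t)) • ξ) * (((((r ^ 2) ^ l : ℝ)) : ℂ) * h ξ)) z‖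
        ≤ (A * 4 ^ l * r ^ l) * (1 + ‖x - z‖ / t) ^ l := by
      intro z
      have e5 : Tm (fun ξ => η ((4⁻¹ * (r * t)) • ξ) * (((((r ^ 2) ^ l : ℝ)) : ℂ) * h ξ)) z
          = ((((r ^ 2) ^ l : ℝ)) : ℂ) * um η h (4⁻¹ * (r * t)) z := by
        unfold um Tm
        rw [← integral_const_mul]
        refine integral_congr_ae (Filter.Eventually.of_forall (fun ξ => ?_))
        simp only; ring
      rw [e5, norm_mul, Complex.norm_real, Real.norm_eq_abs, abs_of_nonneg (by positivity)]
      have h6 := hU (4⁻¹ * (r * t)) z (by positivity)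
      have h7 : 1 + ‖x - z‖ / (4⁻¹ * (r * t)) ≤ 4 * r⁻¹ * (1 + ‖x - z‖ / t) := by
        have : ‖x - z‖ / (4⁻¹ * (r * t)) = 4 * r⁻¹ * (‖x - z‖ / t) := by field_simp
        rw [this, mul_add, mul_one]
        have : 1 ≤ r⁻¹ := (one_le_inv₀ hr0).2 hr1
        linarith
      have h8 := pow_le_pow_left₀ (by positivity) h7 l
      calc _ ≤ (r ^ 2) ^ l * (A * (4 * r⁻¹ * (1 + ‖x - z‖ / t)) ^ l) := by
            refine mul_le_mul_of_nonneg_left (h6.trans ?_) (by positivity)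
            exact mul_le_mul_of_nonneg_left h8 hA
        _ = _ := by
            have : r ^ l * (r⁻¹) ^ l = 1 := by
              rw [← mul_pow, mul_inv_cancel₀ hr0.ne', one_pow]
            rw [mul_pow, mul_pow, sq, mul_pow]
            linear_combination (r ^ l * A * 4 ^ l * (1 + ‖x - z‖ / t) ^ l) * this
    have hF2 : ∀ z, ‖Tm (fun ξ => G ((r * t) • ξ) *
        (η ((4⁻¹ * (r * t)) • ξ) * (((((r ^ 2) ^ l : ℝ)) : ℂ) * h ξ))) z‖
        ≤ (A * 4 ^ l * r ^ l * wI (kr G) l) * (1 + ‖x - z‖ / t) ^ l := by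
      intro z
      rw [Tm_mul G (um_int η hhc _)]
      exact peetre_transfer (kr G) l (by positivity) ht (by positivity) (by nlinarith) hF1 z
    rw [e1, Tm_mul P (um_int G (um_int η hhc _) _)]
    have h9 := peetre_transfer (kr P) l (by have := wI_nonneg (kr G) l; positivity) ht ht.le le_rfl
      hF2 y
    refine h9.trans ?_
    have h10 : r ^ l ≤ (2⁻¹ : ℝ) ^ K := by
      have : r = (2⁻¹ : ℝ) ^ K := by rw [hr, inv_pow]
      rw [← this]
      exact pow_le_of_le_one hr0.le hr1 (by omega)
    have h11 : 0 ≤ A * 4 ^ l * wI (kr G) l * wI (kr P) l * X := by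
      have := wI_nonneg (kr G) l
      have := wI_nonneg (kr P) l
      positivity
    calc _ = (A * 4 ^ l * wI (kr G) l * wI (kr P) l * X) * r ^ l := by rw [hX]; ring
      _ ≤ (A * 4 ^ l * wI (kr G) l * wI (kr P) l * X) * (2⁻¹ : ℝ) ^ K :=
          mul_le_mul_of_nonneg_left h10 h11
      _ = _ := by rw [hc1]; ring
  have h0 : ‖a 0‖ ≤ c0 * A * X := by
    simp only [ha, pow_zero, inv_one, one_mul]
    rw [Tm_mul Ψ (um_int η hh _)]
    have := peetre_transfer (kr Ψ) l hA ht ht.le le_rfl (fun z => hU t z ht) y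
    refine this.trans (le_of_eq ?_)
    rw [hc0, hX]; ring
  have hK : ∀ K, ‖a K‖ ≤ c0 * A * X + c1 * A * X * (2 - 2 * (2⁻¹ : ℝ) ^ K) := by
    intro K
    induction K with
    | zero => simpa using h0
    | succ K ih =>
      have e : a (K + 1) = a K + (a (K + 1) - a K) := by ring
      rw [e]
      refine (norm_add_le _ _).trans ((add_le_add ih (hstep K)).trans (le_of_eq ?_))
      rw [pow_succ]; ring
  have hK' : ∀ K, ‖a K‖ ≤ (c0 + 2 * c1 + 1) * A * X := by
    intro K
    refine (hK K).trans ?_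
    have h1 : 0 ≤ A * X := by positivity
    have h2 : 0 ≤ c1 * (A * X) * (2⁻¹ : ℝ) ^ K := by positivity
    nlinarith
  have hlim : Filter.Tendsto a Filter.atTop (nhds (um Ψ h t y)) := by
    simp only [ha, um]
    unfold Tm
    obtain ⟨Cη, hCη, Hη⟩ := η.decay 0 0
    refine tendsto_integral_of_dominated_convergence (fun ξ => Cη * ‖Ψ (t • ξ) * h ξ‖)
      (fun K => (int_ech (um_int Ψ (um_int η hh _) _) _).1) ((um_int Ψ hh t).norm.const_mul _) ?_ ?_
    · intro K
      refine Filter.Eventually.of_forall (fun ξ => ?_)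
      have := Hη ((((2 : ℝ) ^ K)⁻¹ * t) • ξ)
      simp only [pow_zero, one_mul, norm_iteratedFDeriv_zero] at this
      rw [norm_mul, ech_norm, norm_mul, norm_mul, norm_mul]
      have h2 : 0 ≤ ‖Ψ (t • ξ)‖ * ‖h ξ‖ := by positivity
      nlinarith [mul_le_mul_of_nonneg_right this h2]
    · refine Filter.Eventually.of_forall (fun ξ => ?_)
      have hev : ∀ᶠ K : ℕ in Filter.atTop, ‖((((2 : ℝ) ^ K)⁻¹ * t) • ξ)‖ ≤ 1 := by
        have h1 : Filter.Tendsto (fun K : ℕ => (2 : ℝ) ^ K) Filter.atTop Filter.atTop :=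
          tendsto_pow_atTop_atTop_of_one_lt (by norm_num)
        filter_upwards [h1.eventually_ge_atTop ‖t • ξ‖] with K hK
        rw [mul_smul, norm_smul, Real.norm_eq_abs, abs_of_pos (by positivity)]
        exact inv_mul_le_one_of_le₀ hK (by positivity)
      refine tendsto_const_nhds.congr' ?_
      filter_upwards [hev] with K hK
      rw [hη1 _ hK, one_mul]
  exact le_of_tendsto hlim.norm (Filter.Eventually.of_forall hK')

end BR

namespace BR

lemma exists_theta {n : ℕ} (Ψ η : SchwartzMap (En n) ℂ)
    (hη2 : ∀ ξ, 2 ≤ ‖ξ‖ → η ξ = 0) (hΨ : Ψ 0 ≠ 0) :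
    ∃ (c : ℝ) (θ : SchwartzMap (En n) ℂ), 0 < c ∧ c ≤ 1 ∧ ∀ ζ, η ζ = θ ζ * Ψ (c • ζ) := by
  have ho : IsOpen {z : En n | Ψ z ≠ 0} := isOpen_ne_fun Ψ.continuous continuous_const
  obtain ⟨ρ, hρ, hball⟩ := Metric.isOpen_iff.1 ho 0 hΨ
  set c : ℝ := min 1 (ρ / 4) with hc
  have hc0 : 0 < c := by rw [hc]; positivity
  have hcρ : c ≤ ρ / 4 := min_le_right _ _
  have hne : ∀ ζ : En n, ‖ζ‖ < 4 → Ψ (c • ζ) ≠ 0 := by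
    intro ζ hζ
    refine hball ?_
    rw [mem_ball_zero_iff, norm_smul, Real.norm_eq_abs, abs_of_pos hc0]
    nlinarith [norm_nonneg ζ]
  set g : En n → ℂ := fun ζ => η ζ * (Ψ (c • ζ))⁻¹ with hg
  have hsupp : HasCompactSupport g := by
    refine HasCompactSupport.intro (isCompact_closedBall (0 : En n) 2) (fun z hz => ?_)
    rw [mem_closedBall_zero_iff, not_le] at hz
    simp only [hg]
    rw [hη2 z hz.le, zero_mul]
  have hsm : ContDiff ℝ (⊤ : ℕ∞) g := by
    rw [contDiff_iff_contDiffAt]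
    intro ζ
    rcases lt_or_ge 2 ‖ζ‖ with h | h
    · have : g =ᶠ[nhds ζ] fun _ => 0 := by
        have ho : IsOpen {z : En n | 2 < ‖z‖} := isOpen_lt continuous_const continuous_norm
        filter_upwards [ho.mem_nhds h] with z hz
        simp only [hg]
        rw [hη2 z (le_of_lt hz), zero_mul]
      exact contDiffAt_const.congr_of_eventuallyEq this
    · have a1 : ContDiffAt ℝ (⊤ : ℕ∞) (fun ζ : En n => Ψ (c • ζ)) ζ :=
        ((Ψ.smooth _).comp (contDiff_const_smul _)).contDiffAt
      exact ContDiffAt.mul (η.smooth _).contDiffAt (a1.inv (hne ζ (by linarith)))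
  refine ⟨c, hsupp.toSchwartzMap hsm, hc0, min_le_left _ _, fun ζ => ?_⟩
  have hv : hsupp.toSchwartzMap hsm ζ = g ζ := rfl
  rw [hv]
  simp only [hg]
  rcases le_or_gt 2 ‖ζ‖ with h | h
  · rw [hη2 ζ h]; simp
  · rw [inv_mul_cancel_right₀ (hne ζ (by linarith))]

lemma lint_subst {n : ℕ} {H : En n → ℝ≥0∞} (hH : Measurable H) {t : ℝ} (ht : 0 < t) (y : En n) :
    ∫⁻ w, H (y - t • w) = ENNReal.ofReal ((t ^ n)⁻¹) * ∫⁻ z, H z := by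
  have h1 : ∫⁻ w, H (y - t • w) = ∫⁻ z, H (y - z) ∂(Measure.map (fun x : En n => t • x) volume) := by
    have hm : Measurable (fun z => H (y - z)) := hH.comp (by fun_prop)
    rw [lintegral_map hm (by fun_prop)]
  rw [h1, Measure.map_addHaar_smul _ ht.ne', lintegral_smul_measure, finrank_euclideanSpace_fin,
    abs_of_pos (by positivity), lintegral_sub_left_eq_self, smul_eq_mul]

lemma max_conv {n : ℕ} : ∃ C : ℝ≥0∞, C < ⊤ ∧ ∀ (G : En n → ℝ≥0∞) (x y : En n) (t : ℝ),
    Measurable G → 0 < t →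
    ∫⁻ w, ENNReal.ofReal (((1 + ‖w‖) ^ (n + 1))⁻¹) * G (y - t • w)
      ≤ C * (ENNReal.ofReal ((1 + ‖x - y‖ / t) ^ n) * Mx volume G x) := by
  set v : ℝ≥0∞ := volume (Metric.ball (0 : En n) 1) with hv
  have hvt : v < ⊤ := measure_ball_lt_top
  refine ⟨∑' j : ℕ, ENNReal.ofReal (2 ^ (n + 1)) * (2⁻¹ : ℝ≥0∞) ^ j * v, ?_, ?_⟩
  · rw [ENNReal.tsum_mul_right, ENNReal.tsum_mul_left, ENNReal.tsum_geometric]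
    refine ENNReal.mul_lt_top (ENNReal.mul_lt_top ENNReal.ofReal_lt_top ?_) hvt
    rw [ENNReal.one_sub_inv_two, inv_inv]; exact ENNReal.ofNat_lt_top
  intro G x y t hG ht
  set X : ℝ := 1 + ‖x - y‖ / t with hX
  have hX1 : 1 ≤ X := by rw [hX]; have : 0 ≤ ‖x - y‖ / t := by positivity
                         linarith
  set co : ℕ → ℝ := fun j => 2 ^ (n + 1) * ((2 ^ j) ^ (n + 1))⁻¹ with hco
  have hpt : ∀ w : En n, ENNReal.ofReal (((1 + ‖w‖) ^ (n + 1))⁻¹) * G (y - t • w)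
      ≤ ∑' j : ℕ, ENNReal.ofReal (co j) *
        (Metric.ball y (2 ^ j * t)).indicator G (y - t • w) := by
    intro w
    have hex : ∃ j : ℕ, ‖w‖ < 2 ^ j := pow_unbounded_of_one_lt _ (by norm_num)
    classical
    set j := Nat.find hex with hj
    have hj1 : ‖w‖ < 2 ^ j := Nat.find_spec hex
    refine le_trans ?_ (ENNReal.le_tsum j)
    have hmem : y - t • w ∈ Metric.ball y (2 ^ j * t) := by
      rw [mem_ball_iff_norm, sub_sub_cancel_left, norm_neg, norm_smul, Real.norm_eq_abs,
        abs_of_pos ht]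
      nlinarith
    rw [indicator_of_mem hmem]
    refine mul_le_mul_left (ENNReal.ofReal_le_ofReal ?_) _
    simp only [hco]
    have hle : (2 : ℝ) ^ j ≤ 2 * (1 + ‖w‖) := by
      rcases Nat.eq_zero_or_pos j with h0 | h0
      · rw [h0]; have := norm_nonneg w; norm_num; linarith
      · have := Nat.find_min hex (m := j - 1) (by omega)
        rw [not_lt] at this
        have e : (2 : ℝ) ^ j = 2 * 2 ^ (j - 1) := by
          rw [← pow_succ']; congr 1; omega
        rw [e]; linarith
    have h2 := pow_le_pow_left₀ (by positivity) hle (n + 1)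
    rw [mul_pow] at h2
    rw [← div_eq_mul_inv, le_div_iff₀ (by positivity), inv_mul_le_iff₀ (by positivity)]
    linarith
  have hterm : ∀ j : ℕ, ∫⁻ w, ENNReal.ofReal (co j) *
        (Metric.ball y (2 ^ j * t)).indicator G (y - t • w)
      ≤ ENNReal.ofReal (2 ^ (n + 1)) * (2⁻¹ : ℝ≥0∞) ^ j * v *
        (ENNReal.ofReal (X ^ n) * Mx volume G x) := by
    intro j
    have hm : Measurable ((Metric.ball y (2 ^ j * t)).indicator G) := hG.indicator measurableSet_ball
    have hm2 : Measurable (fun w => (Metric.ball y (2 ^ j * t)).indicator G (y - t • w)) :=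
      hm.comp (by fun_prop)
    rw [lintegral_const_mul _ hm2, lint_subst hm ht,
      lintegral_indicator measurableSet_ball]
    set R : ℝ := 2 ^ j * t * X with hR
    have hR0 : 0 < R := by positivity
    have hxR : x ∈ Metric.ball y R := by
      rw [mem_ball_iff_norm, hR, hX, mul_assoc, mul_add, mul_one, mul_div_cancel₀ _ ht.ne']
      have : (1 : ℝ) ≤ 2 ^ j := one_le_pow₀ (by norm_num)
      nlinarith [norm_nonneg (x - y)]
    have h1 : ∫⁻ z in Metric.ball y (2 ^ j * t), G z ≤ volume (Metric.ball y R) * Mx volume G x := by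
      have hsub : Metric.ball y (2 ^ j * t) ⊆ Metric.ball y R := by
        refine Metric.ball_subset_ball ?_
        rw [hR]
        have : 0 < 2 ^ j * t := by positivity
        nlinarith
      refine (lintegral_mono_set hsub).trans ?_
      have h2 := le_Mx volume G x y R hR0 hxR
      rwa [ENNReal.inv_mul_le_iff (vol_ball_pos y hR0) (vol_ball_fin y R)] at h2
    rw [vol_ball_std y hR0, ← hv] at h1
    have e : ENNReal.ofReal (co j) * (ENNReal.ofReal ((t ^ n)⁻¹) * ENNReal.ofReal (R ^ n))
        = ENNReal.ofReal (2 ^ (n + 1)) * (2⁻¹ : ℝ≥0∞) ^ j * ENNReal.ofReal (X ^ n) := by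
      have e2 : (2⁻¹ : ℝ≥0∞) ^ j = ENNReal.ofReal ((2⁻¹ : ℝ) ^ j) := by
        rw [ENNReal.ofReal_pow (by norm_num), ENNReal.ofReal_inv_of_pos (by norm_num)]; norm_num
      rw [e2, ← ENNReal.ofReal_mul (by positivity), ← ENNReal.ofReal_mul (by positivity),
        ← ENNReal.ofReal_mul (by positivity), ← ENNReal.ofReal_mul (by positivity)]
      congr 1
      simp only [hco, hR, mul_pow]
      have ht' : t ^ n ≠ 0 := by positivity
      have h2' : ((2 : ℝ) ^ j) ^ n ≠ 0 := by positivity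
      have h2'' : ((2 : ℝ) ^ j) ≠ 0 := by positivity
      rw [pow_succ ((2 : ℝ) ^ j) n, inv_pow]
      field_simp
    calc _ ≤ ENNReal.ofReal (co j) * (ENNReal.ofReal ((t ^ n)⁻¹) *
          (ENNReal.ofReal (R ^ n) * v * Mx volume G x)) :=
          mul_le_mul_right (mul_le_mul_right h1 _) _
      _ = (ENNReal.ofReal (co j) * (ENNReal.ofReal ((t ^ n)⁻¹) * ENNReal.ofReal (R ^ n))) * v *
          Mx volume G x := by ring
      _ = _ := by rw [e]; ring
  calc _ ≤ ∫⁻ w, ∑' j : ℕ, ENNReal.ofReal (co j) *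
        (Metric.ball y (2 ^ j * t)).indicator G (y - t • w) := lintegral_mono hpt
    _ = ∑' j : ℕ, ∫⁻ w, ENNReal.ofReal (co j) *
        (Metric.ball y (2 ^ j * t)).indicator G (y - t • w) := by
        refine lintegral_tsum (fun j => ?_)
        have hm : Measurable ((Metric.ball y (2 ^ j * t)).indicator G) :=
          hG.indicator measurableSet_ball
        exact ((hm.comp (by fun_prop)).const_mul _).aemeasurable
    _ ≤ ∑' j : ℕ, ENNReal.ofReal (2 ^ (n + 1)) * (2⁻¹ : ℝ≥0∞) ^ j * v *
        (ENNReal.ofReal (X ^ n) * Mx volume G x) := ENNReal.tsum_le_tsum hterm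
    _ = _ := by rw [ENNReal.tsum_mul_right]

lemma peetre_B1 {n : ℕ} (Ψ η : SchwartzMap (En n) ℂ) (hη2 : ∀ ξ, 2 ≤ ‖ξ‖ → η ξ = 0)
    (hΨ : Ψ 0 ≠ 0) (l : ℕ) (s : ℝ) (hs0 : 0 < s) (hs1 : s < 1) (hls : (n : ℝ) ≤ l * s) :
    ∃ C : ℝ, 0 < C ∧ ∀ (h : En n → ℂ) (g0 : En n → ℝ≥0∞), Integrable h → Measurable g0 →
      (∀ t y, 0 < t → ‖um Ψ h t y‖ₑ ≤ g0 y) → ∀ (x : En n) (A : ℝ), 0 ≤ A →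
      (∀ t y, 0 < t → ‖um Ψ h t y‖ ≤ A * (1 + ‖x - y‖ / t) ^ l) →
      ∀ t y, 0 < t → ‖um η h t y‖ₑ ≤
        ENNReal.ofReal (C * A ^ (1 - s) * (1 + ‖x - y‖ / t) ^ l) * Mx volume (fun z => g0 z ^ s) x := by
  obtain ⟨c, θ, hc0, hc1, hθ⟩ := exists_theta Ψ η hη2 hΨ
  obtain ⟨C1, hC1, H1⟩ := sch_decay (kr θ) (l + (n + 1))
  obtain ⟨C2, hC2, H2⟩ := max_conv (n := n)
  have hC2' : C2 = ENNReal.ofReal C2.toReal := (ENNReal.ofReal_toReal hC2.ne).symm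
  have hnl : n ≤ l := by
    have : (n : ℝ) ≤ l := hls.trans (by nlinarith [(Nat.cast_nonneg l : (0 : ℝ) ≤ l)])
    exact_mod_cast this
  refine ⟨C1 * (c⁻¹) ^ l * (C2.toReal + 1), by positivity, ?_⟩
  intro h g0 hh hg0 hgb x A hA hV t y ht
  set X : ℝ := 1 + ‖x - y‖ / t with hX
  have hX1 : 1 ≤ X := by
    rw [hX]
    have : 0 ≤ ‖x - y‖ / t := by positivity
    linarith
  have hcinv : 1 ≤ c⁻¹ := (one_le_inv₀ hc0).2 hc1
  have e1 : um η h t y = ∫ w, kr θ w * um Ψ h (c * t) (y - t • w) := by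
    unfold um
    rw [← Tm_mul θ (um_int Ψ hh (c * t))]
    congr 1
    funext ξ
    rw [hθ (t • ξ), smul_smul, mul_assoc]
  have hpt : ∀ w, ‖kr θ w * um Ψ h (c * t) (y - t • w)‖ₑ ≤
      ENNReal.ofReal (C1 * (c⁻¹) ^ l * A ^ (1 - s) * X ^ (l - n)) *
      (ENNReal.ofReal (((1 + ‖w‖) ^ (n + 1))⁻¹) * g0 (y - t • w) ^ s) := by
    intro w
    set u := um Ψ h (c * t) (y - t • w) with hu
    set W := 1 + ‖w‖ with hW
    have hW1 : 1 ≤ W := by rw [hW]; linarith [norm_nonneg w]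
    have hu1 : ‖u‖ₑ ≤ g0 (y - t • w) := hgb _ _ (by positivity)
    have hu2 : ‖u‖ ≤ A * (c⁻¹ * X * W) ^ l := by
      refine (hV _ _ (by positivity)).trans ?_
      refine mul_le_mul_of_nonneg_left (pow_le_pow_left₀ (by positivity) ?_ l) hA
      have h3 := peetre_tri x y w ht ht.le le_rfl
      have h4 : ‖x - (y - t • w)‖ / (c * t) = c⁻¹ * (‖x - (y - t • w)‖ / t) := by field_simp
      rw [h4]
      calc _ ≤ c⁻¹ * (1 + ‖x - (y - t • w)‖ / t) := by rw [mul_add]; linarith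
        _ ≤ c⁻¹ * (X * W) := mul_le_mul_of_nonneg_left h3 (by positivity)
        _ = _ := by ring
    have hu3 : ‖u‖ ^ (1 - s) ≤ A ^ (1 - s) * ((c⁻¹) ^ l * X ^ (l - n) * W ^ l) := by
      refine (Real.rpow_le_rpow (norm_nonneg _) hu2 (by linarith)).trans ?_
      rw [Real.mul_rpow hA (by positivity)]
      refine mul_le_mul_of_nonneg_left ?_ (Real.rpow_nonneg hA _)
      have q : ∀ a : ℝ, 1 ≤ a → (a ^ l) ^ (1 - s) ≤ a ^ (l - n) := by
        intro a ha
        rw [← Real.rpow_natCast, ← Real.rpow_mul (by linarith), ← Real.rpow_natCast]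
        refine Real.rpow_le_rpow_of_exponent_le ha ?_
        rw [Nat.cast_sub hnl]
        linarith
      have q2 : ∀ a : ℝ, 1 ≤ a → (a ^ l) ^ (1 - s) ≤ a ^ l := by
        intro a ha
        exact (q a ha).trans (pow_le_pow_right₀ ha (by omega))
      rw [mul_pow, mul_pow, Real.mul_rpow (by positivity) (by positivity),
        Real.mul_rpow (by positivity) (by positivity)]
      have := q2 _ hcinv
      have := q _ hX1
      have := q2 _ hW1
      gcongr
    have hsplit : ‖u‖ₑ ≤ g0 (y - t • w) ^ s * ENNReal.ofReal (‖u‖ ^ (1 - s)) := by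
      have e2 : ‖u‖ₑ = ‖u‖ₑ ^ s * ‖u‖ₑ ^ (1 - s) := by
        rw [← ENNReal.rpow_add_of_nonneg _ _ hs0.le (by linarith)]; simp
      rw [e2]
      refine mul_le_mul' (ENNReal.rpow_le_rpow hu1 hs0.le) ?_
      rw [← ofReal_norm, ENNReal.ofReal_rpow_of_nonneg (norm_nonneg _) (by linarith)]
    rw [enorm_mul]
    have hk : ‖kr θ w‖ₑ ≤ ENNReal.ofReal (C1 * (W ^ (l + (n + 1)))⁻¹) := by
      rw [← ofReal_norm]; exact ENNReal.ofReal_le_ofReal (H1 w)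
    calc _ ≤ ENNReal.ofReal (C1 * (W ^ (l + (n + 1)))⁻¹) * (g0 (y - t • w) ^ s *
          ENNReal.ofReal (A ^ (1 - s) * ((c⁻¹) ^ l * X ^ (l - n) * W ^ l))) := by
          refine mul_le_mul' hk (hsplit.trans (mul_le_mul_right (ENNReal.ofReal_le_ofReal hu3) _))
      _ = (ENNReal.ofReal (C1 * (W ^ (l + (n + 1)))⁻¹) *
          ENNReal.ofReal (A ^ (1 - s) * ((c⁻¹) ^ l * X ^ (l - n) * W ^ l))) *
          g0 (y - t • w) ^ s := by ring
      _ = (ENNReal.ofReal (C1 * (c⁻¹) ^ l * A ^ (1 - s) * X ^ (l - n)) *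
          ENNReal.ofReal ((W ^ (n + 1))⁻¹)) * g0 (y - t • w) ^ s := by
          have hA' := Real.rpow_nonneg hA (1 - s)
          rw [← ENNReal.ofReal_mul (by positivity), ← ENNReal.ofReal_mul (by positivity)]
          congr 2
          have : W ^ l ≠ 0 := by positivity
          rw [pow_add]
          field_simp
      _ = _ := by ring
  rw [e1]
  refine (enorm_integral_le_lintegral_enorm _).trans ((lintegral_mono hpt).trans ?_)
  rw [lintegral_const_mul' _ _ ENNReal.ofReal_ne_top]
  refine (mul_le_mul_right (H2 _ x y t (hg0.pow_const s) ht) _).trans ?_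
  rw [← mul_assoc, ← mul_assoc]
  refine mul_le_mul_left ?_ _
  have hA' := Real.rpow_nonneg hA (1 - s)
  rw [hC2', ← ENNReal.ofReal_mul (by positivity), ← ENNReal.ofReal_mul (by positivity)]
  refine ENNReal.ofReal_le_ofReal ?_
  rw [ENNReal.toReal_ofReal ENNReal.toReal_nonneg]
  have e3 : X ^ l = X ^ (l - n) * X ^ n := by rw [← pow_add]; congr 1; omega
  have e4 : 0 ≤ C1 * (c⁻¹) ^ l * A ^ (1 - s) * (X ^ (l - n) * X ^ n) := by positivity
  rw [e3]
  calc _ = (C1 * (c⁻¹) ^ l * A ^ (1 - s) * (X ^ (l - n) * X ^ n)) * C2.toReal := by ring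
    _ ≤ (C1 * (c⁻¹) ^ l * A ^ (1 - s) * (X ^ (l - n) * X ^ n)) * (C2.toReal + 1) :=
        mul_le_mul_of_nonneg_left (by linarith) e4
    _ = _ := by ring

end BR

namespace BR

lemma peetre_final {n : ℕ} (Ψ η : SchwartzMap (En n) ℂ) (hη1 : ∀ ξ, ‖ξ‖ ≤ 1 → η ξ = 1)
    (hη2 : ∀ ξ, 2 ≤ ‖ξ‖ → η ξ = 0)
    (hΨ : Ψ 0 ≠ 0) (l : ℕ) (hl : 1 ≤ l) (s : ℝ) (hs0 : 0 < s) (hs1 : s < 1)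
    (hls : (n : ℝ) ≤ l * s) :
    ∃ C : ℝ, 0 < C ∧ ∀ (h : En n → ℂ) (g0 : En n → ℝ≥0∞), Integrable h → Measurable g0 →
      (∀ t y, 0 < t → ‖um Ψ h t y‖ₑ ≤ g0 y) → ∀ (x : En n) (t : ℝ) (y : En n), 0 < t →
        ‖um η h t y‖ₑ ≤ ENNReal.ofReal (C * (1 + ‖x - y‖ / t) ^ l) *
          Mx volume (fun z => g0 z ^ s) x ^ (1 / s) := by
  obtain ⟨C1, hC1, H1⟩ := peetre_B1 Ψ η hη2 hΨ l s hs0 hs1 hls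
  obtain ⟨C2, hC2, H2⟩ := peetre_B2 Ψ η hη1 hη2 l hl
  refine ⟨C1 * (C2 * C1) ^ ((1 - s) / s), by positivity, ?_⟩
  intro h g0 hh hg0 hgb x t y ht
  set M := Mx volume (fun z => g0 z ^ s) x with hM
  have hX : ∀ (t : ℝ) (y : En n), 0 < t → 1 ≤ (1 + ‖x - y‖ / t) ^ l := by
    intro t y ht
    refine one_le_pow₀ ?_
    have : 0 ≤ ‖x - y‖ / t := by positivity
    linarith
  by_cases hMt : M = ⊤
  · rw [hMt, ENNReal.top_rpow_of_pos (by positivity), ENNReal.mul_top]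
    · exact le_top
    · have := hX t y ht
      rw [Ne, ENNReal.ofReal_eq_zero, not_le]
      positivity
  set m := M.toReal with hm
  have hm0 : 0 ≤ m := ENNReal.toReal_nonneg
  have hMm : M = ENNReal.ofReal m := (ENNReal.ofReal_toReal hMt).symm
  obtain ⟨B, hB0, hB⟩ := um_bdd Ψ hh
  set S : Set ℝ := {a | ∃ (t : ℝ) (y : En n), 0 < t ∧ a = ‖um Ψ h t y‖ / (1 + ‖x - y‖ / t) ^ l} with hS
  have hbdd : BddAbove S := by
    refine ⟨B, ?_⟩
    rintro a ⟨t, y, ht, rfl⟩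
    exact (div_le_self (norm_nonneg _) (hX t y ht)).trans (hB t y)
  set V := sSup S with hV
  have hVt : ∀ t y, 0 < t → ‖um Ψ h t y‖ ≤ V * (1 + ‖x - y‖ / t) ^ l := by
    intro t y ht
    have h1 : ‖um Ψ h t y‖ / (1 + ‖x - y‖ / t) ^ l ≤ V := le_csSup hbdd ⟨t, y, ht, rfl⟩
    rwa [div_le_iff₀ (by linarith [hX t y ht])] at h1
  have hV0 : 0 ≤ V := by
    refine le_trans ?_ (le_csSup hbdd ⟨t, y, ht, rfl⟩)
    have := hX t y ht
    positivity
  have hVp := Real.rpow_nonneg hV0 (1 - s)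
  have hb1 : ∀ t y, 0 < t → ‖um η h t y‖ ≤ (C1 * V ^ (1 - s) * m) * (1 + ‖x - y‖ / t) ^ l := by
    intro t y ht
    have h1 := H1 h g0 hh hg0 hgb x V hV0 hVt t y ht
    have hXt := hX t y ht
    rw [← hM, hMm, ← ENNReal.ofReal_mul (by positivity), ← ofReal_norm,
      ENNReal.ofReal_le_ofReal_iff (by positivity)] at h1
    linarith
  have hb2 := H2 h x _ hh (by positivity) hb1
  have hVle : V ≤ C2 * (C1 * V ^ (1 - s) * m) := by
    refine csSup_le ⟨_, t, y, ht, rfl⟩ ?_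
    rintro a ⟨t, y, ht, rfl⟩
    rw [div_le_iff₀ (by linarith [hX t y ht])]
    exact hb2 t y ht
  have hVm : V ^ (1 - s) ≤ (C2 * C1 * m) ^ ((1 - s) / s) := by
    rcases hV0.eq_or_lt with h0 | h0
    · rw [← h0, Real.zero_rpow (by linarith)]
      positivity
    · have h1 : V ^ s ≤ C2 * C1 * m := by
        have hp : 0 < V ^ (1 - s) := Real.rpow_pos_of_pos h0 _
        have e : V = V ^ s * V ^ (1 - s) := by
          rw [← Real.rpow_add h0]; simp
        refine le_of_mul_le_mul_right ?_ hp
        rw [← e]; linarith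
      have h2 := Real.rpow_le_rpow (by positivity) h1 (z := (1 - s) / s)
        (div_nonneg (by linarith) hs0.le)
      rw [← Real.rpow_mul hV0, mul_div_cancel₀ _ hs0.ne'] at h2
      exact h2
  have hfin := hb1 t y ht
  have hXt := hX t y ht
  have hmm : m ^ ((1 - s) / s) * m = m ^ (1 / s) := by
    rcases hm0.eq_or_lt with h0 | h0
    · rw [← h0, mul_zero, Real.zero_rpow (by positivity)]
    · nth_rw 2 [← Real.rpow_one m]
      rw [← Real.rpow_add h0]; congr 1; field_simp; ring
  have hfin2 : ‖um η h t y‖ ≤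
      C1 * (C2 * C1) ^ ((1 - s) / s) * (1 + ‖x - y‖ / t) ^ l * m ^ (1 / s) := by
    refine hfin.trans ?_
    rw [Real.mul_rpow (by positivity) hm0] at hVm
    calc _ ≤ (C1 * ((C2 * C1) ^ ((1 - s) / s) * m ^ ((1 - s) / s)) * m) *
          (1 + ‖x - y‖ / t) ^ l := by gcongr
      _ = C1 * (C2 * C1) ^ ((1 - s) / s) * (1 + ‖x - y‖ / t) ^ l * (m ^ ((1 - s) / s) * m) := by
          ring
      _ = _ := by rw [hmm]
  rw [hMm, ENNReal.ofReal_rpow_of_nonneg hm0 (by positivity), ← ENNReal.ofReal_mul (by positivity),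
    ← ofReal_norm]
  exact ENNReal.ofReal_le_ofReal hfin2

/-- Existence of the cutoff. -/
lemma exists_eta (n : ℕ) : ∃ η : SchwartzMap (En n) ℂ, (∀ ξ, ‖ξ‖ ≤ 1 → η ξ = 1) ∧
    (∀ ξ, 2 ≤ ‖ξ‖ → η ξ = 0) := by
  let b : ContDiffBump (0 : En n) := ⟨1, 2, one_pos, one_lt_two⟩
  have hs : HasCompactSupport (fun x => ((b x : ℝ) : ℂ)) := by
    have := b.hasCompactSupport
    exact this.comp_left (g := fun r : ℝ => (r : ℂ)) Complex.ofReal_zero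
  have hd : ContDiff ℝ (⊤ : ℕ∞) (fun x => ((b x : ℝ) : ℂ)) :=
    Complex.ofRealCLM.contDiff.comp b.contDiff
  refine ⟨hs.toSchwartzMap hd, fun ξ h => ?_, fun ξ h => ?_⟩
  · change ((b ξ : ℝ) : ℂ) = 1
    rw [b.one_of_mem_closedBall (by simpa using h)]; simp
  · change ((b ξ : ℝ) : ℂ) = 0
    have : b ξ = 0 := by
      rw [← Function.notMem_support, b.support_eq]
      simpa [b] using h
    rw [this]; simp

/-- Nontangential maximal function. -/
def ntm {n : ℕ} (a h : En n → ℂ) (x : En n) : ℝ≥0∞ :=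
  ⨆ (t : ℝ) (y : En n) (_ : 0 < t) (_ : x ∈ Metric.ball y t), ‖um a h t y‖ₑ

lemma lt_ntm {n : ℕ} (a h : En n → ℂ) (x : En n) (c : ℝ≥0∞) : c < ntm a h x ↔
    ∃ t y, 0 < t ∧ x ∈ Metric.ball y t ∧ c < ‖um a h t y‖ₑ := by
  simp only [ntm, lt_iSup_iff, exists_prop]

lemma isOpen_ntm {n : ℕ} (a h : En n → ℂ) (c : ℝ≥0∞) : IsOpen {x | c < ntm a h x} := by
  have : {x | c < ntm a h x} = ⋃ (t : ℝ) (y : En n) (_ : 0 < t ∧ c < ‖um a h t y‖ₑ),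
      Metric.ball y t := by
    ext x
    simp only [mem_setOf_eq, lt_ntm, mem_iUnion, exists_prop]
    constructor
    · rintro ⟨t, y, h1, h2, h3⟩; exact ⟨t, y, ⟨h1, h3⟩, h2⟩
    · rintro ⟨t, y, ⟨h1, h3⟩, h2⟩; exact ⟨t, y, h1, h2, h3⟩
  rw [this]
  exact isOpen_iUnion fun t => isOpen_iUnion fun y => isOpen_iUnion fun _ => Metric.isOpen_ball

lemma measurable_ntm {n : ℕ} (a h : En n → ℂ) : Measurable (ntm a h) :=
  measurable_of_Ioi (fun c => (isOpen_ntm a h c).measurableSet)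

lemma radMax_measurable {n : ℕ} (Φ f : SchwartzMap (En n) ℂ) : Measurable (radMax n Φ f) := by
  have hl : LowerSemicontinuous (radMax n Φ f) := by
    unfold radMax
    refine lowerSemicontinuous_iSup (fun t => lowerSemicontinuous_iSup (fun ht => ?_))
    refine Continuous.lowerSemicontinuous ?_
    have : (fun x => ((‖∫ y, (t ^ n)⁻¹ • Φ (t⁻¹ • (x - y)) * f y‖₊ : ℝ≥0) : ℝ≥0∞)) =
        fun x => ((‖um (FourierTransform.fourier Φ : SchwartzMap (En n) ℂ)
        (FourierTransform.fourier f : SchwartzMap (En n) ℂ) t x‖₊ : ℝ≥0) : ℝ≥0∞) := by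
      funext x
      rw [radMax_integrand Φ f ht]
    rw [this]
    have hc := Tm_cont (um_int (FourierTransform.fourier Φ : SchwartzMap (En n) ℂ)
      (SchwartzMap.integrable (μ := volume) (FourierTransform.fourier f : SchwartzMap (En n) ℂ)) t)
    exact ENNReal.continuous_coe.comp hc.nnnorm
  exact hl.measurable

lemma Mx_vol_le {n : ℕ} {μ : Measure (En n)} {D : ℝ≥0∞} (hμ : Dbl μ D) {q : ℝ} (hq : 1 ≤ q)
    {K : ℝ≥0∞} (H : ∀ (c : En n) (r : ℝ), 0 < r → ∀ h : En n → ℝ≥0∞, Measurable h →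
      (∫⁻ y in Metric.ball c r, h y) ^ q * μ (Metric.ball c r) ≤
        K * volume (Metric.ball c r) ^ q * ∫⁻ y in Metric.ball c r, h y ^ q ∂μ)
    {h : En n → ℝ≥0∞} (hh : Measurable h) (x : En n) :
    Mx volume h x ^ q ≤ K * Mx μ (fun z => h z ^ q) x := by
  have hq0 : 0 < q := by linarith
  rw [← ENNReal.le_rpow_inv_iff hq0]
  unfold Mx
  refine iSup_le fun c => iSup_le fun r => iSup_le fun hr => iSup_le fun hx => ?_
  rw [ENNReal.le_rpow_inv_iff hq0]
  have h1 := H c r hr h hh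
  have hv0 := vol_ball_pos c hr
  have hvt := vol_ball_fin c r
  have h2 := le_Mx μ (fun z => h z ^ q) x c r hr hx
  have hμ0 : μ (Metric.ball c r) ≠ 0 := (hμ.pos c r hr).ne'
  have hμt : μ (Metric.ball c r) ≠ ⊤ := (hμ.fin c r hr).ne
  refine le_trans ?_ (mul_le_mul_right h2 K)
  rw [ENNReal.mul_rpow_of_nonneg _ _ hq0.le, ENNReal.inv_rpow]
  have hvq0 : volume (Metric.ball c r) ^ q ≠ 0 := by
    simp [ENNReal.rpow_eq_zero_iff, hv0, hvt]
  have hvqt : volume (Metric.ball c r) ^ q ≠ ⊤ := by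
    simp [ENNReal.rpow_eq_top_iff, hv0, hvt]
  rw [ENNReal.inv_mul_le_iff hvq0 hvqt]
  rw [← ENNReal.mul_le_mul_iff_left hμ0 hμt]
  refine h1.trans (le_of_eq ?_)
  calc _ = K * volume (Metric.ball c r) ^ q * (∫⁻ y in Metric.ball c r, h y ^ q ∂μ) *
        ((μ (Metric.ball c r))⁻¹ * μ (Metric.ball c r)) := by
        rw [ENNReal.inv_mul_cancel hμ0 hμt, mul_one]
    _ = _ := by ring

end BR

namespace BR

lemma brKernelDil_le {n : ℕ} (hn : 1 ≤ n) {δ : ℝ} (hδ : ((n : ℝ) - 1) / 2 < δ) :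
    ∃ A : ℝ≥0∞, A < ⊤ ∧ ∀ (ε : ℝ) (z : En n), 0 < ε →
      ‖brKernelDil n δ ε z‖ₑ ≤ A * kap n (((n : ℝ) + 1) / 2 + δ) ε z := by
  obtain ⟨C, hC, H⟩ := brKernel_decay hn hδ
  refine ⟨ENNReal.ofReal C, ENNReal.ofReal_lt_top, fun ε z hε => ?_⟩
  unfold kap brKernelDil
  rw [← ofReal_norm, ← ENNReal.ofReal_mul hC.le]
  refine ENNReal.ofReal_le_ofReal ?_
  have h1 := H (ε⁻¹ • z)
  have e : ‖ε⁻¹ • z‖ = ‖z‖ / ε := by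
    rw [norm_smul, norm_inv, Real.norm_of_nonneg hε.le]; field_simp
  rw [e] at h1
  rw [norm_smul, norm_inv, Real.norm_of_nonneg (by positivity)]
  calc _ ≤ (ε ^ n)⁻¹ * (C * (1 + ‖z‖ / ε) ^ (-(((n : ℝ) + 1) / 2 + δ))) := by gcongr
    _ = _ := by ring

lemma layer_le (v τ : ℝ≥0∞) (hv : v ≠ ⊤) (h0 : τ ≠ 0) (ht : τ ≠ ⊤) :
    v ≤ τ + ∑' k : ℕ, 2 ^ (k + 1) * τ * (if 2 ^ k * τ < v then 1 else 0) := by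
  have hex : ∃ m : ℕ, v ≤ 2 ^ m * τ := by
    obtain ⟨m, hm⟩ := ENNReal.exists_nat_gt (ENNReal.div_lt_top hv h0).ne
    refine ⟨m, ?_⟩
    rw [← ENNReal.div_le_iff h0 ht]
    refine hm.le.trans ?_
    have : m ≤ 2 ^ m := Nat.lt_two_pow_self.le
    exact_mod_cast this
  classical
  obtain ⟨hm1, hm2⟩ : v ≤ 2 ^ (Nat.find hex) * τ ∧ ∀ k < Nat.find hex, ¬ v ≤ 2 ^ k * τ :=
    ⟨Nat.find_spec hex, fun k hk => Nat.find_min hex hk⟩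
  rcases hm : Nat.find hex with _ | k
  · rw [hm] at hm1
    simp only [pow_zero, one_mul] at hm1
    exact hm1.trans le_self_add
  · rw [hm] at hm1 hm2
    have h3 := hm2 k (Nat.lt_succ_self k)
    push Not at h3
    refine hm1.trans (le_trans ?_ le_add_self)
    refine le_trans ?_ (ENNReal.le_tsum k)
    rw [if_pos h3, mul_one]

lemma brMax_level {n : ℕ} (hn : 1 ≤ n) {δ : ℝ} (hδ : ((n : ℝ) - 1) / 2 < δ)
    (η : SchwartzMap (En n) ℂ) (hη : ∀ ξ, ‖ξ‖ ≤ 1 → η ξ = 1) :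
    ∃ C : ℝ≥0∞, C < ⊤ ∧ C ≠ 0 ∧ ∀ (f : SchwartzMap (En n) ℂ) (x : En n) (τ : ℝ≥0∞), τ ≠ 0 → τ ≠ ⊤ →
      brMax n δ f x ≤ C * τ * (1 + ∑' k : ℕ, 2 ^ k *
        (Mset {z | 2 ^ k * τ < ntm η (FourierTransform.fourier f : SchwartzMap (En n) ℂ) z} x) ^
          ((((n : ℝ) + 1) / 2 + δ) / n)) := by
  have hN : (n : ℝ) < ((n : ℝ) + 1) / 2 + δ := by linarith
  obtain ⟨A, hA, HA⟩ := brKernelDil_le hn hδ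
  set N := ((n : ℝ) + 1) / 2 + δ with hNd
  obtain ⟨C1, hC1, H1⟩ := kap_int hn hN
  obtain ⟨C2, hC2, H2⟩ := kap_level hn hN
  refine ⟨A * C1 + A * (2 * C2) + 1, ?_, by simp, ?_⟩
  · refine ENNReal.add_lt_top.2 ⟨ENNReal.add_lt_top.2 ⟨ENNReal.mul_lt_top hA hC1,
      ENNReal.mul_lt_top hA (ENNReal.mul_lt_top (by norm_num) hC2)⟩, by norm_num⟩
  intro f x τ h0 ht
  set F : SchwartzMap (En n) ℂ := (FourierTransform.fourier f : SchwartzMap (En n) ℂ) with hF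
  set E : ℕ → Set (En n) := fun k => {z | 2 ^ k * τ < ntm η F z} with hE
  unfold brMax
  refine iSup_le fun ε => iSup_le fun hε => ?_
  have hFi : Integrable (F : En n → ℂ) := SchwartzMap.integrable (μ := volume) F
  have hc : Continuous (um η F ε) := Tm_cont (um_int η hFi ε)
  rw [brMeans_eq hn hδ f η hη hε x]
  set S : ℕ → Set (En n) := fun k => {y | 2 ^ k * τ < ‖um η F ε y‖ₑ} with hS
  have hSm : ∀ k, MeasurableSet (S k) := fun k => measurableSet_lt measurable_const hc.enorm.measurable
  have hSE : ∀ k, ∀ y ∈ S k, Metric.ball y ε ⊆ E k := by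
    intro k y hy z hz
    exact (lt_ntm _ _ _ _).2 ⟨ε, y, hε, hz, hy⟩
  have hEm : ∀ k, MeasurableSet (E k) := fun k => (isOpen_ntm _ _ _).measurableSet
  have hkm : Measurable (fun y => kap n N ε (x - y)) := kap_meas N ε x
  have step : ∀ y, ‖um η F ε y * brKernelDil n δ ε (x - y)‖ₑ ≤
      A * (τ * kap n N ε (x - y)) + ∑' k : ℕ, A * (2 ^ (k + 1) * τ *
        (S k).indicator (fun y => kap n N ε (x - y)) y) := by
    intro y
    rw [enorm_mul]
    calc _ ≤ (τ + ∑' k : ℕ, 2 ^ (k + 1) * τ * (if 2 ^ k * τ < ‖um η F ε y‖ₑ then 1 else 0)) *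
          (A * kap n N ε (x - y)) :=
          mul_le_mul' (layer_le _ τ enorm_ne_top h0 ht) (HA ε _ hε)
      _ = A * (τ * kap n N ε (x - y)) + ∑' k : ℕ, A * (2 ^ (k + 1) * τ *
        (S k).indicator (fun y => kap n N ε (x - y)) y) := by
          rw [add_mul, ← ENNReal.tsum_mul_right]
          congr 1
          · ring
          · refine tsum_congr fun k => ?_
            by_cases hy : y ∈ S k
            · rw [indicator_of_mem hy, if_pos (show 2 ^ k * τ < ‖um η F ε y‖ₑ from hy)]; ring
            · rw [indicator_of_notMem hy, if_neg (show ¬ 2 ^ k * τ < ‖um η F ε y‖ₑ from hy)]; ring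
  have hfin : ‖∫ y, um η F ε y * brKernelDil n δ ε (x - y)‖ₑ ≤
      A * (τ * C1) + ∑' k : ℕ, A * (2 ^ (k + 1) * τ * (C2 * (Mset (E k) x) ^ (N / n))) := by
    refine (enorm_integral_le_lintegral_enorm _).trans ((lintegral_mono step).trans ?_)
    rw [lintegral_add_left ((hkm.const_mul _).const_mul _)]
    refine add_le_add ?_ ?_
    · rw [lintegral_const_mul _ (hkm.const_mul _), lintegral_const_mul _ hkm]
      gcongr
      exact H1 ε x hε
    · rw [lintegral_tsum fun k => (((hkm.indicator (hSm k)).const_mul _).const_mul _).aemeasurable]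
      refine ENNReal.tsum_le_tsum fun k => ?_
      rw [lintegral_const_mul _ ((hkm.indicator (hSm k)).const_mul _),
        lintegral_const_mul _ (hkm.indicator (hSm k)), lintegral_indicator (hSm k)]
      gcongr
      exact H2 (E k) (S k) ε x hε (hEm k) (hSm k) (hSE k)
  have hsum : ∑' k : ℕ, A * (2 ^ (k + 1) * τ * (C2 * (Mset (E k) x) ^ (N / n))) =
      A * (2 * C2) * τ * ∑' k : ℕ, 2 ^ k * (Mset (E k) x) ^ (N / n) := by
    rw [← ENNReal.tsum_mul_left]
    refine tsum_congr fun k => ?_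
    rw [pow_succ]; ring
  rw [hsum] at hfin
  refine hfin.trans ?_
  set Sg := ∑' k : ℕ, (2 : ℝ≥0∞) ^ k * (Mset (E k) x) ^ (N / n)
  have : (A * C1 + A * (2 * C2) + 1) * τ * (1 + Sg) =
      A * (τ * C1) + A * (2 * C2) * τ * Sg + (A * C1 * τ * Sg + A * (2 * C2) * τ + τ * (1 + Sg)) := by
    ring
  rw [this]
  exact le_self_add

lemma dyadic_level {n : ℕ} (μ : Measure (En n)) {p : ℝ} (hp : 0 < p) {g : En n → ℝ≥0∞}
    (hg : Measurable g) (τ : ℝ≥0∞) (h0 : τ ≠ 0) (ht : τ ≠ ⊤) :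
    τ ^ p * ∑' k : ℕ, ((2 : ℝ≥0∞) ^ k) ^ p * μ {z | 2 ^ k * τ < g z} ≤
      dyC p * ∫⁻ z, g z ^ p ∂μ := by
  have h1 : ∀ k : ℕ, ((2 : ℝ≥0∞) ^ k) ^ p * μ {z | 2 ^ k * τ < g z} =
      ∫⁻ z, ({z | 2 ^ k * τ < g z}).indicator (fun _ => ((2 : ℝ≥0∞) ^ k) ^ p) z ∂μ := by
    intro k
    rw [lintegral_indicator_const (measurableSet_lt measurable_const hg)]
  simp_rw [h1]
  rw [← lintegral_tsum fun k => (measurable_const.indicator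
    (measurableSet_lt measurable_const hg)).aemeasurable]
  have hm : Measurable (fun z => ∑' k : ℕ,
      ({z | 2 ^ k * τ < g z}).indicator (fun _ => ((2 : ℝ≥0∞) ^ k) ^ p) z) :=
    Measurable.ennreal_tsum fun k => measurable_const.indicator
      (measurableSet_lt measurable_const hg)
  rw [← lintegral_const_mul _ hm, ← lintegral_const_mul _ (hg.pow_const p)]
  refine lintegral_mono fun z => ?_
  have h2 := dyadic_sum_le hp (g z / τ)
  have h3 : ∑' k : ℕ, ({z | 2 ^ k * τ < g z}).indicator (fun _ => ((2 : ℝ≥0∞) ^ k) ^ p) z ≤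
      ∑' k : ℤ, (if (2 : ℝ≥0∞) ^ k < g z / τ then ((2 : ℝ≥0∞) ^ k) ^ p else 0) := by
    refine le_trans (le_of_eq ?_) (ENNReal.tsum_comp_le_tsum_of_injective
      (Nat.cast_injective (R := ℤ)) _)
    refine tsum_congr fun k => ?_
    have : (2 : ℝ≥0∞) ^ ((k : ℕ) : ℤ) < g z / τ ↔ 2 ^ k * τ < g z := by
      rw [ENNReal.lt_div_iff_mul_lt (Or.inl h0) (Or.inl ht), zpow_natCast]
    rw [zpow_natCast] at this
    simp only [indicator, mem_setOf_eq, zpow_natCast, this]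
  calc _ ≤ τ ^ p * (dyC p * (g z / τ) ^ p) := by
        gcongr
        exact h3.trans h2
    _ = dyC p * (τ * (g z / τ)) ^ p := by rw [ENNReal.mul_rpow_of_nonneg _ _ hp.le]; ring
    _ = _ := by rw [ENNReal.mul_div_cancel h0 ht]

lemma sum_lemma {n : ℕ} (hn : 1 ≤ n) {p r q : ℝ} (hp : 0 < p) (hr : 1 < r) (hq : q = p * r)
    (hq1 : 1 ≤ q) (ω : En n → ℝ≥0∞) (hωmeas : Measurable ω)
    (hωloc : ∀ (x : En n) (r : ℝ), 0 < r → (∫⁻ y in Metric.ball x r, ω y) < ⊤)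
    (hω : IsAp n q ω) {K : ℝ≥0∞} (hK : K < ⊤) (hS : SetP (Wm ω) q K) :
    ∃ C : ℝ≥0∞, C < ⊤ ∧ ∀ E : ℕ → Set (En n), (∀ k, IsOpen (E k)) →
      Wm ω {x | 1 / 2 < ∑' k : ℕ, 2 ^ k * (Mset (E k) x) ^ r} ≤
        C * ∑' k : ℕ, ((2 : ℝ≥0∞) ^ k) ^ p * Wm ω (E k) := by
  have hD := hS.Dbl (by linarith)
  have hDt : K * ENNReal.ofReal (5 ^ n) ^ q < ⊤ := ENNReal.mul_lt_top hK
    (ENNReal.rpow_lt_top_of_nonneg (by linarith) ENNReal.ofReal_ne_top)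
  rcases hq1.eq_or_lt with h1 | h1
  · have hO : OpenP (Wm ω) q K := fun c r E hr hE hsub => hS.setp c r E hr hE.measurableSet hsub
    have hp1 : p < 1 := by nlinarith
    exact sum_lemma_A hD hDt hK hO (by linarith) (by linarith) hq hp1
  · obtain ⟨q', C, h2, h3, hC, H⟩ := improve hn h1 ω hωmeas hωloc hS.pos hω
    exact sum_lemma_B hD hDt hC (h := H) (by linarith) (by linarith) (by rw [← hq]; exact h3)

lemma ntm_Lp {n : ℕ} {p q s : ℝ} (hp : 0 < p) (hq : 1 ≤ q) (hs0 : 0 < s) (hs1 : s < 1)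
    (hps : p = 2 * q * s) (ω : En n → ℝ≥0∞) {D K : ℝ≥0∞} (hD : Dbl (Wm ω) D) (hDt : D < ⊤)
    (hK : K < ⊤)
    (H : ∀ (c : En n) (r : ℝ), 0 < r → ∀ h : En n → ℝ≥0∞, Measurable h →
      (∫⁻ y in Metric.ball c r, h y) ^ q * Wm ω (Metric.ball c r) ≤
        K * volume (Metric.ball c r) ^ q * ∫⁻ y in Metric.ball c r, h y ^ q ∂(Wm ω))
    (Φ η : SchwartzMap (En n) ℂ) (hΦ : (∫ x, Φ x) ≠ 0) (hη1 : ∀ ξ, ‖ξ‖ ≤ 1 → η ξ = 1)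
    (hη2 : ∀ ξ, 2 ≤ ‖ξ‖ → η ξ = 0) :
    ∃ C : ℝ≥0∞, C < ⊤ ∧ ∀ f : SchwartzMap (En n) ℂ,
      ∫⁻ x, ntm η (FourierTransform.fourier f : SchwartzMap (En n) ℂ) x ^ p ∂(Wm ω) ≤
        C * ∫⁻ x, radMax n Φ f x ^ p ∂(Wm ω) := by
  set Ψ : SchwartzMap (En n) ℂ := (FourierTransform.fourier Φ : SchwartzMap (En n) ℂ) with hΨd
  have hΨ : Ψ 0 ≠ 0 := by
    have : Ψ 0 = ∫ x, Φ x := by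
      rw [hΨd, SchwartzMap.fourier_coe, Real.fourier_eq']
      simp
    rwa [this]
  obtain ⟨l, hl⟩ := exists_nat_ge (max 1 ((n : ℝ) / s))
  have hl1 : 1 ≤ l := by exact_mod_cast (le_max_left _ _).trans hl
  have hls : (n : ℝ) ≤ l * s := by
    rw [← div_le_iff₀ hs0]; exact (le_max_right _ _).trans hl
  obtain ⟨C, hC, HC⟩ := peetre_final Ψ η hη1 hη2 hΨ l hl1 s hs0 hs1 hls
  refine ⟨ENNReal.ofReal (C * 2 ^ l) ^ p * (K ^ 2 * (16 * D * dyC 1)), ?_, ?_⟩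
  · refine ENNReal.mul_lt_top (ENNReal.rpow_lt_top_of_nonneg hp.le ENNReal.ofReal_ne_top)
      (ENNReal.mul_lt_top (ENNReal.pow_lt_top hK) (ENNReal.mul_lt_top
        (ENNReal.mul_lt_top (by norm_num) hDt) (dyC_lt_top one_pos)))
  intro f
  set F : SchwartzMap (En n) ℂ := (FourierTransform.fourier f : SchwartzMap (En n) ℂ) with hF
  have hFi : Integrable (F : En n → ℂ) := SchwartzMap.integrable (μ := volume) F
  have hg0 := radMax_measurable Φ f
  set g0 := radMax n Φ f with hg0d
  have hb : ∀ t y, 0 < t → ‖um Ψ F t y‖ₑ ≤ g0 y := by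
    intro t y ht
    rw [hΨd, hF, ← radMax_integrand Φ f ht, hg0d]
    unfold radMax
    exact le_iSup₂_of_le t ht le_rfl
  have hx : ∀ x, ntm η F x ≤ ENNReal.ofReal (C * 2 ^ l) *
      Mx volume (fun z => g0 z ^ s) x ^ (1 / s) := by
    intro x
    unfold ntm
    refine iSup_le fun t => iSup_le fun y => iSup_le fun ht => iSup_le fun hxy => ?_
    refine (HC F g0 hFi hg0 hb x t y ht).trans ?_
    have : ‖x - y‖ / t ≤ 1 := by
      rw [div_le_one ht, ← dist_eq_norm]; exact (Metric.mem_ball.1 hxy).le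
    gcongr
    linarith
  have hxp : ∀ x, ntm η F x ^ p ≤ ENNReal.ofReal (C * 2 ^ l) ^ p *
      (K ^ 2 * Mx (Wm ω) (fun z => (g0 z ^ s) ^ q) x ^ 2) := by
    intro x
    refine (ENNReal.rpow_le_rpow (hx x) hp.le).trans ?_
    rw [ENNReal.mul_rpow_of_nonneg _ _ hp.le, ← ENNReal.rpow_mul]
    have e : 1 / s * p = q * (2 : ℕ) := by rw [hps]; push_cast; field_simp
    rw [e, ENNReal.rpow_mul, ENNReal.rpow_natCast, ← mul_pow]
    gcongr
    exact Mx_vol_le hD hq H (hg0.pow_const s) x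
  have hM : Measurable (fun x => Mx (Wm ω) (fun z => (g0 z ^ s) ^ q) x) := measurable_Mx _ _
  refine (lintegral_mono hxp).trans ?_
  rw [lintegral_const_mul _ ((hM.pow_const 2).const_mul _), lintegral_const_mul _ (hM.pow_const 2),
    mul_assoc, mul_assoc]
  gcongr
  refine (Mx_strong hD _ ((hg0.pow_const s).pow_const q)).trans (le_of_eq ?_)
  congr 1
  refine lintegral_congr fun z => ?_
  rw [← ENNReal.rpow_natCast, ← ENNReal.rpow_mul, ← ENNReal.rpow_mul]
  congr 1
  rw [hps]; push_cast; ring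

theorem final {n : ℕ} (hn : 1 ≤ n) (δ p : ℝ) (hδ : ((n:ℝ)-1)/2 < δ) (hp0 : 0<p)
    (hplow : 2*(n:ℝ)/((n:ℝ)+1+2*δ) ≤ p) (ω : En n → ℝ≥0∞) (hωmeas : Measurable ω)
    (hωloc : ∀ (x : En n) (r : ℝ), 0<r → (∫⁻ y in Metric.ball x r, ω y) < ⊤)
    (hω : IsAp n (p*((n:ℝ)+1+2*δ)/(2*(n:ℝ))) ω) (Φ : SchwartzMap (En n) ℂ)
    (hΦ : (∫ x, Φ x) ≠ 0) :
    ∃ C : ℝ≥0, 0 < C ∧ ∀ f : SchwartzMap (En n) ℂ,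
      wWLp n ω p (brMax n δ ⇑f) ≤ (C:ℝ≥0∞) * wLp n ω p (radMax n ⇑Φ ⇑f) := by
  have hn0 : (1 : ℝ) ≤ n := by exact_mod_cast hn
  have hN : (n : ℝ) < ((n : ℝ) + 1) / 2 + δ := by linarith
  set N := ((n : ℝ) + 1) / 2 + δ with hNd
  set q := p*((n:ℝ)+1+2*δ)/(2*(n:ℝ)) with hqd
  have hNN : (n : ℝ) + 1 + 2 * δ = 2 * N := by rw [hNd]; ring
  have hqN : q = p * (N / n) := by rw [hqd, hNN]; field_simp
  have hq1 : 1 ≤ q := by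
    rw [hNN, div_le_iff₀ (by linarith)] at hplow
    rw [hqd, hNN, le_div_iff₀ (by linarith)]; linarith
  have hr1 : 1 < N / n := by rw [one_lt_div (by linarith)]; exact hN
  obtain ⟨K, hK, H⟩ := Ap_Pq hq1 ω hωmeas hωloc hω
  rcases Wm_zero_or_setP hq1 ω hωloc K H with hz | hS
  · refine ⟨1, one_pos, fun f => ?_⟩
    have : wWLp n ω p (brMax n δ ⇑f) = 0 := by
      unfold wWLp
      simp only [ENNReal.iSup_eq_zero]
      intro α _
      have h1 : ∫⁻ x in {x | (α : ℝ≥0∞) < brMax n δ f x}, ω x = 0 := by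
        have := withDensity_apply_le (μ := volume) ω {x | (α : ℝ≥0∞) < brMax n δ f x}
        change _ ≤ Wm ω _ at this
        rw [hz] at this
        simpa using this
      rw [h1, ENNReal.zero_rpow_of_pos (by positivity), mul_zero]
    rw [this]; exact zero_le
  obtain ⟨η, hη1, hη2⟩ := exists_eta n
  have hD := hS.Dbl (by linarith)
  have hDt : K * ENNReal.ofReal (5 ^ n) ^ q < ⊤ := ENNReal.mul_lt_top hK
    (ENNReal.rpow_lt_top_of_nonneg (by linarith) ENNReal.ofReal_ne_top)
  have hs0 : 0 < n / (2 * N) := div_pos (by linarith) (by linarith)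
  have hs1 : n / (2 * N) < 1 := by rw [div_lt_one (by linarith)]; linarith
  have hN0 : N ≠ 0 := by linarith
  obtain ⟨C1, hC1, H1⟩ := ntm_Lp hp0 hq1 hs0 hs1 (by rw [hqN]; field_simp) ω hD hDt hK H Φ η hΦ hη1 hη2
  obtain ⟨C2, hC2, H2⟩ := sum_lemma hn hp0 hr1 hqN hq1 ω hωmeas hωloc hω hK hS
  obtain ⟨C3, hC3, hC30, H3⟩ := brMax_level hn hδ η hη1
  have hCt : ((2 * C3) ^ p * (C2 * dyC p * C1)) ^ (1 / p) < ⊤ := by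
    refine ENNReal.rpow_lt_top_of_nonneg (by positivity) (ENNReal.mul_lt_top
      (ENNReal.rpow_lt_top_of_nonneg hp0.le (ENNReal.mul_lt_top (by norm_num) hC3).ne)
      (ENNReal.mul_lt_top (ENNReal.mul_lt_top hC2 (dyC_lt_top hp0)) hC1)).ne
  refine ⟨(((2 * C3) ^ p * (C2 * dyC p * C1)) ^ (1 / p)).toNNReal + 1, by positivity, fun f => ?_⟩
  have key : wWLp n ω p (brMax n δ ⇑f) ≤
      ((2 * C3) ^ p * (C2 * dyC p * C1)) ^ (1 / p) * wLp n ω p (radMax n ⇑Φ ⇑f) := by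
    unfold wWLp
    refine iSup_le fun α => iSup_le fun hα => ?_
    set F : SchwartzMap (En n) ℂ := (FourierTransform.fourier f : SchwartzMap (En n) ℂ) with hF
    have h2C0 : 2 * C3 ≠ 0 := mul_ne_zero (by norm_num) hC30
    have h2Ct : 2 * C3 ≠ ⊤ := (ENNReal.mul_lt_top (by norm_num) hC3).ne
    have hα0 : (α : ℝ≥0∞) ≠ 0 := by exact_mod_cast hα.ne'
    set τ : ℝ≥0∞ := α / (2 * C3) with hτ
    have hτ0 : τ ≠ 0 := (ENNReal.div_pos hα0 h2Ct).ne'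
    have hτt : τ ≠ ⊤ := (ENNReal.div_lt_top ENNReal.coe_ne_top h2C0).ne
    have hατ : (α : ℝ≥0∞) = 2 * C3 * τ := (ENNReal.mul_div_cancel h2C0 h2Ct).symm
    set E : ℕ → Set (En n) := fun k => {z | 2 ^ k * τ < ntm η F z} with hE
    have hsub : {x | (α : ℝ≥0∞) < brMax n δ f x} ⊆
        {x | 1 / 2 < ∑' k : ℕ, 2 ^ k * (Mset (E k) x) ^ (N / n)} := by
      intro x hx
      have hx1 : (α : ℝ≥0∞) < brMax n δ f x := hx
      have h4 := hx1.trans_le (H3 f x τ hτ0 hτt)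
      change 1 / 2 < ∑' k : ℕ, 2 ^ k * (Mset (E k) x) ^ (N / n)
      change _ < C3 * τ * (1 + ∑' k : ℕ, 2 ^ k * (Mset (E k) x) ^ (N / n)) at h4
      by_contra hc
      push Not at hc
      have h5 : C3 * τ * (1 + ∑' k : ℕ, 2 ^ k * (Mset (E k) x) ^ (N / n)) ≤ C3 * τ * 2 := by
        gcongr
        calc _ ≤ (1 : ℝ≥0∞) + 1 := by
              gcongr
              refine hc.trans ?_
              rw [one_div]; exact ENNReal.inv_le_one.2 (by norm_num)
          _ = 2 := by norm_num
      have h6 := h4.trans_le h5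
      rw [hατ] at h6
      exact absurd h6 (not_lt.2 (le_of_eq (by ring)))
    have hW : ∫⁻ x in {x | (α : ℝ≥0∞) < brMax n δ f x}, ω x ≤
        C2 * ∑' k : ℕ, ((2 : ℝ≥0∞) ^ k) ^ p * Wm ω (E k) :=
      (withDensity_apply_le (μ := volume) ω _).trans ((measure_mono hsub).trans
        (H2 E fun k => isOpen_ntm _ _ _))
    have h7 := dyadic_level (Wm ω) hp0 (measurable_ntm η F) τ hτ0 hτt
    have h8 : ∫⁻ x, radMax n Φ f x ^ p ∂(Wm ω) = ∫⁻ x, radMax n Φ f x ^ p * ω x := by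
      unfold Wm
      rw [lintegral_withDensity_eq_lintegral_mul _ hωmeas ((radMax_measurable Φ f).pow_const p)]
      refine lintegral_congr fun x => ?_
      simp only [Pi.mul_apply]; ring
    have h9 : (α : ℝ≥0∞) ^ p * ∫⁻ x in {x | (α : ℝ≥0∞) < brMax n δ f x}, ω x ≤
        ((2 * C3) ^ p * (C2 * dyC p * C1)) * ∫⁻ x, radMax n Φ f x ^ p * ω x := by
      calc _ ≤ (α : ℝ≥0∞) ^ p * (C2 * ∑' k : ℕ, ((2 : ℝ≥0∞) ^ k) ^ p * Wm ω (E k)) := by gcongr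
        _ = (2 * C3) ^ p * C2 * (τ ^ p * ∑' k : ℕ, ((2 : ℝ≥0∞) ^ k) ^ p * Wm ω (E k)) := by
            rw [hατ, ENNReal.mul_rpow_of_nonneg _ _ hp0.le]; ring
        _ ≤ (2 * C3) ^ p * C2 * (dyC p * (C1 * ∫⁻ x, radMax n Φ f x ^ p * ω x)) := by
            rw [← h8]
            exact mul_le_mul_right (h7.trans (mul_le_mul_right (H1 f) _)) _
        _ = _ := by ring
    unfold wLp
    have h10 := ENNReal.rpow_le_rpow h9 (z := 1 / p) (by positivity)
    rw [ENNReal.mul_rpow_of_nonneg _ _ (by positivity), ENNReal.mul_rpow_of_nonneg _ _ (by positivity),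
      ← ENNReal.rpow_mul, mul_one_div_cancel hp0.ne', ENNReal.rpow_one] at h10
    exact h10
  refine key.trans ?_
  gcongr
  rw [ENNReal.coe_add, ENNReal.coe_toNNReal hCt.ne]
  exact le_self_add

end BR

theorem maximalBochnerRiesz_weightedHardy_to_weakWeightedLebesgue {n : ℕ} (hn : 1 ≤ n) (δ p : ℝ)
    (hδ : ((n : ℝ) - 1) / 2 < δ) (hp0 : 0 < p)
    (hplow : 2 * (n : ℝ) / ((n : ℝ) + 1 + 2 * δ) ≤ p)
    (ω : En n → ℝ≥0∞) (hωmeas : Measurable ω)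
    (hωloc : ∀ (x : En n) (r : ℝ), 0 < r → (∫⁻ y in Metric.ball x r, ω y) < ⊤)
    (hω : IsAp n (p * ((n : ℝ) + 1 + 2 * δ) / (2 * (n : ℝ))) ω)
    (Φ : SchwartzMap (En n) ℂ) (hΦ : (∫ x, Φ x) ≠ 0) :
    ∃ C : ℝ≥0, 0 < C ∧ ∀ f : SchwartzMap (En n) ℂ,
      wWLp n ω p (brMax n δ (⇑f)) ≤
        (C : ℝ≥0∞) * wLp n ω p (radMax n (⇑Φ) (⇑f)) :=
  BR.final hn δ p hδ hp0 hplow ω hωmeas hωloc hω Φ hΦ
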